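/- Every real von Neumann algebra has the Mazur–Ulam property: if M is a von Neumann algebra on a complex Hilbert space, J : M → M is a conjugate-linear *-automorphism with J² = id, and A := {x ∈ M : J(x) = x} is the associated real von Neumann algebra regarded as a real Banach space, then for every real normed space Y, every surjective isometry from the unit sphere S_A onto S_Y extends to a surjective real linear isometry from A onto Y. -/

import Mathlib

/-- A real normed space `X` has the *Mazur–Ulam property* if for every real normed space `Y`,
every surjective isometry from the unit sphere of `X` onto the unit sphere of `Y` extends to
a surjective real linear isometry from `X` onto `Y`. -/
def HasMazurUlamProperty (X : Type*) [NormedAddCommGroup X] [NormedSpace ℝ X] : Prop :=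
  ∀ (Y : Type*) [NormedAddCommGroup Y] [NormedSpace ℝ Y] (T : X → Y),
    (∀ x ∈ Metric.sphere (0 : X) 1, ∀ y ∈ Metric.sphere (0 : X) 1,
      dist (T x) (T y) = dist x y) →
    T '' Metric.sphere (0 : X) 1 = Metric.sphere (0 : Y) 1 →
    ∃ g : X →ₗᵢ[ℝ] Y, Function.Surjective g ∧ ∀ x ∈ Metric.sphere (0 : X) 1, g x = T x

set_option linter.unusedSectionVars false

/-! ### Isometries between unit spheres -/

section SphereIsometry

variable {X Y : Type*} [NormedAddCommGroup X] [NormedSpace ℝ X]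
  [NormedAddCommGroup Y] [NormedSpace ℝ Y]

/-- A map which restricts to a surjective isometry between the unit spheres. -/
structure IsSphereIsometry (T : X → Y) : Prop where
  norm_sub : ∀ x y : X, ‖x‖ = 1 → ‖y‖ = 1 → ‖T x - T y‖ = ‖x - y‖
  norm_map : ∀ x : X, ‖x‖ = 1 → ‖T x‖ = 1
  surj : ∀ y : Y, ‖y‖ = 1 → ∃ x : X, ‖x‖ = 1 ∧ T x = y

/-- The intersection of all stars containing a point of the unit sphere. -/
def starHull (x : X) : Set X :=
  {y | ‖y‖ = 1 ∧ ∀ w, ‖w‖ = 1 → ‖x + w‖ = 2 → ‖y + w‖ = 2}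

theorem exists_dual_eq_one_of_norm_add_eq_two {a b : X} (ha : ‖a‖ = 1) (hb : ‖b‖ = 1)
    (hab : ‖a + b‖ = 2) : ∃ φ : X →L[ℝ] ℝ, ‖φ‖ ≤ 1 ∧ φ a = 1 ∧ φ b = 1 := by
  obtain ⟨φ, hφ, h⟩ := exists_dual_vector'' ℝ (a + b)
  have h1 : φ a ≤ 1 := by
    have := φ.le_of_opNorm_le hφ a
    rw [ha] at this
    exact (le_abs_self _).trans (by simpa using this)
  have h2 : φ b ≤ 1 := by
    have := φ.le_of_opNorm_le hφ b
    rw [hb] at this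
    exact (le_abs_self _).trans (by simpa using this)
  rw [map_add, hab] at h
  norm_num at h
  exact ⟨φ, hφ, by linarith, by linarith⟩

theorem norm_eq_of_dual {φ : X →L[ℝ] ℝ} (hφ : ‖φ‖ ≤ 1) {x : X} {r : ℝ} (h : φ x = r)
    (hx : ‖x‖ ≤ r) : ‖x‖ = r := by
  refine le_antisymm hx ?_
  have := φ.le_of_opNorm_le hφ x
  rw [one_mul, h] at this
  exact (le_abs_self _).trans this

theorem dual_le_norm {φ : X →L[ℝ] ℝ} (hφ : ‖φ‖ ≤ 1) (x : X) : φ x ≤ ‖x‖ := by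
  have := φ.le_of_opNorm_le hφ x
  rw [one_mul] at this
  exact (le_abs_self _).trans this

theorem norm_add_eq_two_of_dual {φ : X →L[ℝ] ℝ} (hφ : ‖φ‖ ≤ 1) {x y : X} (hx : ‖x‖ = 1)
    (hy : ‖y‖ = 1) (h1 : φ x = 1) (h2 : φ y = 1) : ‖x + y‖ = 2 := by
  refine norm_eq_of_dual hφ (by rw [map_add, h1, h2]; norm_num) ?_
  exact (norm_add_le _ _).trans (by rw [hx, hy]; norm_num)

theorem norm_midpoint_eq_one {a b : X} (hab : ‖a + b‖ = 2) : ‖(1 / 2 : ℝ) • (a + b)‖ = 1 := by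
  rw [norm_smul, hab]; norm_num

theorem self_mem_starHull {x : X} (hx : ‖x‖ = 1) : x ∈ starHull x := ⟨hx, fun _ _ h => h⟩

theorem dual_eq_one_of_midpoint {φ : X →L[ℝ] ℝ} (hφ : ‖φ‖ ≤ 1) {a b : X} (ha : ‖a‖ = 1)
    (hb : ‖b‖ = 1) (h : φ ((1 / 2 : ℝ) • (a + b)) = 1) : φ a = 1 ∧ φ b = 1 := by
  have h1 := dual_le_norm hφ a
  have h2 := dual_le_norm hφ b
  rw [ha] at h1
  rw [hb] at h2
  rw [map_smul, map_add, smul_eq_mul] at h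
  constructor <;> linarith

theorem mem_starHull_midpoint {a b : X} (ha : ‖a‖ = 1) (hb : ‖b‖ = 1) (hab : ‖a + b‖ = 2) :
    a ∈ starHull ((1 / 2 : ℝ) • (a + b)) := by
  refine ⟨ha, fun w hw h => ?_⟩
  obtain ⟨φ, hφ, h1, h2⟩ := exists_dual_eq_one_of_norm_add_eq_two (norm_midpoint_eq_one hab) hw h
  obtain ⟨h3, -⟩ := dual_eq_one_of_midpoint hφ ha hb h1
  exact norm_add_eq_two_of_dual hφ ha hw h3 h2

theorem convex_starHull {x : X} (hx : ‖x‖ = 1) : Convex ℝ (starHull x) := by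
  intro y₁ hy₁ y₂ hy₂ a b ha hb hab
  have key : ∀ w, ‖w‖ = 1 → ‖x + w‖ = 2 →
      ∃ φ : X →L[ℝ] ℝ, ‖φ‖ ≤ 1 ∧ φ w = 1 ∧ φ y₁ = 1 ∧ φ y₂ = 1 := by
    intro w hw hxw
    obtain ⟨φ, hφ, h1, h2⟩ := exists_dual_eq_one_of_norm_add_eq_two hx hw hxw
    have hw1 := norm_midpoint_eq_one hxw
    set w₁ := (1 / 2 : ℝ) • (x + w) with hw₁
    have hφw1 : φ w₁ = 1 := by rw [hw₁, map_smul, map_add, h1, h2]; norm_num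
    have h3 := hy₁.2 w₁ hw1 (norm_add_eq_two_of_dual hφ hx hw1 h1 hφw1)
    obtain ⟨ψ, hψ, h4, h5⟩ := exists_dual_eq_one_of_norm_add_eq_two hy₁.1 hw1 h3
    obtain ⟨h6, h7⟩ := dual_eq_one_of_midpoint hψ hx hw h5
    have hw2 := norm_midpoint_eq_one h3
    set w₂ := (1 / 2 : ℝ) • (y₁ + w₁) with hw₂
    have hψw2 : ψ w₂ = 1 := by rw [hw₂, map_smul, map_add, h4, h5]; norm_num
    have h8 := hy₂.2 w₂ hw2 (norm_add_eq_two_of_dual hψ hx hw2 h6 hψw2)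
    obtain ⟨θ, hθ, h9, h10⟩ := exists_dual_eq_one_of_norm_add_eq_two hy₂.1 hw2 h8
    obtain ⟨h11, h12⟩ := dual_eq_one_of_midpoint hθ hy₁.1 hw1 h10
    obtain ⟨h13, h14⟩ := dual_eq_one_of_midpoint hθ hx hw h12
    exact ⟨θ, hθ, h14, h11, h9⟩
  have hle : ‖a • y₁ + b • y₂‖ ≤ 1 := by
    refine (norm_add_le _ _).trans ?_
    rw [norm_smul, norm_smul, hy₁.1, hy₂.1, Real.norm_of_nonneg ha, Real.norm_of_nonneg hb]
    linarith
  have hval : ∀ φ : X →L[ℝ] ℝ, φ y₁ = 1 → φ y₂ = 1 → φ (a • y₁ + b • y₂) = 1 := by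
    intro φ h1 h2
    rw [map_add, map_smul, map_smul, h1, h2, smul_eq_mul, smul_eq_mul]; linarith
  have hxx : ‖x + x‖ = 2 := by rw [← two_smul ℝ x, norm_smul, hx]; norm_num
  obtain ⟨φ, hφ, -, h1, h2⟩ := key x hx hxx
  have hn : ‖a • y₁ + b • y₂‖ = 1 := norm_eq_of_dual hφ (hval φ h1 h2) hle
  refine ⟨hn, fun w hw hxw => ?_⟩
  obtain ⟨ψ, hψ, h3, h4, h5⟩ := key w hw hxw
  exact norm_add_eq_two_of_dual hψ hn hw (hval ψ h4 h5) h3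

namespace IsSphereIsometry

variable {T : X → Y}

theorem neg_comp_neg (hT : IsSphereIsometry T) : IsSphereIsometry (fun x => -T (-x)) where
  norm_sub x y hx hy := by
    have := hT.norm_sub (-x) (-y) (by simpa) (by simpa)
    rw [neg_sub_neg, norm_sub_rev, this, neg_sub_neg, norm_sub_rev]
  norm_map x hx := by
    rw [norm_neg]; exact hT.norm_map _ (by simpa)
  surj y hy := by
    obtain ⟨x, hx, h⟩ := hT.surj (-y) (by simpa)
    exact ⟨-x, by simpa, by simp [h]⟩

theorem norm_add_neg_comp_neg (hT : IsSphereIsometry T) {x y : X} (hx : ‖x‖ = 1) (hy : ‖y‖ = 1) :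
    ‖T x + -T (-y)‖ = ‖x + y‖ := by
  rw [← sub_eq_add_neg, hT.norm_sub x (-y) hx (by simpa), sub_neg_eq_add]

theorem map_starHull (hT : IsSphereIsometry T) {x y : X} (hx : ‖x‖ = 1) (hy : ‖y‖ = 1) :
    T y ∈ starHull (T x) ↔ y ∈ starHull x := by
  constructor
  · rintro ⟨-, h⟩
    refine ⟨hy, fun w hw hxw => ?_⟩
    rw [← hT.norm_add_neg_comp_neg hx hw] at hxw
    rw [← hT.norm_add_neg_comp_neg hy hw]
    exact h _ (hT.neg_comp_neg.norm_map w hw) hxw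
  · rintro ⟨-, h⟩
    refine ⟨hT.norm_map y hy, fun w hw hxw => ?_⟩
    obtain ⟨v, hv, rfl⟩ := hT.neg_comp_neg.surj w hw
    rw [hT.norm_add_neg_comp_neg hx hv] at hxw
    rw [hT.norm_add_neg_comp_neg hy hv]
    exact h _ hv hxw

theorem image_starHull (hT : IsSphereIsometry T) {x : X} (hx : ‖x‖ = 1) :
    T '' starHull x = starHull (T x) := by
  ext z
  constructor
  · rintro ⟨y, hy, rfl⟩
    exact (hT.map_starHull hx hy.1).2 hy
  · intro hz
    obtain ⟨y, hy, rfl⟩ := hT.surj z hz.1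
    exact ⟨y, (hT.map_starHull hx hy).1 hz, rfl⟩

theorem norm_add_eq_two (hT : IsSphereIsometry T) {x y : X} (hx : ‖x‖ = 1) (hy : ‖y‖ = 1)
    (hxy : ‖x + y‖ = 2) : ‖T x + T y‖ = 2 := by
  have hm := norm_midpoint_eq_one hxy
  have h1 := (hT.map_starHull hm hx).2 (mem_starHull_midpoint hx hy hxy)
  have h2 := (hT.map_starHull hm hy).2
    (by rw [add_comm x y]; exact mem_starHull_midpoint hy hx (by rwa [add_comm]))
  have h3 := (convex_starHull (hT.norm_map _ hm) h1 h2 (a := 1 / 2) (b := 1 / 2) (by norm_num)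
    (by norm_num) (by norm_num)).1
  rw [← smul_add, norm_smul] at h3
  norm_num at h3
  linarith

theorem starHull_neg_comp_neg (hT : IsSphereIsometry T) {x : X} (hx : ‖x‖ = 1) :
    starHull (-T (-x)) = starHull (T x) := by
  have key : ∀ w, ‖w‖ = 1 → (‖-T (-x) + w‖ = 2 ↔ ‖T x + w‖ = 2) := by
    intro w hw
    constructor
    · intro h
      obtain ⟨v, hv, rfl⟩ := hT.surj w hw
      rw [add_comm, hT.norm_add_neg_comp_neg hv hx] at h
      rw [add_comm]
      exact hT.norm_add_eq_two hv hx h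
    · intro h
      obtain ⟨v, hv, rfl⟩ := hT.neg_comp_neg.surj w hw
      rw [hT.norm_add_neg_comp_neg hx hv] at h
      exact hT.neg_comp_neg.norm_add_eq_two hx hv h
  ext z
  simp only [starHull, Set.mem_ofPred_eq]
  refine and_congr_right fun _ => forall_congr' fun w => forall_congr' fun hw => ?_
  rw [key w hw]

theorem image_starHull_eq (hT : IsSphereIsometry T) {x : X} (hx : ‖x‖ = 1) :
    (fun x => -T (-x)) '' starHull x = T '' starHull x := by
  rw [hT.image_starHull hx, hT.neg_comp_neg.image_starHull hx, hT.starHull_neg_comp_neg hx]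

theorem map_neg_of_starHull_eq_singleton (hT : IsSphereIsometry T) {u : X} (hu : ‖u‖ = 1)
    (h : ∀ y ∈ starHull u, y = u) : -T (-u) = T u := by
  have h1 : -T (-u) ∈ T '' starHull u := by
    rw [← hT.image_starHull_eq hu]
    exact ⟨u, self_mem_starHull hu, rfl⟩
  obtain ⟨y, hy, hy'⟩ := h1
  rw [← hy', h y hy]

end IsSphereIsometry

end SphereIsometry

/-! ### Isometries on balls with many extreme directions -/

section BallIsometry

variable {E Y : Type*} [NormedAddCommGroup E] [NormedSpace ℝ E]
  [NormedAddCommGroup Y] [NormedSpace ℝ Y]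

/-- A vector of the unit ball whose two antipodal unit balls meet only at the origin. -/
def IsExtremeDirection (u : E) : Prop :=
  ‖u‖ ≤ 1 ∧ ∀ c : E, ‖c + u‖ ≤ 1 → ‖c - u‖ ≤ 1 → c = 0

theorem IsExtremeDirection.neg {u : E} (hu : IsExtremeDirection u) : IsExtremeDirection (-u) :=
  ⟨by simpa using hu.1, fun c h1 h2 => hu.2 c (by simpa using h2)
    (by simpa [sub_eq_add_neg] using h1)⟩

/-- An isometric map on the closed unit ball with convex image. -/
structure IsBallIsometry (S : E → Y) : Prop where
  norm_sub : ∀ x y : E, ‖x‖ ≤ 1 → ‖y‖ ≤ 1 → ‖S x - S y‖ = ‖x - y‖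
  midpoint : ∀ x y : E, ‖x‖ ≤ 1 → ‖y‖ ≤ 1 → ∃ z : E, ‖z‖ ≤ 1 ∧ S z = (1 / 2 : ℝ) • (S x + S y)

namespace IsBallIsometry

variable {S : E → Y}

theorem eq_of_extreme (hS : IsBallIsometry S) {x u z : E} {r : ℝ} (hr : 0 ≤ r)
    (hu : IsExtremeDirection u) (hx : ‖x‖ + r ≤ 1) (hz : ‖z‖ ≤ 1)
    (h1 : ‖S z - S (x + r • u)‖ ≤ r) (h2 : ‖S z - S (x - r • u)‖ ≤ r) : z = x := by
  have hru : ‖r • u‖ ≤ r := by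
    rw [norm_smul, Real.norm_of_nonneg hr]; exact mul_le_of_le_one_right hr hu.1
  have hb1 : ‖x + r • u‖ ≤ 1 := (norm_add_le _ _).trans (by linarith)
  have hb2 : ‖x - r • u‖ ≤ 1 := (norm_sub_le _ _).trans (by linarith)
  rw [hS.norm_sub _ _ hz hb1] at h1
  rw [hS.norm_sub _ _ hz hb2] at h2
  rcases hr.eq_or_lt with rfl | hr'
  · simp only [zero_smul, add_zero] at h1
    exact sub_eq_zero.1 (norm_le_zero_iff.1 h1)
  · have h3 := hu.2 (r⁻¹ • (z - x))
    have e1 : r⁻¹ • (z - x) + u = r⁻¹ • (z - (x - r • u)) := by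
      rw [sub_sub_eq_add_sub, add_sub_right_comm, smul_add, smul_smul, inv_mul_cancel₀ hr'.ne',
        one_smul]
    have e2 : r⁻¹ • (z - x) - u = r⁻¹ • (z - (x + r • u)) := by
      rw [← sub_sub, smul_sub _ _ (r • u), smul_smul, inv_mul_cancel₀ hr'.ne', one_smul]
    rw [e1, e2, norm_smul, norm_smul, norm_inv, Real.norm_of_nonneg hr, inv_mul_le_iff₀ hr',
      inv_mul_le_iff₀ hr', mul_one, smul_eq_zero] at h3
    rcases h3 h2 h1 with h | h
    · exact absurd h (inv_ne_zero hr'.ne')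
    · exact sub_eq_zero.1 h

theorem add_eq_two_smul (hS : IsBallIsometry S) {x u : E} {r : ℝ} (hr : 0 ≤ r)
    (hu : IsExtremeDirection u) (hx : ‖x‖ + r ≤ 1) :
    S (x + r • u) + S (x - r • u) = (2 : ℝ) • S x := by
  have hru : ‖r • u‖ ≤ r := by
    rw [norm_smul, Real.norm_of_nonneg hr]; exact mul_le_of_le_one_right hr hu.1
  have hb1 : ‖x + r • u‖ ≤ 1 := (norm_add_le _ _).trans (by linarith)
  have hb2 : ‖x - r • u‖ ≤ 1 := (norm_sub_le _ _).trans (by linarith)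
  obtain ⟨z, hz, hz'⟩ := hS.midpoint _ _ hb1 hb2
  have hd : ‖S (x + r • u) - S (x - r • u)‖ ≤ 2 * r := by
    rw [hS.norm_sub _ _ hb1 hb2, show x + r • u - (x - r • u) = (2 : ℝ) • (r • u) by
      rw [two_smul]; abel, norm_smul]
    norm_num
    exact hru
  have hzx : z = x := by
    refine hS.eq_of_extreme hr hu hx hz ?_ ?_
    · rw [hz', show (1 / 2 : ℝ) • (S (x + r • u) + S (x - r • u)) - S (x + r • u) =
        (-(1 / 2) : ℝ) • (S (x + r • u) - S (x - r • u)) by module, norm_smul]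
      norm_num
      linarith
    · rw [hz', show (1 / 2 : ℝ) • (S (x + r • u) + S (x - r • u)) - S (x - r • u) =
        ((1 / 2) : ℝ) • (S (x + r • u) - S (x - r • u)) by module, norm_smul]
      norm_num
      linarith
  rw [← hzx, hz', smul_smul]
  norm_num [hzx]

theorem increment_eq_of_nonneg (hS : IsBallIsometry S) {x u₁ u₂ : E} {s t : ℝ} (hs : 0 ≤ s)
    (ht : 0 ≤ t) (hu₁ : IsExtremeDirection u₁) (hu₂ : IsExtremeDirection u₂)
    (hx : ‖x‖ + s + t ≤ 1) :
    S (x + t • u₂ + s • u₁) - S (x + t • u₂) = S (x + s • u₁) - S x := by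
  have hsu : ‖s • u₁‖ ≤ s := by
    rw [norm_smul, Real.norm_of_nonneg hs]; exact mul_le_of_le_one_right hs hu₁.1
  have htu : ‖t • u₂‖ ≤ t := by
    rw [norm_smul, Real.norm_of_nonneg ht]; exact mul_le_of_le_one_right ht hu₂.1
  have n1 := norm_add_le x (s • u₁)
  have n2 := norm_sub_le x (s • u₁)
  have n3 := norm_add_le x (t • u₂)
  have n4 := norm_add_le (x + s • u₁) (t • u₂)
  have n5 := norm_sub_le (x + s • u₁) (t • u₂)
  have n6 := norm_add_le (x - s • u₁) (t • u₂)
  have n7 := norm_sub_le (x - s • u₁) (t • u₂)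
  have ab := hS.add_eq_two_smul (x := x + s • u₁) ht hu₂ (by linarith)
  have cd := hS.add_eq_two_smul (x := x - s • u₁) ht hu₂ (by linarith)
  have ac := hS.add_eq_two_smul (x := x + t • u₂) hs hu₁ (by linarith)
  have x1 := hS.add_eq_two_smul (x := x) hs hu₁ (by linarith)
  rw [show x + t • u₂ + s • u₁ = x + s • u₁ + t • u₂ by abel,
    show x + t • u₂ - s • u₁ = x - s • u₁ + t • u₂ by abel] at ac
  rw [show x + t • u₂ + s • u₁ = x + s • u₁ + t • u₂ by abel]
  have hbd := hS.norm_sub (x - s • u₁ - t • u₂) (x + s • u₁ - t • u₂) (by linarith) (by linarith)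
  have hac := hS.norm_sub (x + s • u₁ + t • u₂) (x - s • u₁ + t • u₂) (by linarith) (by linarith)
  rw [show x - s • u₁ - t • u₂ - (x + s • u₁ - t • u₂) = (-2 : ℝ) • (s • u₁) by module,
    norm_smul] at hbd
  rw [show x + s • u₁ + t • u₂ - (x - s • u₁ + t • u₂) = (2 : ℝ) • (s • u₁) by module,
    norm_smul] at hac
  norm_num at hbd hac
  obtain ⟨z, hz, hz'⟩ := hS.midpoint (x + s • u₁ + t • u₂) (x - s • u₁ - t • u₂) (by linarith)
    (by linarith)
  set a := S (x + s • u₁ + t • u₂)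
  set b := S (x + s • u₁ - t • u₂)
  set c := S (x - s • u₁ + t • u₂)
  set d := S (x - s • u₁ - t • u₂)
  have hp : S (x + s • u₁) = (1 / 2 : ℝ) • (a + b) := by rw [ab, smul_smul]; norm_num
  have hm : S (x - s • u₁) = (1 / 2 : ℝ) • (c + d) := by rw [cd, smul_smul]; norm_num
  have hq : S (x + t • u₂) = (1 / 2 : ℝ) • (a + c) := by rw [ac, smul_smul]; norm_num
  have hzx : z = x := by
    refine hS.eq_of_extreme hs hu₁ (by linarith) hz ?_ ?_
    · rw [hz', hp, show (1 / 2 : ℝ) • (a + d) - (1 / 2 : ℝ) • (a + b) = (1 / 2 : ℝ) • (d - b) by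
        module, norm_smul, hbd]
      norm_num
      linarith
    · rw [hz', hm, show (1 / 2 : ℝ) • (a + d) - (1 / 2 : ℝ) • (c + d) = (1 / 2 : ℝ) • (a - c) by
        module, norm_smul, hac]
      norm_num
      linarith
  have hx0 : S x = (1 / 2 : ℝ) • (a + d) := by rw [← hz', hzx]
  rw [hp, hm, hx0] at x1
  have hd : d = b + c - a := by
    have : (1 / 2 : ℝ) • (a + b) + (1 / 2 : ℝ) • (c + d) - (2 : ℝ) • (1 / 2 : ℝ) • (a + d) =
      (1 / 2 : ℝ) • (b + c - a - d) := by module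
    rw [x1, sub_self] at this
    have h := (smul_eq_zero.1 this.symm).resolve_left (by norm_num)
    exact (sub_eq_zero.1 h).symm
  rw [hp, hq, hx0, hd]
  module

theorem increment_eq (hS : IsBallIsometry S) {x u₁ u₂ : E} {s t : ℝ}
    (hu₁ : IsExtremeDirection u₁) (hu₂ : IsExtremeDirection u₂)
    (hx : ‖x‖ + |s| + |t| ≤ 1) :
    S (x + t • u₂ + s • u₁) - S (x + t • u₂) = S (x + s • u₁) - S x := by
  have main : ∀ v₁ v₂ : E, IsExtremeDirection v₁ → IsExtremeDirection v₂ →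
      s • u₁ = |s| • v₁ → t • u₂ = |t| • v₂ →
      S (x + t • u₂ + s • u₁) - S (x + t • u₂) = S (x + s • u₁) - S x := by
    intro v₁ v₂ h1 h2 h3 h4
    rw [h3, h4]
    exact hS.increment_eq_of_nonneg (abs_nonneg _) (abs_nonneg _) h1 h2 hx
  have hsplit : ∀ (r : ℝ) (u : E), IsExtremeDirection u → ∃ v, IsExtremeDirection v ∧
      r • u = |r| • v := by
    intro r u hu
    rcases le_total 0 r with h | h
    · exact ⟨u, hu, by rw [abs_of_nonneg h]⟩
    · exact ⟨-u, hu.neg, by rw [abs_of_nonpos h, smul_neg, neg_smul, neg_neg]⟩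
  obtain ⟨v₁, h1, h3⟩ := hsplit s u₁ hu₁
  obtain ⟨v₂, h2, h4⟩ := hsplit t u₂ hu₂
  exact main v₁ v₂ h1 h2 h3 h4

theorem exists_increment_eq_of_mem_span (hS : IsBallIsometry S) {U : Set E}
    (hU : ∀ u ∈ U, IsExtremeDirection u) {y : E} (hy : y ∈ Submodule.span ℝ U) :
    ∃ C : ℝ, ‖y‖ ≤ C ∧ ∀ u ∈ U, ∀ (x : E) (s t : ℝ), ‖x‖ + |s| + |t| * C ≤ 1 →
      S (x + t • y + s • u) - S (x + t • y) = S (x + s • u) - S x := by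
  induction hy using Submodule.span_induction with
  | mem v hv =>
    exact ⟨1, (hU v hv).1, fun u hu x s t h =>
      hS.increment_eq (hU u hu) (hU v hv) (by rwa [mul_one] at h)⟩
  | zero => exact ⟨0, by simp, by simp⟩
  | add y₁ y₂ _ _ h₁ h₂ =>
    obtain ⟨C₁, hC₁, h₁⟩ := h₁
    obtain ⟨C₂, hC₂, h₂⟩ := h₂
    refine ⟨C₁ + C₂, (norm_add_le _ _).trans (add_le_add hC₁ hC₂), fun u hu x s t h => ?_⟩
    have hn : ‖x + t • y₁‖ ≤ ‖x‖ + |t| * C₁ := (norm_add_le _ _).trans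
      (by rw [norm_smul, Real.norm_eq_abs]; gcongr)
    have hC₂' : 0 ≤ |t| * C₂ := mul_nonneg (abs_nonneg _) ((norm_nonneg _).trans hC₂)
    rw [mul_add] at h
    rw [smul_add, ← add_assoc, h₂ u hu (x + t • y₁) s t (by linarith), h₁ u hu x s t (by linarith)]
  | smul a y _ h =>
    obtain ⟨C, hC, h⟩ := h
    refine ⟨|a| * C, by rw [norm_smul, Real.norm_eq_abs]; gcongr, fun u hu x s t hx => ?_⟩
    rw [smul_smul]
    exact h u hu x s (t * a) (by rwa [abs_mul, mul_assoc])

theorem exists_increment_eq_of_mem_span₂ (hS : IsBallIsometry S) {U : Set E}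
    (hU : ∀ u ∈ U, IsExtremeDirection u) {y w : E} (hy : y ∈ Submodule.span ℝ U)
    (hw : w ∈ Submodule.span ℝ U) :
    ∃ C₁ C₂ : ℝ, ‖y‖ ≤ C₁ ∧ ‖w‖ ≤ C₂ ∧ ∀ (x : E) (s t : ℝ), ‖x‖ + |s| * C₂ + |t| * C₁ ≤ 1 →
      S (x + t • y + s • w) - S (x + t • y) = S (x + s • w) - S x := by
  obtain ⟨C₁, hC₁, hy⟩ := hS.exists_increment_eq_of_mem_span hU hy
  refine ⟨C₁, ?_⟩
  induction hw using Submodule.span_induction with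
  | mem v hv =>
    exact ⟨1, hC₁, (hU v hv).1, fun x s t h => hy v hv x s t (by linarith)⟩
  | zero => exact ⟨0, hC₁, by simp, by simp⟩
  | add w₁ w₂ _ _ h₁ h₂ =>
    obtain ⟨C₂, -, hC₂, h₁⟩ := h₁
    obtain ⟨C₃, -, hC₃, h₂⟩ := h₂
    refine ⟨C₂ + C₃, hC₁, (norm_add_le _ _).trans (add_le_add hC₂ hC₃), fun x s t h => ?_⟩
    have hn : ‖x + s • w₁‖ ≤ ‖x‖ + |s| * C₂ := (norm_add_le _ _).trans
      (by rw [norm_smul, Real.norm_eq_abs]; gcongr)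
    have hC₃' : 0 ≤ |s| * C₃ := mul_nonneg (abs_nonneg _) ((norm_nonneg _).trans hC₃)
    rw [mul_add] at h
    have e1 := h₁ x s t (by linarith)
    have e2 := h₂ (x + s • w₁) s t (by linarith)
    rw [show x + t • y + s • (w₁ + w₂) = x + s • w₁ + t • y + s • w₂ by module,
      show x + s • (w₁ + w₂) = x + s • w₁ + s • w₂ by module]
    rw [show x + t • y + s • w₁ = x + s • w₁ + t • y by abel] at e1
    rw [← sub_add_sub_cancel _ (S (x + s • w₁ + t • y)), e2, e1, sub_add_sub_cancel]
  | smul a w _ h =>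
    obtain ⟨C, -, hC, h⟩ := h
    refine ⟨|a| * C, hC₁, by rw [norm_smul, Real.norm_eq_abs]; gcongr, fun x s t hx => ?_⟩
    rw [smul_smul]
    exact h x (s * a) t (by rwa [abs_mul, mul_assoc])

theorem map_midpoint_of_mem_span (hS : IsBallIsometry S) {U : Set E}
    (hU : ∀ u ∈ U, IsExtremeDirection u) {y w : E} (hy : y ∈ Submodule.span ℝ U)
    (hw : w ∈ Submodule.span ℝ U) (hy1 : ‖y‖ < 1) (hw1 : ‖w‖ < 1) :
    S ((1 / 2 : ℝ) • (y + w)) = (1 / 2 : ℝ) • (S y + S w) := by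
  have hd := Submodule.sub_mem _ hw hy
  obtain ⟨C₁, C₂, hC₁, hC₂, h⟩ := hS.exists_increment_eq_of_mem_span₂ hU hd hd
  set d := w - y with hd_def
  set ρ := max ‖y‖ ‖w‖ with hρ
  have hρ1 : ρ < 1 := max_lt hy1 hw1
  have hC₁0 := (norm_nonneg d).trans hC₁
  have hC₂0 := (norm_nonneg d).trans hC₂
  obtain ⟨N, hN⟩ := exists_nat_gt ((C₁ + C₂) / (1 - ρ))
  have hN0 : (0 : ℝ) < N := lt_of_le_of_lt (div_nonneg (by linarith) (by linarith)) hN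
  rw [div_lt_iff₀ (by linarith)] at hN
  set ε : ℝ := 1 / (2 * N) with hε
  have hε0 : 0 < ε := by positivity
  have hεC : ε * (C₁ + C₂) ≤ 1 - ρ := by
    rw [hε, one_div, inv_mul_le_iff₀ (by positivity)]
    nlinarith
  have hstep : ∀ k : ℕ, k ≤ 2 * N → S (y + (k * ε) • d) = S y + (k : ℝ) • (S (y + ε • d) - S y) ∧
      S (y + (k * ε) • d + ε • d) - S (y + (k * ε) • d) = S (y + ε • d) - S y := by
    intro k
    induction k with
    | zero => intro _; simp
    | succ k ih =>
      intro hk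
      obtain ⟨ih1, ih2⟩ := ih (by omega)
      have e : y + ((k + 1 : ℕ) * ε) • d = y + (k * ε) • d + ε • d := by push_cast; module
      rw [e]
      refine ⟨?_, ?_⟩
      · rw [sub_eq_iff_eq_add.1 ih2, ih1]; push_cast; module
      · rw [← ih2]
        refine h (y + (k * ε) • d) ε ε ?_
        have hk' : (k : ℝ) * ε ≤ 1 := by
          have : (k : ℝ) ≤ 2 * N := by exact_mod_cast (by omega : k ≤ 2 * N)
          rw [hε, mul_one_div, div_le_one (by positivity)]
          exact this
        have hkn : 0 ≤ (k : ℝ) * ε := by positivity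
        have : ‖y + (k * ε) • d‖ ≤ ρ := by
          rw [show y + (k * ε) • d = (1 - k * ε) • y + (k * ε) • w by rw [hd_def]; module]
          refine (norm_add_le _ _).trans ?_
          rw [norm_smul, norm_smul, Real.norm_of_nonneg hkn, Real.norm_of_nonneg (by linarith)]
          have g1 : ‖y‖ ≤ ρ := le_max_left _ _
          have g2 : ‖w‖ ≤ ρ := le_max_right _ _
          nlinarith
        rw [abs_of_pos hε0]
        linarith
  have h1 := (hstep N (by omega)).1
  have h2 := (hstep (2 * N) le_rfl).1
  have e1 : (N : ℝ) * ε = 1 / 2 := by rw [hε]; field_simp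
  have e2 : ((2 * N : ℕ) : ℝ) * ε = 1 := by push_cast; rw [hε]; field_simp
  rw [e1] at h1
  rw [e2, one_smul] at h2
  rw [show (1 / 2 : ℝ) • (y + w) = y + (1 / 2 : ℝ) • d by rw [hd_def]; module, h1,
    show w = y + d by rw [hd_def]; abel, h2]
  push_cast
  module

theorem tendsto (hS : IsBallIsometry S) {ι : Type*} {l : Filter ι} {f : ι → E} {x : E}
    (hf : ∀ i, ‖f i‖ ≤ 1) (hx : ‖x‖ ≤ 1) (h : Filter.Tendsto f l (nhds x)) :
    Filter.Tendsto (fun i => S (f i)) l (nhds (S x)) := by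
  rw [tendsto_iff_norm_sub_tendsto_zero] at h ⊢
  simpa only [hS.norm_sub _ _ (hf _) hx] using h

theorem map_midpoint (hS : IsBallIsometry S) {U : Set E}
    (hU : ∀ u ∈ U, IsExtremeDirection u) (hd : ∀ x : E, x ∈ closure (Submodule.span ℝ U : Set E))
    {y w : E} (hy : ‖y‖ ≤ 1) (hw : ‖w‖ ≤ 1) :
    S ((1 / 2 : ℝ) • (y + w)) = (1 / 2 : ℝ) • (S y + S w) := by
  have hcl : ∀ x : E, ‖x‖ ≤ 1 → ∃ f : ℕ → E, (∀ n, f n ∈ Submodule.span ℝ U ∧ ‖f n‖ < 1) ∧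
      Filter.Tendsto f Filter.atTop (nhds x) := by
    intro x hx
    have h1 : x ∈ closure (Metric.ball (0 : E) 1) := by
      rw [closure_ball _ one_ne_zero]; simpa using hx
    have h2 : Metric.ball (0 : E) 1 ⊆ closure (Metric.ball (0 : E) 1 ∩ Submodule.span ℝ U) :=
      fun z hz => Metric.isOpen_ball.inter_closure ⟨hz, hd z⟩
    have h3 := closure_minimal h2 isClosed_closure h1
    obtain ⟨f, hf, hf'⟩ := mem_closure_iff_seq_limit.1 h3
    exact ⟨f, fun n => ⟨(hf n).2, by simpa using (hf n).1⟩, hf'⟩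
  obtain ⟨f, hf, hf'⟩ := hcl y hy
  obtain ⟨g, hg, hg'⟩ := hcl w hw
  have hmid : ∀ a b : E, ‖a‖ ≤ 1 → ‖b‖ ≤ 1 → ‖(1 / 2 : ℝ) • (a + b)‖ ≤ 1 := by
    intro a b ha hb
    rw [norm_smul]
    have := norm_add_le a b
    norm_num
    linarith
  have t1 := hS.tendsto (fun n => hmid _ _ (hf n).2.le (hg n).2.le) (hmid _ _ hy hw)
    ((hf'.add hg').const_smul (1 / 2 : ℝ))
  have t2 := ((hS.tendsto (fun n => (hf n).2.le) hy hf').add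
    (hS.tendsto (fun n => (hg n).2.le) hw hg')).const_smul (1 / 2 : ℝ)
  refine tendsto_nhds_unique t1 (t2.congr fun n => ?_)
  exact (hS.map_midpoint_of_mem_span hU (hf n).1 (hg n).1 (hf n).2 (hg n).2).symm

theorem exists_linearIsometry (hS : IsBallIsometry S) {U : Set E}
    (hU : ∀ u ∈ U, IsExtremeDirection u)
    (hd : ∀ x : E, x ∈ closure (Submodule.span ℝ U : Set E)) :
    ∃ L : E →ₗᵢ[ℝ] Y, ∀ b : E, ‖b‖ ≤ 1 → S b = S 0 + L b := by
  set f : E → Y := fun b => S b - S 0 with hf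
  have f_half : ∀ b : E, ‖b‖ ≤ 1 → (2 : ℝ) • f ((1 / 2 : ℝ) • b) = f b := by
    intro b hb
    have := hS.map_midpoint hU hd hb (w := 0) (by simp)
    rw [add_zero] at this
    simp only [hf, this]
    module
  have f_add : ∀ a b : E, ‖a‖ ≤ 1 → ‖b‖ ≤ 1 → f a + f b = (2 : ℝ) • f ((1 / 2 : ℝ) • (a + b)) := by
    intro a b ha hb
    simp only [hf, hS.map_midpoint hU hd ha hb]
    module
  have f_norm : ∀ b : E, ‖b‖ ≤ 1 → ‖f b‖ = ‖b‖ := by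
    intro b hb
    simpa using hS.norm_sub b 0 hb (by simp)
  set g : E → Y := fun x => (2 : ℝ) ^ ⌈‖x‖⌉₊ • f (((1 / 2 : ℝ) ^ ⌈‖x‖⌉₊) • x) with hg
  have hsmall : ∀ (x : E) (m : ℕ), ⌈‖x‖⌉₊ ≤ m → ‖((1 / 2 : ℝ) ^ m) • x‖ ≤ 1 := by
    intro x m hm
    rw [norm_smul, norm_pow, Real.norm_of_nonneg (by norm_num), one_div, inv_pow,
      inv_mul_le_iff₀ (by positivity), mul_one]
    calc ‖x‖ ≤ ⌈‖x‖⌉₊ := Nat.le_ceil _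
      _ ≤ m := by exact_mod_cast hm
      _ ≤ 2 ^ m := by exact_mod_cast Nat.lt_two_pow_self.le
  have g_eq : ∀ (x : E) (m : ℕ), ⌈‖x‖⌉₊ ≤ m → (2 : ℝ) ^ m • f (((1 / 2 : ℝ) ^ m) • x) = g x := by
    intro x m hm
    induction m, hm using Nat.le_induction with
    | base => rfl
    | succ m hm ih =>
      rw [← ih, ← f_half _ (hsmall x m hm), smul_smul, smul_smul, pow_succ, pow_succ']
  have g_add : ∀ x y : E, g (x + y) = g x + g y := by
    intro x y
    set m := max ⌈‖x + y‖⌉₊ (max ⌈‖x‖⌉₊ ⌈‖y‖⌉₊) with hm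
    have hx : ⌈‖x‖⌉₊ ≤ m := by omega
    have hy : ⌈‖y‖⌉₊ ≤ m := by omega
    rw [← g_eq (x + y) (m + 1) (by omega), ← g_eq x m hx, ← g_eq y m hy, ← smul_add,
      f_add _ _ (hsmall x m hx) (hsmall y m hy), smul_smul, ← smul_add, smul_smul, pow_succ,
      pow_succ']
  have g_small : ∀ x : E, ‖x‖ ≤ 1 → g x = f x := by
    intro x hx
    have hle : ⌈‖x‖⌉₊ ≤ 1 := Nat.ceil_le.2 (by simpa using hx)
    rw [← g_eq x 1 hle, pow_one, pow_one, f_half x hx]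
  have g_norm : ∀ x : E, ‖g x‖ = ‖x‖ := by
    intro x
    simp only [hg]
    rw [norm_smul, f_norm _ (hsmall x _ le_rfl), norm_smul, ← mul_assoc, ← norm_mul, ← mul_pow]
    norm_num
  let G : E →+ Y := AddMonoidHom.mk' g g_add
  have hG : Continuous G := AddMonoidHomClass.continuous_of_bound G 1 fun x => by
    rw [one_mul]; exact (g_norm x).le
  refine ⟨⟨(G.toRealLinearMap hG).toLinearMap, g_norm⟩, fun b hb => ?_⟩
  change S b = S 0 + g b
  rw [g_small b hb]
  simp [hf]

end IsBallIsometry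

end BallIsometry

/-! ### The parallelogram law on unit vectors -/

section Parallelogram

theorem mem_of_isClosed_of_midpoint_mem {s : Set ℝ} (hs : IsClosed s) {L : ℝ} (hL : 0 < L)
    (hmem : ∀ n : ℤ, n * L ∈ s)
    (hmid : ∀ a ∈ s, ∀ b ∈ s, a ≤ b → b - a ≤ L → (a + b) / 2 ∈ s) (t : ℝ) : t ∈ s := by
  by_contra ht
  set n := ⌊t / L⌋ with hn
  have h1 : n * L ≤ t := by
    have := Int.floor_le (t / L)
    rwa [le_div_iff₀ hL] at this
  have h2 : t < (n + 1) * L := by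
    have := Int.lt_floor_add_one (t / L)
    rwa [div_lt_iff₀ hL] at this
  have hA : IsCompact (s ∩ Set.Icc (n * L) t) := isCompact_Icc.inter_left hs
  have hB : IsCompact (s ∩ Set.Icc t ((n + 1) * L)) := isCompact_Icc.inter_left hs
  have hm' : ((n : ℝ) + 1) * L ∈ s := by exact_mod_cast hmem (n + 1)
  obtain ⟨a, ⟨ha, ha1, ha2⟩, ha3⟩ := hA.exists_isGreatest ⟨n * L, hmem n, le_rfl, h1⟩
  obtain ⟨b, ⟨hb, hb1, hb2⟩, hb3⟩ := hB.exists_isLeast ⟨(n + 1) * L, hm', h2.le, le_rfl⟩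
  have hat : a < t := lt_of_le_of_ne ha2 fun h => ht (h ▸ ha)
  have hbt : t < b := lt_of_le_of_ne hb1 fun h => ht (h ▸ hb)
  have hc := hmid a ha b hb (by linarith) (by linarith)
  rcases le_total ((a + b) / 2) t with h | h
  · have := ha3 ⟨hc, by linarith, h⟩
    linarith
  · have := hb3 ⟨hc, h, by linarith⟩
    linarith

variable {W : Type*} [NormedAddCommGroup W] [NormedSpace ℝ W]

theorem norm_sq_of_unit_parallelogram_of_orthogonal
    (h : ∀ u v : W, ‖u‖ = 1 → ‖v‖ = 1 → ‖u + v‖ ^ 2 + ‖u - v‖ ^ 2 = 4) {u v : W} (hu : ‖u‖ = 1)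
    (hv : ‖v‖ = 1) (huv : ‖u + v‖ = ‖u - v‖) (a b : ℝ) : ‖a • u + b • v‖ ^ 2 = a ^ 2 + b ^ 2 := by
  have h2 : ‖u + v‖ ^ 2 = 2 := by
    have := h u v hu hv
    rw [← huv] at this
    linarith
  have h2' : ‖u - v‖ ^ 2 = 2 := by rw [← huv, h2]
  set e : ℝ → W := fun t => Real.cos t • u + Real.sin t • v with he
  have hec : Continuous e := by fun_prop
  set s : Set ℝ := {t | ‖e t‖ = 1 ∧ ‖e (t + Real.pi / 2)‖ = 1} with hs
  have hsc : IsClosed s := (isClosed_eq (by fun_prop) continuous_const).inter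
    (isClosed_eq (by fun_prop) continuous_const)
  have e_pi : ∀ t, e (t + Real.pi) = -e t := by
    intro t; simp only [he, Real.cos_add_pi, Real.sin_add_pi]; module
  have e_pi2 : ∀ t, e (t + Real.pi / 2 + Real.pi / 2) = -e t := by
    intro t; rw [← e_pi]; congr 1; ring
  have sper : ∀ t ∈ s, t + Real.pi / 2 ∈ s := by
    rintro t ⟨h1, h3⟩
    exact ⟨h3, by rw [e_pi2, norm_neg, h1]⟩
  have sper' : ∀ t, t + Real.pi / 2 ∈ s → t ∈ s := by
    rintro t ⟨h1, h3⟩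
    rw [e_pi2, norm_neg] at h3
    exact ⟨h3, h1⟩
  have s0 : (0 : ℝ) ∈ s := by
    refine ⟨by simp [he, hu], by simp [he, hv]⟩
  have hsq : ∀ w : W, ‖w‖ ^ 2 = 2 → ‖(Real.sqrt 2 / 2) • w‖ = 1 := by
    intro w hw
    have h3 : ‖(Real.sqrt 2 / 2) • w‖ ^ 2 = 1 := by
      rw [norm_smul, mul_pow, hw, Real.norm_of_nonneg (by positivity), div_pow,
        Real.sq_sqrt (by norm_num)]
      norm_num
    exact (pow_eq_one_iff_of_nonneg (norm_nonneg _) two_ne_zero).1 h3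
  have s1 : Real.pi / 4 ∈ s := by
    constructor
    · simp only [he, Real.cos_pi_div_four, Real.sin_pi_div_four]
      rw [← smul_add]
      exact hsq _ h2
    · simp only [he, Real.cos_add_pi_div_two, Real.sin_add_pi_div_two, Real.cos_pi_div_four,
        Real.sin_pi_div_four]
      rw [show -(Real.sqrt 2 / 2) • u + (Real.sqrt 2 / 2) • v = -((Real.sqrt 2 / 2) • (u - v)) by
        module, norm_neg]
      exact hsq _ h2'
  have sall : ∀ n : ℤ, n * (Real.pi / 4) ∈ s := by
    have key : ∀ n : ℤ, n * (Real.pi / 4) ∈ s ∧ (n + 1) * (Real.pi / 4) ∈ s := by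
      intro n
      induction n using Int.induction_on with
      | zero => simpa using ⟨s0, s1⟩
      | succ n ih =>
        push_cast at ih ⊢
        refine ⟨ih.2, ?_⟩
        convert sper _ ih.1 using 1
        ring
      | pred n ih =>
        push_cast at ih ⊢
        refine ⟨sper' _ ?_, ?_⟩
        · convert ih.2 using 1; ring
        · convert ih.1 using 1; ring
    exact fun n => (key n).1
  have smid : ∀ a ∈ s, ∀ b ∈ s, a ≤ b → b - a ≤ Real.pi / 4 → (a + b) / 2 ∈ s := by
    rintro a ⟨ha1, ha2⟩ b ⟨hb1, hb2⟩ hab hab'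
    set m := (a + b) / 2 with hm
    set d := (b - a) / 2 with hd
    have eadd : ∀ r, e (m + r - d) + e (m + r + d) = (2 * Real.cos d) • e (m + r) := by
      intro r; simp only [he, Real.cos_add (m + r), Real.sin_add (m + r), Real.cos_sub (m + r),
        Real.sin_sub (m + r)]; module
    have esub : ∀ r, e (m + r - d) - e (m + r + d) =
        (-2 * Real.sin d) • e (m + r + Real.pi / 2) := by
      intro r; simp only [he, Real.cos_add (m + r), Real.sin_add (m + r), Real.cos_sub (m + r),
        Real.sin_sub (m + r), Real.cos_pi_div_two,
        Real.sin_pi_div_two]; module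
    have hA := h _ _ (show ‖e (m + 0 - d)‖ = 1 by convert ha1 using 3; rw [hm, hd]; ring)
      (show ‖e (m + 0 + d)‖ = 1 by convert hb1 using 3; rw [hm, hd]; ring)
    have hB := h _ _ (show ‖e (m + Real.pi / 2 - d)‖ = 1 by convert ha2 using 3; rw [hm, hd]; ring)
      (show ‖e (m + Real.pi / 2 + d)‖ = 1 by convert hb2 using 3; rw [hm, hd]; ring)
    rw [eadd, esub, norm_smul, norm_smul, mul_pow, mul_pow, Real.norm_eq_abs, Real.norm_eq_abs,
      sq_abs, sq_abs] at hA hB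
    rw [add_zero] at hA
    rw [e_pi2, norm_neg] at hB
    have hcs := Real.cos_sq_add_sin_sq d
    have hc2 : 0 < Real.cos (2 * d) := Real.cos_pos_of_mem_Ioo
      ⟨by rw [hd]; linarith [Real.pi_pos], by rw [hd]; linarith [Real.pi_pos]⟩
    rw [Real.cos_two_mul] at hc2
    set P := ‖e m‖ ^ 2 with hP
    set Q := ‖e (m + Real.pi / 2)‖ ^ 2 with hQ
    set C := Real.cos d ^ 2 with hC
    have hS : Real.sin d ^ 2 = 1 - C := by linarith
    rw [mul_pow, mul_pow, hS, ← hC] at hA hB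
    have e1 : (2 * C - 1) * (P - Q) = 0 := by linarith
    have e2 : P = Q := by
      have := (mul_eq_zero.1 e1).resolve_left hc2.ne'
      linarith
    have e3 : P = 1 := by rw [← e2] at hA; linarith
    have e4 : Q = 1 := e2 ▸ e3
    refine ⟨?_, ?_⟩
    · exact (pow_eq_one_iff_of_nonneg (norm_nonneg _) two_ne_zero).1 e3
    · exact (pow_eq_one_iff_of_nonneg (norm_nonneg _) two_ne_zero).1 e4
  have hall : ∀ t, ‖e t‖ = 1 := fun t =>
    (mem_of_isClosed_of_midpoint_mem hsc (by positivity) sall smid t).1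
  set z : ℂ := ⟨a, b⟩ with hz
  have h3 : a • u + b • v = ‖z‖ • e z.arg := by
    have h4 : ‖z‖ * Real.cos z.arg = a := Complex.norm_mul_cos_arg z
    have h5 : ‖z‖ * Real.sin z.arg = b := Complex.norm_mul_sin_arg z
    simp only [he]
    rw [smul_add, smul_smul, smul_smul, h4, h5]
  rw [h3, norm_smul, hall, mul_one, norm_norm, Complex.sq_norm, Complex.normSq_apply]
  ring

theorem norm_sub_sq_of_unit_parallelogram
    (h : ∀ u v : W, ‖u‖ = 1 → ‖v‖ = 1 → ‖u + v‖ ^ 2 + ‖u - v‖ ^ 2 = 4) {x y : W} (hx : ‖x‖ = 1)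
    (hy : ‖y‖ = 1) (a b : ℝ) : ‖a • x - b • y‖ ^ 2 = (a - b) ^ 2 + a * b * ‖x - y‖ ^ 2 := by
  by_cases hdep : y = x ∨ y = -x
  · rcases hdep with rfl | rfl
    · rw [← sub_smul, norm_smul, hx]; simp
    · rw [show a • x - b • -x = (a + b) • x by module, show x - -x = (2 : ℝ) • x by module,
        norm_smul, norm_smul, hx, mul_one, Real.norm_eq_abs, sq_abs]
      norm_num
      ring
  push Not at hdep
  have hne : ∀ c d : ℝ, c ^ 2 + d ^ 2 = 1 → c • x + d • y ≠ 0 := by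
    intro c d hcd h0
    have h1 : ‖c • x‖ = ‖d • y‖ := by rw [eq_neg_of_add_eq_zero_left h0, norm_neg]
    rw [norm_smul, norm_smul, hx, hy, mul_one, mul_one, Real.norm_eq_abs, Real.norm_eq_abs] at h1
    have hd0 : d ≠ 0 := by
      rintro rfl
      rw [abs_zero, abs_eq_zero] at h1
      norm_num [h1] at hcd
    rcases abs_eq_abs.1 h1 with h2 | h2
    · rw [h2, ← smul_add] at h0
      exact hdep.2 (eq_neg_of_add_eq_zero_right ((smul_eq_zero.1 h0).resolve_left hd0))
    · rw [h2, neg_smul, neg_add_eq_sub, ← smul_sub] at h0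
      exact hdep.1 (sub_eq_zero.1 ((smul_eq_zero.1 h0).resolve_left hd0))
  set p : ℝ → W := fun t => Real.cos t • x + Real.sin t • y with hp
  have hp0 : ∀ t, p t ≠ 0 := fun t => hne _ _ (Real.cos_sq_add_sin_sq t)
  set w : ℝ → W := fun t => ‖p t‖⁻¹ • p t with hw
  have hpc : Continuous p := by fun_prop
  have hwc : Continuous w := (hpc.norm.inv₀ fun t => norm_ne_zero_iff.2 (hp0 t)).smul hpc
  have hw1 : ∀ t, ‖w t‖ = 1 := fun t => by
    simp only [hw]
    rw [norm_smul, norm_inv, norm_norm, inv_mul_cancel₀ (norm_ne_zero_iff.2 (hp0 t))]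
  set f : ℝ → ℝ := fun t => ‖x + w t‖ - ‖x - w t‖ with hf
  have hfc : Continuous f := by fun_prop
  have hxx : ‖x + x‖ = 2 := by rw [← two_smul ℝ x, norm_smul, hx]; norm_num
  have f0 : f 0 = 2 := by simp [hf, hw, hp, hx, hxx]
  have fpi : f Real.pi = -2 := by simp [hf, hw, hp, hx, hxx]
  obtain ⟨t, -, ht⟩ := intermediate_value_Icc' Real.pi_pos.le hfc.continuousOn
    (show (0 : ℝ) ∈ Set.Icc (f Real.pi) (f 0) by rw [f0, fpi]; norm_num)
  have hort := norm_sq_of_unit_parallelogram_of_orthogonal h hx (hw1 t) (sub_eq_zero.1 ht)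
  have hsin : Real.sin t ≠ 0 := by
    intro h0
    have hcos : Real.cos t = 1 ∨ Real.cos t = -1 := Real.sin_eq_zero_iff_cos_eq.1 h0
    have h2 : (2 : ℝ) ≠ 0 := two_ne_zero
    rcases hcos with hc | hc
    · have : w t = x := by simp [hw, hp, h0, hc, hx]
      simp [hf, this, hxx] at ht
    · have : w t = -x := by simp [hw, hp, h0, hc, hx]
      simp [hf, this, hxx] at ht
  have hyw : y = (-(Real.cos t / Real.sin t)) • x + (‖p t‖ / Real.sin t) • w t := by
    have hpt := norm_ne_zero_iff.2 (hp0 t)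
    simp only [hw]
    rw [smul_smul, div_mul_eq_mul_div, mul_inv_cancel₀ hpt]
    simp only [hp]
    rw [smul_add, smul_smul, smul_smul, one_div, inv_mul_cancel₀ hsin, ← add_assoc, ← add_smul]
    rw [show -(Real.cos t / Real.sin t) + (Real.sin t)⁻¹ * Real.cos t = 0 by ring]
    simp
  set α := -(Real.cos t / Real.sin t)
  set β := ‖p t‖ / Real.sin t
  have k1 : ‖y‖ ^ 2 = α ^ 2 + β ^ 2 := by rw [hyw]; exact hort α β
  have k2 : ‖x - y‖ ^ 2 = (1 - α) ^ 2 + (-β) ^ 2 := by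
    rw [← hort]; congr 2; rw [hyw]; module
  have k3 : ‖a • x - b • y‖ ^ 2 = (a - b * α) ^ 2 + (-b * β) ^ 2 := by
    rw [← hort]; congr 2; rw [hyw]; module
  rw [hy] at k1
  rw [k3, k2]
  linear_combination (-b ^ 2 + a * b) * k1

theorem map_add_of_unit_parallelogram {N : Type*} [NormedAddCommGroup N] [NormedSpace ℝ N]
    (h : ∀ u v : N, ‖u‖ = 1 → ‖v‖ = 1 → ‖u + v‖ ^ 2 + ‖u - v‖ ^ 2 = 4) {τ : N → W}
    (hsurj : Function.Surjective τ) (hsmul : ∀ (c : ℝ) x, τ (c • x) = c • τ x)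
    (hnorm : ∀ x, ‖τ x‖ = ‖x‖) (hsub : ∀ x y, ‖x‖ = 1 → ‖y‖ = 1 → ‖τ x - τ y‖ = ‖x - y‖)
    (x y : N) : τ (x + y) = τ x + τ y := by
  have hneg : ∀ x, τ (-x) = -τ x := fun x => by
    rw [← neg_one_smul ℝ x, hsmul, neg_one_smul]
  have hW : ∀ u v : W, ‖u‖ = 1 → ‖v‖ = 1 → ‖u + v‖ ^ 2 + ‖u - v‖ ^ 2 = 4 := by
    intro u v hu hv
    obtain ⟨a, rfl⟩ := hsurj u
    obtain ⟨b, rfl⟩ := hsurj v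
    rw [hnorm] at hu hv
    rw [hsub a b hu hv, ← h a b hu hv, ← sub_neg_eq_add (τ a), ← hneg,
      hsub a (-b) hu (by rwa [norm_neg]), sub_neg_eq_add]
  have hiso : Isometry τ := by
    refine Isometry.of_dist_eq fun x y => ?_
    rw [dist_eq_norm, dist_eq_norm]
    by_cases hx : x = 0
    · have : τ 0 = 0 := by simpa using hsmul 0 0
      rw [hx, this, zero_sub, zero_sub, norm_neg, norm_neg, hnorm]
    by_cases hy : y = 0
    · have : τ 0 = 0 := by simpa using hsmul 0 0
      rw [hy, this, sub_zero, sub_zero, hnorm]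
    have hx1 : ‖‖x‖⁻¹ • x‖ = 1 := by
      rw [norm_smul, norm_inv, norm_norm, inv_mul_cancel₀ (norm_ne_zero_iff.2 hx)]
    have hy1 : ‖‖y‖⁻¹ • y‖ = 1 := by
      rw [norm_smul, norm_inv, norm_norm, inv_mul_cancel₀ (norm_ne_zero_iff.2 hy)]
    have ex : x = ‖x‖ • (‖x‖⁻¹ • x) := by
      rw [smul_smul, mul_inv_cancel₀ (norm_ne_zero_iff.2 hx), one_smul]
    have ey : y = ‖y‖ • (‖y‖⁻¹ • y) := by
      rw [smul_smul, mul_inv_cancel₀ (norm_ne_zero_iff.2 hy), one_smul]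
    generalize ‖x‖⁻¹ • x = x' at *
    generalize ‖y‖⁻¹ • y = y' at *
    have k1 := norm_sub_sq_of_unit_parallelogram h hx1 hy1 ‖x‖ ‖y‖
    have k2 := norm_sub_sq_of_unit_parallelogram hW (x := τ x') (y := τ y') (by rw [hnorm, hx1])
      (by rw [hnorm, hy1]) ‖x‖ ‖y‖
    rw [hsub _ _ hx1 hy1, ← hsmul, ← hsmul, ← k1, ← ex, ← ey] at k2
    exact (pow_left_inj₀ (norm_nonneg _) (norm_nonneg _) two_ne_zero).1 k2
  have h0 : τ 0 = 0 := by simpa using hsmul 0 0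
  let e : N ≃ᵢ W := IsometryEquiv.mk' τ (Function.surjInv hsurj)
    (fun w => Function.surjInv_eq hsurj w) hiso
  exact map_add (e.toRealLinearIsometryEquivOfMapZero h0) x y

end Parallelogram

/-! ### Orthogonality and partial isometries -/

section Abstract

variable {R : Type*} [NormedRing R] [NormedAlgebra ℝ R] [StarRing R] [CStarRing R] [StarModule ℝ R]

/-- Orthogonality of two elements of a star ring. -/
def Orth (x y : R) : Prop := star x * y = 0 ∧ x * star y = 0

/-- Partial isometries. -/
def PIso (e : R) : Prop := e * star e * e = e

/-- Both the left and the right support of `e` are dominated by those of `x`. -/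
def Under (e x : R) : Prop := (∀ y, y * x = 0 → y * e = 0) ∧ ∀ y, x * y = 0 → e * y = 0

theorem Orth.symm {x y : R} (h : Orth x y) : Orth y x :=
  ⟨by simpa using congrArg star h.1, by simpa using congrArg star h.2⟩

theorem Orth.under {x y e : R} (h : Orth x y) (he : Under e x) : Orth e y :=
  ⟨by simpa using congrArg star (he.1 _ h.symm.1), he.2 _ h.2⟩

theorem Orth.under_right {x y e : R} (h : Orth x y) (he : Under e y) : Orth x e :=
  (h.symm.under he).symm

theorem Orth.add_right {x y z : R} (h : Orth x y) (h' : Orth x z) : Orth x (y + z) :=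
  ⟨by rw [mul_add, h.1, h'.1, add_zero], by rw [star_add, mul_add, h.2, h'.2, add_zero]⟩

theorem Orth.add_left {x y z : R} (h : Orth x z) (h' : Orth y z) : Orth (x + y) z :=
  (h.symm.add_right h'.symm).symm

theorem Orth.smul_right {x y : R} (h : Orth x y) (c : ℝ) : Orth x (c • y) :=
  ⟨by rw [mul_smul_comm, h.1, smul_zero],
    by rw [star_smul, star_trivial, mul_smul_comm, h.2, smul_zero]⟩

theorem Orth.smul_left {x y : R} (h : Orth x y) (c : ℝ) : Orth (c • x) y :=
  (h.symm.smul_right c).symm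

theorem Orth.neg_right {x y : R} (h : Orth x y) : Orth x (-y) := by
  simpa using h.smul_right (-1)

theorem Orth.zero_right (x : R) : Orth x 0 := ⟨by simp, by simp⟩

theorem Orth.star_star {x y : R} (h : Orth x y) : Orth (star x) (star y) :=
  ⟨by simpa using h.2, by simpa using h.1⟩

/-- The elements orthogonal to `e`. -/
def orthSubmodule (e : R) : Submodule ℝ R where
  carrier := {b | Orth e b}
  add_mem' h h' := h.add_right h'
  zero_mem' := Orth.zero_right e
  smul_mem' c _ h := h.smul_right c

theorem Orth.norm_le_norm_add {x y : R} (h : Orth x y) : ‖x‖ ≤ ‖x + y‖ := by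
  rcases eq_or_ne x 0 with rfl | hx
  · simp
  have h1 : star x * (x + y) = star x * x := by rw [mul_add, h.1, add_zero]
  have h2 := norm_mul_le (star x) (x + y)
  rw [h1, CStarRing.norm_star_mul_self, norm_star] at h2
  exact le_of_mul_le_mul_left h2 (norm_pos_iff.2 hx)

theorem PIso.isStarProjection {e : R} (he : PIso e) : IsStarProjection (star e * e) :=
  ⟨by rw [IsIdempotentElem, mul_assoc, ← mul_assoc e, he], IsSelfAdjoint.star_mul_self e⟩

theorem PIso.star_pIso {e : R} (he : PIso e) : PIso (star e) := by
  have := congrArg Star.star he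
  simpa [PIso, mul_assoc] using this

theorem IsStarProjection.norm_eq_one {p : R} (hp : IsStarProjection p) (h0 : p ≠ 0) : ‖p‖ = 1 := by
  have h1 : ‖star p * p‖ = ‖p‖ * ‖p‖ := CStarRing.norm_star_mul_self
  rw [hp.isSelfAdjoint.star_eq, hp.isIdempotentElem.eq] at h1
  have h2 := norm_ne_zero_iff.2 h0
  field_simp at h1
  exact h1.symm

theorem PIso.norm_eq_one {e : R} (he : PIso e) (h0 : e ≠ 0) : ‖e‖ = 1 := by
  have h1 : star e * e ≠ 0 := fun h => h0 (CStarRing.star_mul_self_eq_zero_iff _ |>.1 h)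
  have h2 := he.isStarProjection.norm_eq_one h1
  rw [CStarRing.norm_star_mul_self] at h2
  nlinarith [norm_nonneg e]

theorem PIso.norm_le_one {e : R} (he : PIso e) : ‖e‖ ≤ 1 := by
  rcases eq_or_ne e 0 with rfl | h0
  · simp
  · exact (he.norm_eq_one h0).le

theorem IsStarProjection.pIso {p : R} (hp : IsStarProjection p) : PIso p := by
  rw [PIso, hp.isSelfAdjoint.star_eq, hp.isIdempotentElem.eq, hp.isIdempotentElem.eq]

theorem PIso.neg {e : R} (he : PIso e) : PIso (-e) := by
  have := congrArg Neg.neg he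
  simpa [PIso] using this

theorem Orth.mul_star_mul_add {e f : R} (h : Orth e f) :
    (e + f) * star (e + f) * (e + f) = e * star e * e + f * star f * f := by
  have h1 := h.2
  have h2 := h.symm.2
  have h3 := h.1
  have h4 := h.symm.1
  have e1 : (e + f) * star (e + f) = e * star e + f * star f := by
    rw [star_add, add_mul, mul_add, mul_add, h1, h2]; simp
  rw [e1, add_mul, mul_add, mul_add, mul_assoc e _ f, h3, mul_assoc f _ e, h4]
  simp

theorem PIso.add {e f : R} (he : PIso e) (hf : PIso f) (h : Orth e f) : PIso (e + f) := by
  rw [PIso, h.mul_star_mul_add, he, hf]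

theorem PIso.of_add {e f : R} (he : PIso e) (hef : PIso (e + f)) (h : Orth e f) : PIso f := by
  rw [PIso, h.mul_star_mul_add, he] at hef
  exact add_left_cancel hef

/-- `e` is maximal: only zero is orthogonal to it. -/
def IsMaximalPIso (e : R) : Prop := PIso e ∧ ∀ b, Orth e b → b = 0

theorem PIso.orth_of_orth_add {e f b : R} (he : PIso e) (h : Orth e f) (hb : Orth (e + f) b) :
    Orth e b := by
  constructor
  · have h1 : star e * (e * (star (e + f) * b)) = 0 := by rw [hb.1]; simp
    rw [star_add, add_mul, mul_add, ← mul_assoc e (star f), h.2, zero_mul, add_zero] at h1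
    have h2 : star e * (e * (star e * b)) = star e * b := by
      rw [← mul_assoc, ← mul_assoc]
      congr 1
      simpa [PIso] using he.star_pIso
    rwa [h2] at h1
  · have h1 : (e + f) * star b = 0 := hb.2
    have h2 : e * star e * ((e + f) * star b) = e * star b := by
      rw [← mul_assoc, mul_add, he, mul_assoc e _ f, h.1, mul_zero, add_zero]
    rw [← h2, h1, mul_zero]

theorem IsMaximalPIso.sub {e f : R} (he : PIso e) (h : Orth e f) (hm : IsMaximalPIso (e + f)) :
    IsMaximalPIso (e - f) := by
  have hf := he.of_add hm.1 h
  refine ⟨by rw [sub_eq_add_neg]; exact he.add hf.neg h.neg_right, fun b hb => hm.2 b ?_⟩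
  rw [sub_eq_add_neg] at hb
  have h1 := he.orth_of_orth_add h.neg_right hb
  have h2 := hf.neg.orth_of_orth_add h.neg_right.symm (by rwa [add_comm])
  exact h1.add_left (by simpa using h2.symm.neg_right.symm)

variable (R) in
/-- The properties of a real von Neumann algebra that determine the isometries of its sphere. -/
structure HasPeirceGeometry : Prop where
  norm_add_le : ∀ x y : R, Orth x y → ‖x + y‖ ≤ max ‖x‖ ‖y‖
  peel : ∀ x : R, ‖x‖ = 1 → ∀ ε : ℝ, 0 < ε → ∃ e b : R, e ≠ 0 ∧ PIso e ∧ Orth e b ∧ ‖b‖ ≤ 1 ∧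
    ‖x - (e + b)‖ ≤ ε ∧ Under e x ∧ Under b x
  mem_of_isClosed : ∀ (x : R) (G : Set R), IsClosed G →
    (∀ e : R, PIso e → Under e x → ∀ c : ℝ, c • e ∈ G) →
    (∀ y ∈ G, ∀ z ∈ G, Orth y z → y + z ∈ G) → x ∈ G
  orth_of_face : ∀ e x : R, PIso e → e ≠ 0 → ‖x‖ ≤ 1 →
    (∀ y : R, ‖y‖ = 1 → ‖e + y‖ = 2 → ‖x + y‖ = 2) → Orth e (x - e)
  exists_maximal : ∀ e : R, PIso e → ∃ w : R, Orth e w ∧ IsMaximalPIso (e + w)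
  orth_of_norm_le : ∀ u c : R, PIso u → ‖c + u‖ ≤ 1 → ‖c - u‖ ≤ 1 → Orth u c

namespace HasPeirceGeometry

variable (hR : HasPeirceGeometry R)
include hR

theorem norm_add_le_one {e b : R} (he : ‖e‖ ≤ 1) (hb : ‖b‖ ≤ 1) (h : Orth e b) : ‖e + b‖ ≤ 1 :=
  (hR.norm_add_le e b h).trans (max_le he hb)

theorem norm_pIso_add {e b : R} (he : PIso e) (h0 : e ≠ 0) (hb : ‖b‖ ≤ 1) (h : Orth e b) :
    ‖e + b‖ = 1 :=
  le_antisymm (hR.norm_add_le_one (he.norm_eq_one h0).le hb h)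
    ((he.norm_eq_one h0).symm.le.trans h.norm_le_norm_add)

theorem mem_starHull_iff {e x : R} (he : PIso e) (h0 : e ≠ 0) :
    x ∈ starHull e ↔ Orth e (x - e) ∧ ‖x - e‖ ≤ 1 := by
  constructor
  · rintro ⟨hx, h⟩
    have h1 := hR.orth_of_face e x he h0 hx.le h
    refine ⟨h1, ?_⟩
    have := h1.symm.norm_le_norm_add
    rwa [sub_add_cancel, hx] at this
  · rintro ⟨h1, h2⟩
    have hx : ‖x‖ = 1 := by
      have := hR.norm_pIso_add he h0 h2 h1
      rwa [add_sub_cancel] at this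
    refine ⟨hx, fun y hy hey => ?_⟩
    have hen := he.norm_eq_one h0
    obtain ⟨φ, hφ, h3, h4⟩ := exists_dual_eq_one_of_norm_add_eq_two hen hy hey
    refine norm_add_eq_two_of_dual hφ hx hy ?_ h4
    have h5 := dual_le_norm hφ (e + (x - e))
    have h6 := dual_le_norm hφ (e + -(x - e))
    have h7 := hR.norm_pIso_add he h0 (b := -(x - e)) (by rwa [norm_neg]) h1.neg_right
    have h8 := hR.norm_pIso_add he h0 h2 h1
    rw [h8] at h5
    rw [h7] at h6
    simp only [map_add, map_neg, map_sub, h3] at h5 h6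
    linarith

/-- The partial isometries orthogonal to `e` that complete it to a maximal one. -/
def completions (e : R) : Set (orthSubmodule e) := {u | IsMaximalPIso (e + (u : R))}

theorem isExtremeDirection_of_mem_completions {e : R} (he : PIso e) {u : orthSubmodule e}
    (hu : u ∈ completions e) : IsExtremeDirection u := by
  have hu' := he.of_add hu.1 u.2
  refine ⟨hu'.norm_le_one, fun c h1 h2 => Subtype.ext ?_⟩
  have h3 := hR.orth_of_norm_le (u : R) (c : R) hu' h1 h2
  exact hu.2 _ (Orth.add_left c.2 h3)

theorem mem_closure_span_completions {e : R} (he : PIso e) (x : orthSubmodule e) :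
    x ∈ closure (Submodule.span ℝ (completions e) : Set (orthSubmodule e)) := by
  rw [closure_subtype]
  set P : Submodule ℝ R := (Submodule.span ℝ (completions e)).map (orthSubmodule e).subtype with hP
  have hPs : ((↑) '' (Submodule.span ℝ (completions e) : Set (orthSubmodule e)) : Set R) = P := by
    rw [hP, Submodule.map_coe]; rfl
  rw [hPs, ← Submodule.topologicalClosure_coe]
  refine hR.mem_of_isClosed (x : R) _ P.isClosed_topologicalClosure ?_
    (fun y hy z hz _ => Submodule.add_mem _ hy hz)
  intro f hf hfx c
  refine Submodule.smul_mem _ _ (P.le_topologicalClosure ?_)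
  have hef : Orth e f := Orth.under_right x.2 hfx
  obtain ⟨w, hw, hm⟩ := hR.exists_maximal _ (he.add hf hef)
  have hE := he.add hf hef
  have hew : Orth e w := hw.under
    ⟨fun y hy => by
      have h1 : (y * star (star (e + f))) = y * (e + f) := by rw [star_star]
      have h2 : y * (e + f) * (star e * e) = y * e := by
        rw [mul_assoc, add_mul, ← mul_assoc, he, ← mul_assoc f, hef.symm.2, zero_mul, add_zero]
      rw [← h2, hy, zero_mul],
     fun y hy => by
      have h2 : e * star e * ((e + f) * y) = e * y := by
        rw [← mul_assoc, mul_add, he, mul_assoc e _ f, hef.1, mul_zero, add_zero]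
      rw [← h2, hy, mul_zero]⟩
  have hm2 := hm.sub hE hw
  have m1 : (⟨f + w, hef.add_right hew⟩ : orthSubmodule e) ∈ completions e := by
    change IsMaximalPIso (e + (f + w))
    rwa [← add_assoc]
  have m2 : (⟨f + -w, hef.add_right hew.neg_right⟩ : orthSubmodule e) ∈ completions e := by
    change IsMaximalPIso (e + (f + -w))
    rwa [← add_assoc, ← sub_eq_add_neg]
  refine ⟨(1 / 2 : ℝ) • (⟨f + w, hef.add_right hew⟩ + ⟨f + -w, hef.add_right hew.neg_right⟩),
    Submodule.smul_mem _ _ (Submodule.add_mem _ (Submodule.subset_span m1)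
      (Submodule.subset_span m2)), ?_⟩
  change (1 / 2 : ℝ) • ((f + w) + (f + -w)) = f
  module

variable {Y : Type*} [NormedAddCommGroup Y] [NormedSpace ℝ Y] {T : R → Y}

theorem exists_linearIsometry (hT : IsSphereIsometry T) {e : R} (he : PIso e) (h0 : e ≠ 0) :
    ∃ L : orthSubmodule e →ₗᵢ[ℝ] Y, ∀ b : orthSubmodule e, ‖b‖ ≤ 1 → T (e + b) = T e + L b := by
  have hn : ∀ b : orthSubmodule e, ‖b‖ ≤ 1 → ‖e + (b : R)‖ = 1 := fun b hb =>
    hR.norm_pIso_add he h0 hb b.2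
  have hS : IsBallIsometry (fun b : orthSubmodule e => T (e + b)) := by
    refine ⟨fun x y hx hy => ?_, fun x y hx hy => ?_⟩
    · rw [hT.norm_sub _ _ (hn x hx) (hn y hy), add_sub_add_left_eq_sub]
      rfl
    · have hen := he.norm_eq_one h0
      have hmem : ∀ x : orthSubmodule e, ‖x‖ ≤ 1 → T (e + x) ∈ starHull (T e) := by
        intro x hx
        rw [← hT.image_starHull hen]
        refine ⟨_, (hR.mem_starHull_iff he h0).2 ?_, rfl⟩
        rw [add_sub_cancel_left]
        exact ⟨x.2, hx⟩
      have h1 := convex_starHull (hT.norm_map _ hen) (hmem x hx) (hmem y hy) (a := 1 / 2)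
        (b := 1 / 2) (by norm_num) (by norm_num) (by norm_num)
      rw [← smul_add, ← hT.image_starHull hen] at h1
      obtain ⟨z, hz, hz'⟩ := h1
      obtain ⟨h2, h3⟩ := (hR.mem_starHull_iff he h0).1 hz
      refine ⟨⟨z - e, h2⟩, h3, ?_⟩
      rw [← hz']
      change T (e + (z - e)) = T z
      rw [add_sub_cancel]
  obtain ⟨L, hL⟩ := hS.exists_linearIsometry
    (fun u hu => hR.isExtremeDirection_of_mem_completions he hu)
    (hR.mem_closure_span_completions he)
  refine ⟨L, fun b hb => ?_⟩
  simpa using hL b hb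

theorem map_neg_of_mem_face (hT : IsSphereIsometry T) {e : R} (he : PIso e) (h0 : e ≠ 0)
    {b : orthSubmodule e} (hb : ‖b‖ ≤ 1) : -T (-(e + b)) = T (e + b) := by
  obtain ⟨L, hL⟩ := hR.exists_linearIsometry hT he h0
  obtain ⟨L', hL'⟩ := hR.exists_linearIsometry hT.neg_comp_neg he h0
  have hmax : ∀ u ∈ completions e, -T (-(e + (u : R))) = T (e + u) := by
    intro u hu
    have hu0 : e + (u : R) ≠ 0 := by
      intro h
      have := u.2.norm_le_norm_add
      rw [h, norm_zero, he.norm_eq_one h0] at this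
      linarith
    refine hT.map_neg_of_starHull_eq_singleton (hu.1.norm_eq_one hu0) fun y hy => ?_
    exact sub_eq_zero.1 (hu.2 _ ((hR.mem_starHull_iff hu.1 hu0).1 hy).1)
  have hle : ∀ u ∈ completions e, ‖u‖ ≤ 1 := fun u hu => (he.of_add hu.1 u.2).norm_le_one
  have hneg : ∀ u ∈ completions e, -u ∈ completions e := by
    intro u hu
    change IsMaximalPIso (e + -(u : R))
    rw [← sub_eq_add_neg]
    exact hu.sub he u.2
  have hadd : ∀ u ∈ completions e, -T (-e) + L' u = T e + L u := by
    intro u hu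
    have h1 := hmax u hu
    have h2 := hL' u (hle u hu)
    rw [hL u (hle u hu)] at h1
    rw [← h2, ← h1]
  have hbase : -T (-e) = T e := by
    obtain ⟨w, hw, hm⟩ := hR.exists_maximal e he
    have hwU : (⟨w, hw⟩ : orthSubmodule e) ∈ completions e := hm
    have h1 := hadd _ hwU
    have h2 := hadd _ (hneg _ hwU)
    rw [map_neg, map_neg] at h2
    have h3 : (2 : ℝ) • (-T (-e)) = (2 : ℝ) • T e := by
      rw [two_smul, two_smul]
      have := congrArg₂ (· + ·) h1 h2
      rw [add_add_add_comm, add_neg_cancel, add_zero, add_add_add_comm, add_neg_cancel,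
        add_zero] at this
      exact this
    exact smul_right_injective _ (two_ne_zero' ℝ) h3
  have hLL : ∀ x, L' x = L x := by
    have hspan : Set.EqOn L' L (Submodule.span ℝ (completions e)) := by
      refine LinearMap.eqOn_span (f := L'.toLinearMap) (g := L.toLinearMap) fun u hu => ?_
      have := hadd u hu
      rw [hbase] at this
      exact add_left_cancel this
    intro x
    exact hspan.closure L'.continuous L.continuous (hR.mem_closure_span_completions he x)
  have := hL' b hb
  rw [hL b hb, ← hLL b, ← hbase, ← this]

theorem map_neg (hT : IsSphereIsometry T) {x : R} (hx : ‖x‖ = 1) : T (-x) = -T x := by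
  have key : ∀ ε : ℝ, 0 < ε → ‖T (-x) - -T x‖ ≤ ε := by
    intro ε hε
    obtain ⟨e, b, h0, he, heb, hb, hxe, -, -⟩ := hR.peel x hx (ε / 2) (by linarith)
    have h1 : -T (-(e + b)) = T (e + b) := hR.map_neg_of_mem_face hT he h0 (b := ⟨b, heb⟩) hb
    have hn := hR.norm_pIso_add he h0 hb heb
    have h2 := hT.norm_sub _ _ hx hn
    have h3 := hT.neg_comp_neg.norm_sub _ _ hx hn
    simp only [h1] at h3
    calc ‖T (-x) - -T x‖ = ‖(T x - T (e + b)) - (-T (-x) - T (e + b))‖ := by congr 1; abel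
      _ ≤ ‖T x - T (e + b)‖ + ‖-T (-x) - T (e + b)‖ := norm_sub_le _ _
      _ ≤ ε := by rw [h2, h3]; linarith
  exact sub_eq_zero.1 (norm_le_zero_iff.1 (le_of_forall_pos_le_add fun ε hε => by
    simpa using key ε hε))

end HasPeirceGeometry

end Abstract

/-! ### The homogeneous extension -/

section Homogeneous

variable {X Y : Type*} [NormedAddCommGroup X] [NormedSpace ℝ X]
  [NormedAddCommGroup Y] [NormedSpace ℝ Y]

/-- A homogeneous surjection which is isometric on every sphere centred at the origin. -/
structure IsHomogeneousIsometry (τ : X → Y) : Prop where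
  map_smul : ∀ (c : ℝ) (x : X), τ (c • x) = c • τ x
  norm_map : ∀ x : X, ‖τ x‖ = ‖x‖
  norm_sub : ∀ x y : X, ‖x‖ = ‖y‖ → ‖τ x - τ y‖ = ‖x - y‖
  surj : Function.Surjective τ

/-- The positively homogeneous extension of a map on the unit sphere. -/
noncomputable def sphereExtension (T : X → Y) (x : X) : Y := ‖x‖ • T (‖x‖⁻¹ • x)

theorem norm_inv_norm_smul {x : X} (hx : x ≠ 0) : ‖‖x‖⁻¹ • x‖ = 1 := by
  rw [norm_smul, norm_inv, norm_norm, inv_mul_cancel₀ (norm_ne_zero_iff.2 hx)]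

theorem sphereExtension_eq {T : X → Y} {x : X} (hx : ‖x‖ = 1) : sphereExtension T x = T x := by
  rw [sphereExtension, hx, inv_one, one_smul, one_smul]

theorem IsSphereIsometry.isHomogeneousIsometry {T : X → Y} (hT : IsSphereIsometry T)
    (hneg : ∀ x, ‖x‖ = 1 → T (-x) = -T x) : IsHomogeneousIsometry (sphereExtension T) where
  map_smul c x := by
    rcases eq_or_ne x 0 with rfl | hx
    · simp [sphereExtension]
    rcases lt_trichotomy c 0 with hc | rfl | hc
    · have h1 : ‖c • x‖⁻¹ • c • x = -(‖x‖⁻¹ • x) := by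
        rw [norm_smul, Real.norm_of_nonpos hc.le, smul_smul, ← neg_smul]
        congr 1
        have := norm_ne_zero_iff.2 hx
        field_simp
        rw [div_self hc.ne]
      rw [sphereExtension, h1, hneg _ (norm_inv_norm_smul hx), norm_smul, Real.norm_of_nonpos hc.le,
        sphereExtension, smul_neg, smul_smul, neg_mul, neg_smul, neg_neg]
    · simp [sphereExtension]
    · have h1 : ‖c • x‖⁻¹ • c • x = (‖x‖⁻¹ • x) := by
        rw [norm_smul, Real.norm_of_nonneg hc.le, smul_smul]
        congr 1
        have := norm_ne_zero_iff.2 hx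
        field_simp
      rw [sphereExtension, h1, norm_smul, Real.norm_of_nonneg hc.le, sphereExtension, smul_smul]
  norm_map x := by
    rcases eq_or_ne x 0 with rfl | hx
    · simp [sphereExtension]
    rw [sphereExtension, norm_smul, hT.norm_map _ (norm_inv_norm_smul hx), norm_norm, mul_one]
  norm_sub x y hxy := by
    rcases eq_or_ne x 0 with rfl | hx
    · have : y = 0 := norm_eq_zero.1 (by rw [← hxy, norm_zero])
      simp [this]
    have hy : y ≠ 0 := norm_ne_zero_iff.1 (hxy ▸ norm_ne_zero_iff.2 hx)
    rw [sphereExtension, sphereExtension, ← hxy, ← smul_sub, norm_smul, norm_norm,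
      hT.norm_sub _ _ (norm_inv_norm_smul hx) (hxy ▸ norm_inv_norm_smul hy), ← smul_sub, norm_smul,
      norm_inv, norm_norm, ← mul_assoc, mul_inv_cancel₀ (norm_ne_zero_iff.2 hx), one_mul]
  surj y := by
    rcases eq_or_ne y 0 with rfl | hy
    · exact ⟨0, by simp [sphereExtension]⟩
    obtain ⟨x, hx, hxy⟩ := hT.surj _ (norm_inv_norm_smul hy)
    refine ⟨‖y‖ • x, ?_⟩
    have h1 : ‖‖y‖ • x‖ = ‖y‖ := by rw [norm_smul, hx, norm_norm, mul_one]
    rw [sphereExtension, h1, smul_smul, inv_mul_cancel₀ (norm_ne_zero_iff.2 hy), one_smul, hxy,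
      smul_smul, mul_inv_cancel₀ (norm_ne_zero_iff.2 hy), one_smul]

namespace IsHomogeneousIsometry

variable {τ : X → Y} (hτ : IsHomogeneousIsometry τ)
include hτ

theorem map_zero : τ 0 = 0 := by simpa using hτ.map_smul 0 0

theorem map_neg (x : X) : τ (-x) = -τ x := by simpa using hτ.map_smul (-1) x

theorem norm_add (x y : X) (h : ‖x‖ = ‖y‖) : ‖τ x + τ y‖ = ‖x + y‖ := by
  have := hτ.norm_sub x (-y) (by rwa [norm_neg])
  rwa [hτ.map_neg, sub_neg_eq_add, sub_neg_eq_add] at this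

theorem exists_rescale {x y : X} (hy : y ≠ 0) : ∃ y' : X, ‖y'‖ = ‖x‖ ∧ ‖y - y'‖ ≤ ‖x - y‖ ∧
    ‖y - y'‖ ≤ ‖τ x - τ y‖ ∧ ‖τ y - τ y'‖ = ‖y - y'‖ := by
  have hy0 := norm_ne_zero_iff.2 hy
  set c := ‖x‖ / ‖y‖ with hc
  have hyc : ‖y - c • y‖ = |‖y‖ - ‖x‖| := by
    rw [show y - c • y = (1 - c) • y by module, norm_smul, Real.norm_eq_abs]
    calc |1 - c| * ‖y‖ = |1 - c| * |‖y‖| := by rw [abs_norm]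
      _ = |(1 - c) * ‖y‖| := (abs_mul _ _).symm
      _ = |‖y‖ - ‖x‖| := by
        congr 1
        rw [hc]
        field_simp
  refine ⟨c • y, ?_, ?_, ?_, ?_⟩
  · rw [norm_smul, hc, norm_div, norm_norm, norm_norm, div_mul_cancel₀ _ hy0]
  · rw [hyc, abs_sub_comm]
    exact abs_norm_sub_norm_le _ _
  · rw [hyc, abs_sub_comm, ← hτ.norm_map x, ← hτ.norm_map y]
    exact abs_norm_sub_norm_le _ _
  · rw [hτ.map_smul, show τ y - c • τ y = (1 - c) • τ y by module, norm_smul, hτ.norm_map,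
      ← norm_smul]
    congr 1
    module

theorem norm_sub_le (x y : X) : ‖τ x - τ y‖ ≤ 3 * ‖x - y‖ := by
  rcases eq_or_ne y 0 with rfl | hy
  · rw [hτ.map_zero, sub_zero, sub_zero, hτ.norm_map]
    linarith [norm_nonneg x]
  obtain ⟨y', h1, h2, -, h4⟩ := hτ.exists_rescale (x := x) hy
  have h5 := hτ.norm_sub x y' h1.symm
  have h6 := norm_sub_le_norm_sub_add_norm_sub (τ x) (τ y') (τ y)
  have h7 := norm_sub_le_norm_sub_add_norm_sub x y y'
  rw [norm_sub_rev (τ y')] at h6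
  linarith

theorem continuous : Continuous τ :=
  (LipschitzWith.of_dist_le_mul (K := 3) fun x y => by
    rw [dist_eq_norm, dist_eq_norm]; exact hτ.norm_sub_le x y).continuous

theorem exists_linearIsometry (hadd : ∀ x y, τ (x + y) = τ x + τ y) :
    ∃ g : X →ₗᵢ[ℝ] Y, Function.Surjective g ∧ ∀ x, g x = τ x :=
  ⟨⟨{ toFun := τ, map_add' := hadd, map_smul' := hτ.map_smul }, hτ.norm_map⟩, hτ.surj,
    fun _ => rfl⟩

end IsHomogeneousIsometry

end Homogeneous

section OrthAdditive

variable {R : Type*} [NormedRing R] [NormedAlgebra ℝ R] [StarRing R] [CStarRing R] [StarModule ℝ R]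
  {Y : Type*} [NormedAddCommGroup Y] [NormedSpace ℝ Y]

/-- A homogeneous isometry which is additive on orthogonal pairs and on every orthogonal
complement of a nonzero element. -/
structure IsOrthAdditive (τ : R → Y) : Prop extends IsHomogeneousIsometry τ where
  map_add_of_orth : ∀ x y : R, Orth x y → τ (x + y) = τ x + τ y
  map_add_of_common_orth : ∀ z x y : R, z ≠ 0 → Orth z x → Orth z y → τ (x + y) = τ x + τ y

namespace HasPeirceGeometry

variable (hR : HasPeirceGeometry R)
include hR

theorem exists_pIso_under {x : R} (hx : x ≠ 0) : ∃ e : R, e ≠ 0 ∧ PIso e ∧ Under e x := by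
  obtain ⟨e, b, h0, he, -, -, -, hex, -⟩ := hR.peel _ (norm_inv_norm_smul hx) 1 one_pos
  refine ⟨e, h0, he, fun y hy => hex.1 y ?_, fun y hy => hex.2 y ?_⟩
  · rw [mul_smul_comm, hy, smul_zero]
  · rw [smul_mul_assoc, hy, smul_zero]

/-- To prove a continuous equality at a nonzero element it suffices to prove it at the peeled
approximations. -/
theorem eq_of_forall_peel {x : R} (hx : ‖x‖ = 1) {f g : R → Y} (hf : Continuous f)
    (hg : Continuous g)
    (h : ∀ e b : R, e ≠ 0 → PIso e → Orth e b → ‖b‖ ≤ 1 → Under e x → Under b x →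
      f (e + b) = g (e + b)) : f x = g x := by
  have hclosed : IsClosed {y | f y = g y} := isClosed_eq hf hg
  have : x ∈ closure {y | f y = g y} := by
    refine Metric.mem_closure_iff.2 fun ε hε => ?_
    obtain ⟨e, b, h0, he, heb, hb, hxe, h1, h2⟩ := hR.peel x hx (ε / 2) (by linarith)
    exact ⟨e + b, h e b h0 he heb hb h1 h2, by rw [dist_eq_norm]; linarith⟩
  rwa [hclosed.closure_eq] at this

theorem isOrthAdditive_sphereExtension {T : R → Y} (hT : IsSphereIsometry T) :
    IsOrthAdditive (sphereExtension T) := by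
  have hτ := hT.isHomogeneousIsometry fun x hx => hR.map_neg hT hx
  set τ := sphereExtension T with hτ_def
  have face : ∀ e : R, PIso e → e ≠ 0 → ∃ L : orthSubmodule e →ₗᵢ[ℝ] Y,
      ∀ (b : R) (hb : Orth e b), ‖b‖ ≤ 1 → τ (e + b) = τ e + L ⟨b, hb⟩ := by
    intro e he h0
    obtain ⟨L, hL⟩ := hR.exists_linearIsometry hT he h0
    refine ⟨L, fun b hb hb1 => ?_⟩
    rw [hτ_def, sphereExtension_eq (hR.norm_pIso_add he h0 hb1 hb),
      sphereExtension_eq (he.norm_eq_one h0)]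
    exact hL ⟨b, hb⟩ hb1
  have lin : ∀ e : R, PIso e → e ≠ 0 → ∃ L : orthSubmodule e →ₗᵢ[ℝ] Y,
      (∀ (b : R) (hb : Orth e b), ‖b‖ ≤ 1 → τ (e + b) = τ e + L ⟨b, hb⟩) ∧
      ∀ (b : R) (hb : Orth e b), τ b = L ⟨b, hb⟩ := by
    intro e he h0
    obtain ⟨L, hL⟩ := face e he h0
    refine ⟨L, hL, ?_⟩
    have hen := (he.norm_eq_one h0).le
    have approx : ∀ f b : R, f ≠ 0 → PIso f → Orth f b → ‖b‖ ≤ 1 → Orth e f → ∀ hb : Orth e b,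
        ∀ hfb : Orth e (f + b), τ (f + b) = L ⟨f + b, hfb⟩ := by
      intro f b hf0 hf hfb hb hef heb hefb
      obtain ⟨K, hK⟩ := face f hf hf0
      have h1 := hK (e + b) (hef.symm.add_right hfb) (hR.norm_add_le_one hen hb heb)
      have h2 := hK (-e + b) (hef.symm.neg_right.add_right hfb)
        (hR.norm_add_le_one (by rwa [norm_neg]) hb
          (by simpa using (heb.symm.neg_right).symm))
      have h3 := hK b hfb hb
      have hfb1 := hR.norm_add_le_one (hf.norm_eq_one hf0).le hb hfb
      have h4 := hL (f + b) hefb hfb1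
      have h5 := hL (-(f + b)) hefb.neg_right (by rwa [norm_neg])
      have k1 : K ⟨e + b, hef.symm.add_right hfb⟩ = K ⟨e, hef.symm⟩ + K ⟨b, hfb⟩ := by
        rw [← map_add]; rfl
      have k2 : K ⟨-e + b, hef.symm.neg_right.add_right hfb⟩ = -K ⟨e, hef.symm⟩ + K ⟨b, hfb⟩ := by
        rw [← _root_.map_neg K, ← map_add]; rfl
      have k3 : L ⟨-(f + b), hefb.neg_right⟩ = -L ⟨f + b, hefb⟩ :=
        _root_.map_neg L ⟨f + b, hefb⟩
      rw [k1, show f + (e + b) = e + (f + b) by abel, h4] at h1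
      rw [k2, show f + (-e + b) = -(e + -(f + b)) by abel, hτ.map_neg, h5, k3] at h2
      have h6 : (2 : ℝ) • τ (f + b) = (2 : ℝ) • L ⟨f + b, hefb⟩ := by
        rw [h3]
        have : _ + _ = _ + _ := congrArg₂ (· + ·) h1 h2
        calc (2 : ℝ) • (τ f + K ⟨b, hfb⟩) = τ f + (K ⟨e, hef.symm⟩ + K ⟨b, hfb⟩) +
            (τ f + (-K ⟨e, hef.symm⟩ + K ⟨b, hfb⟩)) := by rw [two_smul]; abel
          _ = _ := by rw [← this, two_smul]; abel
      exact smul_right_injective _ (two_ne_zero' ℝ) h6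
    have unit : ∀ (b : R) (hb : Orth e b), ‖b‖ = 1 → τ b = L ⟨b, hb⟩ := by
      intro b hb hb1
      have key : ∀ ε : ℝ, 0 < ε → ‖τ b - L ⟨b, hb⟩‖ ≤ 0 + ε := by
        intro ε hε
        obtain ⟨f, c, hf0, hf, hfc, hc, hbf, h1, h2⟩ := hR.peel b hb1 (ε / 4) (by linarith)
        have hef := hb.under_right h1
        have hec := hb.under_right h2
        have h3 := approx f c hf0 hf hfc hc hef hec (hef.add_right hec)
        have h4 := hτ.norm_sub_le b (f + c)
        have h5 : ‖L ⟨f + c, hef.add_right hec⟩ - L ⟨b, hb⟩‖ = ‖b - (f + c)‖ := by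
          rw [← map_sub, L.norm_map, norm_sub_rev]; rfl
        have h6 := norm_sub_le_norm_sub_add_norm_sub (τ b) (τ (f + c)) (L ⟨b, hb⟩)
        rw [h3] at h6 h4
        linarith
      exact sub_eq_zero.1 (norm_le_zero_iff.1 (le_of_forall_pos_le_add key))
    intro b hb
    rcases eq_or_ne b 0 with rfl | hb0
    · rw [hτ.map_zero]
      exact (L.map_zero).symm
    · have h1 := unit _ (hb.smul_right ‖b‖⁻¹) (norm_inv_norm_smul hb0)
      have h2 : L ⟨‖b‖⁻¹ • b, hb.smul_right ‖b‖⁻¹⟩ = ‖b‖⁻¹ • L ⟨b, hb⟩ := by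
        rw [← map_smul]; rfl
      rw [h2, hτ.map_smul] at h1
      exact smul_right_injective _ (inv_ne_zero (norm_ne_zero_iff.2 hb0)) h1
  have common : ∀ z x y : R, z ≠ 0 → Orth z x → Orth z y → τ (x + y) = τ x + τ y := by
    intro z x y hz hx hy
    obtain ⟨e, h0, he, hez⟩ := hR.exists_pIso_under hz
    obtain ⟨L, -, hL⟩ := lin e he h0
    rw [hL x (hx.under hez), hL y (hy.under hez),
      hL (x + y) ((hx.under hez).add_right (hy.under hez)), ← map_add]
    rfl
  have orthUnit : ∀ x y : R, ‖x‖ = 1 → ‖y‖ ≤ 1 → Orth x y → τ (x + y) = τ x + τ y := by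
    intro x y hx hy hxy
    refine hR.eq_of_forall_peel hx (f := fun x => τ (x + y)) (g := fun x => τ x + τ y)
      (hτ.continuous.comp (continuous_id.add continuous_const))
      (hτ.continuous.add continuous_const) ?_
    intro f b hf0 hf hfb hb hfx hbx
    obtain ⟨L, hL, hL'⟩ := lin f hf hf0
    have hfy := hxy.under hfx
    have hby := hxy.under hbx
    have h1 := hL (b + y) (hfb.add_right hfy) (hR.norm_add_le_one hb hy hby)
    have h2 : L ⟨b + y, hfb.add_right hfy⟩ = L ⟨b, hfb⟩ + L ⟨y, hfy⟩ := by rw [← map_add]; rfl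
    rw [add_assoc, h1, h2, ← add_assoc, ← hL b hfb hb, ← hL' y hfy]
  have orthLe : ∀ x y : R, ‖y‖ ≤ ‖x‖ → Orth x y → τ (x + y) = τ x + τ y := by
    intro x y hxy h
    rcases eq_or_ne x 0 with rfl | hx
    · rw [zero_add, hτ.map_zero, zero_add]
    have hn := norm_pos_iff.2 hx
    have h1 := orthUnit (‖x‖⁻¹ • x) (‖x‖⁻¹ • y) (norm_inv_norm_smul hx)
      (by rw [norm_smul, norm_inv, norm_norm, inv_mul_le_iff₀ hn, mul_one]; exact hxy)
      ((h.smul_right _).smul_left _)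
    rw [← smul_add, hτ.map_smul, hτ.map_smul, hτ.map_smul, ← smul_add] at h1
    exact smul_right_injective _ (inv_ne_zero hn.ne') h1
  refine ⟨hτ, fun x y h => ?_, common⟩
  rcases le_total ‖y‖ ‖x‖ with h1 | h1
  · exact orthLe x y h1 h
  · rw [add_comm, orthLe y x h1 h.symm, add_comm]

end HasPeirceGeometry

end OrthAdditive

/-! ### Projections and factors of rank two -/

section Projections

variable {R : Type*} [NormedRing R] [NormedAlgebra ℝ R] [StarRing R] [CStarRing R] [StarModule ℝ R]

variable (R) in
/-- The facts about projections in a real von Neumann algebra used to glue corners together. -/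
structure HasProjections : Prop where
  exists_central : ∀ x y : R, x ≠ 0 → y ≠ 0 → (∀ a, x * a * y = 0) →
    ∃ z : R, IsStarProjection z ∧ z ≠ 0 ∧ z ≠ 1 ∧ ∀ a, z * a = a * z
  eq_smul_or : ∀ b p : R, IsSelfAdjoint b → IsStarProjection p → p * b = b → b * p = b →
    (∃ c : ℝ, b = c • p) ∨
      ∃ g : R, IsStarProjection g ∧ g * p = g ∧ p * g = g ∧ g ≠ 0 ∧ g ≠ p ∧ g * b = b * g
  nonneg : ∀ (x s : R) (c : ℝ), IsStarProjection s → s ≠ 0 → star x * x = c • s → 0 ≤ c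
  mul_eq_of_four : ∀ h g : R, ‖h‖ ≤ 1 → IsStarProjection g →
    star ((1 + h) * g) * ((1 + h) * g) = (4 : ℝ) • g → h * g = g
  star_mul_mul_eq : ∀ z k : R, ‖z‖ ≤ 1 → IsStarProjection k → star (z * k) * (z * k) = k →
    star z * z * k = k

/-- A projection dominating no other projection than itself and zero. -/
def IsMinimalProjection (p : R) : Prop :=
  IsStarProjection p ∧ ∀ g : R, IsStarProjection g → g * p = g → p * g = g → g = 0 ∨ g = p

theorem IsStarProjection.mul_self {p : R} (hp : IsStarProjection p) : p * p = p :=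
  hp.isIdempotentElem.eq

theorem IsStarProjection.star_eq {p : R} (hp : IsStarProjection p) : star p = p :=
  hp.isSelfAdjoint.star_eq

theorem IsStarProjection.of_mul_eq {p : R} (h1 : p * p = p) (h2 : star p = p) :
    IsStarProjection p := ⟨h1, h2⟩

theorem IsStarProjection.mul_eq_comm {g p : R} (hg : IsStarProjection g) (hp : IsStarProjection p)
    (h : g * p = g) : p * g = g := by
  have := congrArg star h
  rwa [star_mul, hg.star_eq, hp.star_eq] at this

theorem star_mul_self_ne_zero' {x : R} (hx : x ≠ 0) : star x * x ≠ 0 := fun h =>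
  hx ((CStarRing.star_mul_self_eq_zero_iff _).1 h)

theorem PIso.mul_star_mul {e : R} (he : PIso e) : e * (star e * e) = e := by
  rw [← mul_assoc, he]

theorem PIso.star_mul_mul_star {e : R} (he : PIso e) : star e * (e * star e) = star e := by
  have := he.star_pIso
  rwa [PIso, star_star, mul_assoc] at this

theorem PIso.of_isStarProjection {e : R} (h : star e * e * (star e * e) = star e * e) : PIso e := by
  have h1 : star (e * star e * e - e) * (e * star e * e - e) = 0 := by
    have : star (e * star e * e - e) * (e * star e * e - e) =
      star e * e * (star e * e) * (star e * e) - star e * e * (star e * e)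
        - (star e * e * (star e * e) - star e * e) := by
      simp only [star_sub, star_mul, star_star]
      noncomm_ring
    rw [this, h, h]
    simp
  exact sub_eq_zero.1 ((CStarRing.star_mul_self_eq_zero_iff _).1 h1)

theorem IsMinimalProjection.mul_star {e : R} (he : PIso e)
    (h : IsMinimalProjection (star e * e)) : IsMinimalProjection (e * star e) := by
  have hp : IsStarProjection (e * star e) := by simpa using he.star_pIso.isStarProjection
  refine ⟨hp, fun g hg h1 h2 => ?_⟩
  have key : g = e * (star e * g * e) * star e := by
    calc g = (e * star e) * (g * (e * star e)) := by rw [h1, h2]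
      _ = _ := by noncomm_ring
  have hge : star e * g * e * (star e * e) = star e * g * e := by
    rw [mul_assoc, mul_assoc, he.mul_star_mul, ← mul_assoc]
  have hge' : star e * e * (star e * g * e) = star e * g * e := by
    calc star e * e * (star e * g * e) = star e * (e * star e) * (g * e) := by noncomm_ring
      _ = _ := by rw [he.star_mul_mul_star, mul_assoc]
  have hq : IsStarProjection (star e * g * e) := by
    refine .of_mul_eq ?_ ?_
    · calc star e * g * e * (star e * g * e) = star e * (g * (e * star e)) * (g * e) := by
            noncomm_ring
        _ = star e * (g * g) * e := by rw [h1]; noncomm_ring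
        _ = _ := by rw [hg.mul_self]
    · rw [star_mul, star_mul, hg.star_eq, star_star, mul_assoc]
  rcases h.2 _ hq hge hge' with h0 | h0
  · left
    rw [key, h0]
    simp
  · right
    rw [key, h0, he.mul_star_mul]

namespace HasProjections

variable (hP : HasProjections R)
include hP

theorem exists_smul_of_minimal {p b : R} (hp : IsMinimalProjection p) (hb : IsSelfAdjoint b)
    (h1 : p * b = b) (h2 : b * p = b) : ∃ c : ℝ, b = c • p := by
  rcases hP.eq_smul_or b p hb hp.1 h1 h2 with h | ⟨g, hg, h3, h4, h5, h6, -⟩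
  · exact h
  · rcases hp.2 g hg h3 h4 with h | h
    · exact absurd h h5
    · exact absurd h h6

theorem exists_compression {p r : R} (hp : IsMinimalProjection p) (h0 : p ≠ 0)
    (hr : IsStarProjection r) : ∃ c : ℝ, 0 ≤ c ∧ p * r * p = c • p ∧ ‖r * p * r‖ = c := by
  have hb : IsSelfAdjoint (p * r * p) := by
    rw [IsSelfAdjoint, star_mul, star_mul, hp.1.star_eq, hr.star_eq, mul_assoc]
  obtain ⟨c, hc⟩ := hP.exists_smul_of_minimal hp hb
    (by rw [mul_assoc, ← mul_assoc, hp.1.mul_self]) (by rw [mul_assoc, hp.1.mul_self])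
  have h1 : star (r * p) * (r * p) = c • p := by
    rw [star_mul, hp.1.star_eq, hr.star_eq, ← hc]
    calc p * r * (r * p) = p * (r * r) * p := by noncomm_ring
      _ = _ := by rw [hr.mul_self]
  have hc0 := hP.nonneg _ _ _ hp.1 h0 h1
  refine ⟨c, hc0, hc, ?_⟩
  have h2 : r * p * r = (r * p) * star (r * p) := by
    rw [star_mul, hp.1.star_eq, hr.star_eq]
    calc r * p * r = r * (p * p) * r := by rw [hp.1.mul_self]
      _ = _ := by noncomm_ring
  rw [h2, CStarRing.norm_self_mul_star, ← CStarRing.norm_star_mul_self, h1, norm_smul,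
    hp.1.norm_eq_one h0, mul_one, Real.norm_of_nonneg hc0]

/-- A sum of two minimal projections does not split into three nonzero projections. -/
theorem eq_zero_of_three {p r₁ r₂ r₃ : R} (hp : IsMinimalProjection p)
    (hq : IsMinimalProjection (1 - p)) (hp0 : p ≠ 0) (hp1 : 1 - p ≠ 0) (h₁ : IsStarProjection r₁)
    (h₂ : IsStarProjection r₂) (h₃ : IsStarProjection r₃) (hsum : r₁ + r₂ + r₃ = 1)
    (h1 : r₁ ≠ 0) (h2 : r₂ ≠ 0) : r₃ = 0 := by
  by_contra h3
  have key : ∀ r : R, IsStarProjection r → r ≠ 0 → ∃ c d : ℝ, p * r * p = c • p ∧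
      (1 - p) * r * (1 - p) = d • (1 - p) ∧ 1 ≤ c + d := by
    intro r hr h0
    obtain ⟨c, -, hc, hc'⟩ := hP.exists_compression hp hp0 hr
    obtain ⟨d, -, hd, hd'⟩ := hP.exists_compression hq hp1 hr
    refine ⟨c, d, hc, hd, ?_⟩
    rw [← hr.norm_eq_one h0, ← hc', ← hd']
    refine le_trans (le_of_eq ?_) (norm_add_le _ _)
    congr 1
    calc r = r * r := hr.mul_self.symm
      _ = _ := by noncomm_ring
  obtain ⟨c₁, d₁, e1, f1, g1⟩ := key r₁ h₁ h1
  obtain ⟨c₂, d₂, e2, f2, g2⟩ := key r₂ h₂ h2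
  obtain ⟨c₃, d₃, e3, f3, g3⟩ := key r₃ h₃ h3
  have total : ∀ (s : R) (a b c : ℝ), IsStarProjection s → s ≠ 0 → s * r₁ * s = a • s →
      s * r₂ * s = b • s → s * r₃ * s = c • s → a + b + c = 1 := by
    intro s a b c hs hs0 ha hb hc
    have : (a + b + c) • s = (1 : ℝ) • s := by
      rw [add_smul, add_smul, ← ha, ← hb, ← hc, ← add_mul, ← add_mul, ← mul_add, ← mul_add, hsum,
        mul_one, hs.mul_self, one_smul]
    exact smul_left_injective ℝ hs0 this
  have t1 := total p _ _ _ hp.1 hp0 e1 e2 e3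
  have t2 := total (1 - p) _ _ _ hq.1 hp1 f1 f2 f3
  linarith

theorem isMinimalProjection_of_rank_two {p g : R} (hp : IsMinimalProjection p)
    (hq : IsMinimalProjection (1 - p)) (hp0 : p ≠ 0) (hp1 : 1 - p ≠ 0) (hg : IsStarProjection g)
    (hg1 : 1 - g ≠ 0) : IsMinimalProjection g := by
  refine ⟨hg, fun k hk h1 h2 => ?_⟩
  by_cases hk0 : k = 0
  · exact Or.inl hk0
  right
  have := hP.eq_zero_of_three hp hq hp0 hp1 (r₁ := k) (r₂ := 1 - g) (r₃ := g - k) hk hg.one_sub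
    (hk.sub_of_mul_eq_left hg h1) (by abel) hk0 hg1
  exact (sub_eq_zero.1 this).symm

end HasProjections

end Projections

/-! ### Linearity on a rotated minimal partial isometry -/

section RankTwo

variable {R : Type*} [NormedRing R] [NormedAlgebra ℝ R] [StarRing R] [CStarRing R] [StarModule ℝ R]
  {Y : Type*} [NormedAddCommGroup Y] [NormedSpace ℝ Y] {τ : R → Y}

theorem IsOrthAdditive.comp_star (hτ : IsOrthAdditive τ) : IsOrthAdditive fun x => τ (star x) where
  map_smul c x := by rw [star_smul, star_trivial, hτ.map_smul]
  norm_map x := by rw [hτ.norm_map, norm_star]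
  norm_sub x y h := by
    rw [hτ.norm_sub _ _ (by rwa [norm_star, norm_star]), ← star_sub, norm_star]
  surj := hτ.surj.comp star_involutive.surjective
  map_add_of_orth x y h := by rw [star_add, hτ.map_add_of_orth _ _ h.star_star]
  map_add_of_common_orth z x y hz h1 h2 := by
    rw [star_add, hτ.map_add_of_common_orth (star z) _ _ (star_ne_zero.2 hz) h1.star_star
      h2.star_star]

theorem Orth.mul_right {x y w : R} (hw : w * star w = 1) (h : Orth x y) :
    Orth (x * w) (y * w) := by
  constructor
  · rw [star_mul, mul_assoc, ← mul_assoc (star x), h.1, zero_mul, mul_zero]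
  · rw [star_mul, mul_assoc, ← mul_assoc w, hw, one_mul, h.2]

theorem IsOrthAdditive.comp_mul_right (hτ : IsOrthAdditive τ) {w : R} (hw : star w * w = 1)
    (hw' : w * star w = 1) : IsOrthAdditive fun x => τ (x * w) := by
  have hn : ∀ x : R, ‖x * w‖ = ‖x‖ := fun x => CStarRing.norm_mul_mem_unitary x ⟨hw, hw'⟩
  refine ⟨⟨fun c x => ?_, fun x => ?_, fun x y h => ?_, fun y => ?_⟩, fun x y h => ?_,
    fun z x y hz h1 h2 => ?_⟩
  · rw [smul_mul_assoc, hτ.map_smul]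
  · rw [hτ.norm_map, hn]
  · rw [hτ.norm_sub _ _ (by rwa [hn, hn]), ← sub_mul, hn]
  · obtain ⟨x, rfl⟩ := hτ.surj y
    exact ⟨x * star w, by rw [mul_assoc, hw, mul_one]⟩
  · rw [add_mul, hτ.map_add_of_orth _ _ (h.mul_right hw')]
  · refine (congrArg τ (add_mul x y w)).trans
      (hτ.map_add_of_common_orth (z * w) _ _ ?_ (h1.mul_right hw') (h2.mul_right hw'))
    rw [← norm_ne_zero_iff, hn]
    exact norm_ne_zero_iff.2 hz

theorem isStarProjection_half_one_add {G : R} (hG : star G = G) (hG2 : G * G = 1) :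
    IsStarProjection ((1 / 2 : ℝ) • (1 + G)) := by
  refine .of_mul_eq ?_ ?_
  · simp only [smul_mul_assoc, mul_smul_comm, add_mul, mul_add, one_mul, mul_one, hG2]
    module
  · rw [star_smul, star_trivial, star_add, star_one, hG]

/-- Additivity on the plane spanned by a unitary and its product with a symmetry. -/
theorem IsOrthAdditive.map_add_symmetry (hτ : IsOrthAdditive τ) {U F : R} (hU : star U * U = 1)
    (hU' : U * star U = 1) (hF : star F = F) (hF2 : F * F = 1) (hUF : F * star U = U * F)
    (ρ σ : ℝ) : τ (ρ • U + σ • F) = ρ • τ U + σ • τ F := by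
  set G := star U * F with hG
  have hG1 : star G = G := by
    rw [hG, star_mul, star_star, hF]
    calc F * U = star U * (U * F) * U := by rw [← mul_assoc, hU, one_mul]
      _ = star U * F * (star U * U) := by rw [← hUF]; noncomm_ring
      _ = _ := by rw [hU, mul_one]
  have hG2 : G * G = 1 := by
    calc G * G = star U * (F * star U) * F := by rw [hG]; noncomm_ring
      _ = (star U * U) * (F * F) := by rw [hUF]; noncomm_ring
      _ = 1 := by rw [hU, hF2, one_mul]
  have hFG : F = U * G := by rw [hG, ← mul_assoc, hU', one_mul]
  have hg := isStarProjection_half_one_add hG1 hG2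
  set g := (1 / 2 : ℝ) • (1 + G) with hgdef
  have hGg : G = (2 : ℝ) • g - 1 := by rw [hgdef]; module
  have horth : Orth (U * g) (U * (1 - g)) := by
    constructor
    · rw [star_mul, mul_assoc, ← mul_assoc (star U), hU, one_mul, hg.star_eq, hg.mul_one_sub_self]
    · rw [star_mul, hg.one_sub.star_eq, mul_assoc, ← mul_assoc g, hg.mul_one_sub_self]
      simp
  have key : ∀ α β : ℝ, τ (α • (U * g) + β • (U * (1 - g))) =
      α • τ (U * g) + β • τ (U * (1 - g)) := by
    intro α β
    rw [hτ.map_add_of_orth _ _ ((horth.smul_left α).smul_right β), hτ.map_smul, hτ.map_smul]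
  have e1 : U = (1 : ℝ) • (U * g) + (1 : ℝ) • (U * (1 - g)) := by
    rw [one_smul, one_smul]; noncomm_ring
  have e2 : F = (1 : ℝ) • (U * g) + (-1 : ℝ) • (U * (1 - g)) := by
    rw [hFG, hGg]
    simp only [mul_sub, mul_smul_comm, mul_one]
    module
  have e3 : ρ • U + σ • F = (ρ + σ) • (U * g) + (ρ - σ) • (U * (1 - g)) := by
    rw [e2]
    nth_rewrite 1 [e1]
    module
  have f1 := key 1 1
  have f2 := key 1 (-1)
  rw [← e1] at f1
  rw [← e2] at f2
  rw [e3, key, f1, f2]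
  module

theorem norm_add_symmetry {U F J : R} (hU : star U * U = 1)
    (hU' : U * star U = 1) (hF : star F = F) (hF2 : F * F = 1) (hUF : F * star U = U * F)
    (hJF : J * F = -(F * J)) (hJU : J * U = U * J) (hJ : J * J = -1) [Nontrivial R]
    {ρ σ : ℝ} (hρ : 0 ≤ ρ) (hσ : 0 ≤ σ) : ‖ρ • U + σ • F‖ = ρ + σ := by
  have nU : ‖U‖ = 1 := CStarRing.norm_of_mem_unitary ⟨hU, hU'⟩
  have nF : ‖F‖ = 1 := CStarRing.norm_of_mem_unitary ⟨by rw [hF, hF2], by rw [hF, hF2]⟩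
  refine le_antisymm ?_ ?_
  · refine (norm_add_le _ _).trans ?_
    rw [norm_smul, norm_smul, nU, nF, Real.norm_of_nonneg hρ, Real.norm_of_nonneg hσ]
    simp
  · have h0 : U + F ≠ 0 := by
      intro h
      have h1 : F = -U := eq_neg_of_add_eq_zero_right h
      have h2 : J * F = F * J := by rw [h1, mul_neg, neg_mul, hJU]
      have h3 : J * F = 0 := by
        have : (2 : ℝ) • (J * F) = 0 := by
          rw [two_smul]; nth_rewrite 1 [hJF]; rw [h2]; simp
        exact (smul_eq_zero.1 this).resolve_left two_ne_zero
      have h4 : J * (J * F) = -F := by rw [← mul_assoc, hJ, neg_one_mul]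
      rw [h3, mul_zero, zero_eq_neg] at h4
      rw [h4, norm_zero] at nF
      exact zero_ne_one nF
    have h1 : (ρ • U + σ • F) * (star U * (U + F)) = (ρ + σ) • (U + F) := by
      have h2 : F * star U * F = U := by rw [hUF, mul_assoc, hF2, mul_one]
      calc (ρ • U + σ • F) * (star U * (U + F)) = ρ • ((U * star U) * U) + ρ • ((U * star U) * F)
            + σ • (F * (star U * U)) + σ • (F * star U * F) := by
            simp only [add_mul, mul_add, smul_mul_assoc, mul_assoc]
            abel
        _ = _ := by rw [hU', hU, h2, one_mul, one_mul, mul_one]; module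
    have h2 := norm_mul_le (ρ • U + σ • F) (star U * (U + F))
    rw [h1, norm_smul, CStarRing.norm_mem_unitary_mul _ (Unitary.star_mem ⟨hU, hU'⟩),
      Real.norm_of_nonneg (add_nonneg hρ hσ)] at h2
    exact le_of_mul_le_mul_right h2 (norm_pos_iff.2 h0)

/-- In rank two, a contraction at distance two from `-D` agrees with `D` on a projection. -/
theorem HasProjections.exists_agree (hR : HasPeirceGeometry R) (hP : HasProjections R) {p : R}
    (hp : IsMinimalProjection p) (hq : IsMinimalProjection (1 - p)) (hp0 : p ≠ 0)
    (hp1 : 1 - p ≠ 0) {z D : R} (hz : ‖z‖ ≤ 1) (hD : star D = D) (hD2 : D * D = 1)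
    (hzD : ‖z + D‖ = 2) : ∃ k : R, IsStarProjection k ∧ k ≠ 0 ∧ z * k = D * k := by
  have hDu : D ∈ unitary R := ⟨by rw [hD, hD2], by rw [hD, hD2]⟩
  have : Nontrivial R := ⟨p, 0, hp0⟩
  suffices ∃ g : R, IsStarProjection g ∧ g ≠ 0 ∧ z * D * g = g by
    obtain ⟨g, hg, h0, h1⟩ := this
    refine ⟨D * g * D, .of_mul_eq ?_ ?_, ?_, ?_⟩
    · calc D * g * D * (D * g * D) = D * g * (D * D) * g * D := by noncomm_ring
        _ = D * (g * g) * D := by rw [hD2]; noncomm_ring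
        _ = _ := by rw [hg.mul_self]
    · rw [star_mul, star_mul, hD, hg.star_eq, mul_assoc]
    · intro h
      apply h0
      calc g = (D * D) * g * (D * D) := by rw [hD2]; simp
        _ = D * (D * g * D) * D := by noncomm_ring
        _ = 0 := by rw [h]; simp
    · calc z * (D * g * D) = (z * D * g) * D := by noncomm_ring
        _ = (D * D) * g * D := by rw [h1, hD2, one_mul]
        _ = _ := by noncomm_ring
  set h := z * D with hh
  have hn : ‖h‖ ≤ 1 := by rwa [hh, CStarRing.norm_mul_mem_unitary _ hDu]
  have h2 : ‖1 + h‖ = 2 := by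
    rw [← hzD, ← CStarRing.norm_mul_mem_unitary (z + D) hDu, add_mul, hD2, add_comm]
  set a := star (1 + h) * (1 + h) with ha
  have hna : ‖a‖ = 4 := by rw [ha, CStarRing.norm_star_mul_self, h2]; norm_num
  have hself : IsSelfAdjoint a := IsSelfAdjoint.star_mul_self _
  have four : ∀ g : R, IsStarProjection g → a * g = (4 : ℝ) • g → h * g = g := by
    intro g hg hag
    refine hP.mul_eq_of_four h g hn hg ?_
    calc star ((1 + h) * g) * ((1 + h) * g) = g * (a * g) := by
          rw [star_mul, hg.star_eq, ha]; noncomm_ring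
      _ = _ := by rw [hag, mul_smul_comm, hg.mul_self]
  rcases hP.eq_smul_or a 1 hself (.one _) (one_mul _) (mul_one _) with
    ⟨c, hc⟩ | ⟨g, hg, -, -, hg0, hg1, hga⟩
  · have hc0 := hP.nonneg (1 + h) 1 c (.one _) one_ne_zero hc
    have hc4 : c = 4 := by
      rw [hc, norm_smul, CStarRing.norm_one, mul_one, Real.norm_of_nonneg hc0] at hna
      exact hna
    exact ⟨1, .one _, one_ne_zero, four 1 (.one _) (by rw [hc, hc4, mul_one])⟩
  · have hg1' : 1 - g ≠ 0 := fun h => hg1 (sub_eq_zero.1 h).symm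
    have eig : ∀ g : R, IsStarProjection g → g ≠ 0 → 1 - g ≠ 0 → g * a = a * g →
        ∃ c : ℝ, 0 ≤ c ∧ a * g = c • g := by
      intro g hg hg0 hg1 hga
      have hgm := hP.isMinimalProjection_of_rank_two hp hq hp0 hp1 hg hg1
      obtain ⟨c, hc⟩ := hP.exists_smul_of_minimal hgm (b := a * g)
        (by rw [IsSelfAdjoint, star_mul, hself.star_eq, hg.star_eq, hga])
        (by rw [← mul_assoc, hga, mul_assoc, hg.mul_self]) (by rw [mul_assoc, hg.mul_self])
      refine ⟨c, hP.nonneg ((1 + h) * g) g c hg hg0 ?_, hc⟩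
      calc star ((1 + h) * g) * ((1 + h) * g) = g * (a * g) := by
            rw [star_mul, hg.star_eq, ha]; noncomm_ring
        _ = _ := by rw [hc, mul_smul_comm, hg.mul_self]
    obtain ⟨α, hα, hag⟩ := eig g hg hg0 hg1' hga
    obtain ⟨β, hβ, hag'⟩ := eig (1 - g) hg.one_sub hg1' (by simpa using hg0)
      (by rw [sub_mul, mul_sub, hga]; simp)
    have hsum : a = α • g + β • (1 - g) := by rw [← hag, ← hag', ← mul_add]; simp
    have horth : Orth (α • g) (β • (1 - g)) := by
      refine Orth.smul_left (Orth.smul_right ⟨?_, ?_⟩ _) _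
      · rw [hg.star_eq, hg.mul_one_sub_self]
      · rw [hg.one_sub.star_eq, hg.mul_one_sub_self]
    have le1 := hR.norm_add_le _ _ horth
    have le2 := horth.norm_le_norm_add
    have le3 := horth.symm.norm_le_norm_add
    rw [add_comm] at le3
    rw [← hsum, hna, norm_smul, norm_smul, hg.norm_eq_one hg0, hg.one_sub.norm_eq_one hg1',
      Real.norm_of_nonneg hα, Real.norm_of_nonneg hβ, mul_one, mul_one] at le1
    rw [← hsum, hna, norm_smul, hg.norm_eq_one hg0, Real.norm_of_nonneg hα, mul_one] at le2
    rw [← hsum, hna, norm_smul, hg.one_sub.norm_eq_one hg1', Real.norm_of_nonneg hβ, mul_one] at le3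
    rcases le_max_iff.1 le1 with h4 | h4
    · exact ⟨g, hg, hg0, four g hg (by rw [hag, le_antisymm le2 h4])⟩
    · exact ⟨1 - g, hg.one_sub, hg1', four _ hg.one_sub (by rw [hag', le_antisymm le3 h4])⟩

theorem HasProjections.isSelfAdjoint_mul (hR : HasPeirceGeometry R) (hP : HasProjections R) {p : R}
    (hp : IsMinimalProjection p) (hq : IsMinimalProjection (1 - p)) (hp0 : p ≠ 0)
    (hp1 : 1 - p ≠ 0) {z D : R} (hz : ‖z‖ ≤ 1) (hD : star D = D) (hD2 : D * D = 1)
    (hzD : ‖z + D‖ = 2) (hzD' : ‖z - D‖ = 2) : star z * D = D * z := by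
  obtain ⟨k, hk, hk0, hzk⟩ := hP.exists_agree hR hp hq hp0 hp1 hz hD hD2 hzD
  obtain ⟨l, hl, hl0, hzl⟩ := hP.exists_agree hR hp hq hp0 hp1 hz (D := -D)
    (by rw [star_neg, hD]) (by simpa using hD2) (by rwa [← sub_eq_add_neg])
  have h1 := hP.star_mul_mul_eq z k hz hk (by
    rw [hzk, star_mul, hD, hk.star_eq]
    calc k * D * (D * k) = k * (D * D) * k := by noncomm_ring
      _ = k := by rw [hD2, mul_one, hk.mul_self])
  have h2 : l * k = 0 := by
    have h3 : l * k = -(l * k) := by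
      calc l * k = l * (star z * z * k) := by rw [h1]
        _ = star (z * l) * (z * k) := by rw [star_mul, hl.star_eq]; noncomm_ring
        _ = -(l * (D * D) * k) := by rw [hzl, hzk, star_mul, hl.star_eq, star_neg, hD]; noncomm_ring
        _ = _ := by rw [hD2, mul_one]
    have : (2 : ℝ) • (l * k) = 0 := by rw [two_smul]; nth_rewrite 1 [h3]; simp
    exact (smul_eq_zero.1 this).resolve_left two_ne_zero
  have h2' : k * l = 0 := by simpa [hl.star_eq, hk.star_eq] using congrArg star h2
  have hlk : IsStarProjection (1 - k - l) :=
    hl.sub_of_mul_eq_left hk.one_sub (by rw [mul_sub, h2, mul_one, sub_zero])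
  have h3 := hP.eq_zero_of_three hp hq hp0 hp1 hk hl hlk (by abel) hk0 hl0
  have hkl : k + l = 1 := by
    rw [sub_sub, sub_eq_zero] at h3
    exact h3.symm
  have hz' : z = D * (k - l) := by
    calc z = z * k + z * l := by rw [← mul_add, hkl, mul_one]
      _ = _ := by rw [hzk, hzl]; noncomm_ring
  have hDz : D * z = k - l := by rw [hz', ← mul_assoc, hD2, one_mul]
  have := congrArg star hDz
  rwa [star_mul, hD, star_sub, hk.star_eq, hl.star_eq, ← hDz] at this

end RankTwo

section Plane

variable {R : Type*} [NormedRing R] [NormedAlgebra ℝ R] [StarRing R] [CStarRing R] [StarModule ℝ R]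
  {Y : Type*} [NormedAddCommGroup Y] [NormedSpace ℝ Y] {τ : R → Y}

/-- A symmetry `S` anticommuting with a complex structure `J`. -/
structure IsRotationPair (S J : R) : Prop where
  star_left : star S = S
  left_mul_self : S * S = 1
  star_right : star J = -J
  right_mul_self : J * J = -1
  left_mul_right : S * J = -(J * S)

/-- The element `a + b J` of the plane spanned by `1` and `J`. -/
def planeElt (J : R) (a b : ℝ) : R := a • (1 : R) + b • J

namespace IsRotationPair

variable {S J : R} (h : IsRotationPair S J)
include h

theorem planeElt_mul (a b c d : ℝ) :
    planeElt J a b * planeElt J c d = planeElt J (a * c - b * d) (a * d + b * c) := by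
  simp only [planeElt, add_mul, mul_add, smul_mul_assoc, mul_smul_comm, one_mul, mul_one,
    h.right_mul_self]
  module

theorem star_planeElt (a b : ℝ) : star (planeElt J a b) = planeElt J a (-b) := by
  simp only [planeElt, star_add, star_smul, star_trivial, star_one, h.star_right]
  module

theorem left_mul_planeElt (a b : ℝ) : S * planeElt J a b = planeElt J a (-b) * S := by
  simp only [planeElt, mul_add, add_mul, mul_smul_comm, smul_mul_assoc, one_mul, mul_one,
    h.left_mul_right]
  module

theorem star_mul_planeElt (a b : ℝ) :
    star (planeElt J a b) * planeElt J a b = (a ^ 2 + b ^ 2) • (1 : R) := by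
  rw [h.star_planeElt, h.planeElt_mul, planeElt]
  module

theorem planeElt_mul_star (a b : ℝ) :
    planeElt J a b * star (planeElt J a b) = (a ^ 2 + b ^ 2) • (1 : R) := by
  rw [h.star_planeElt, h.planeElt_mul, planeElt]
  module

theorem norm_planeElt [Nontrivial R] (a b : ℝ) : ‖planeElt J a b‖ ^ 2 = a ^ 2 + b ^ 2 := by
  rw [sq, ← CStarRing.norm_star_mul_self, h.star_mul_planeElt, norm_smul, CStarRing.norm_one,
    mul_one, Real.norm_of_nonneg (by positivity)]

theorem symmetry_star (c d : ℝ) : star (planeElt J c d * S) = planeElt J c d * S := by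
  rw [star_mul, h.star_left, h.star_planeElt, h.left_mul_planeElt, neg_neg]

theorem symmetry_mul_self {c d : ℝ} (hcd : c ^ 2 + d ^ 2 = 1) :
    planeElt J c d * S * (planeElt J c d * S) = 1 := by
  rw [mul_assoc, ← mul_assoc S, h.left_mul_planeElt, mul_assoc, h.left_mul_self, mul_one,
    ← h.star_planeElt, h.planeElt_mul_star, hcd, one_smul]

theorem symmetry_mul_star (a b c d : ℝ) : planeElt J c d * S * star (planeElt J a b) =
    planeElt J a b * (planeElt J c d * S) := by
  rw [h.star_planeElt, mul_assoc, h.left_mul_planeElt, neg_neg, ← mul_assoc, ← mul_assoc,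
    h.planeElt_mul, h.planeElt_mul]
  congr 2 <;> ring

theorem right_mul_symmetry (c d : ℝ) :
    J * (planeElt J c d * S) = -(planeElt J c d * S * J) := by
  have h1 : J = planeElt J 0 1 := by simp [planeElt]
  rw [mul_assoc, h.left_mul_right, mul_neg, neg_neg, ← mul_assoc, ← mul_assoc]
  congr 1
  nth_rewrite 1 [h1]
  nth_rewrite 4 [h1]
  rw [h.planeElt_mul, h.planeElt_mul]
  congr 1 <;> ring

theorem right_mul_planeElt (a b : ℝ) : J * planeElt J a b = planeElt J a b * J := by
  simp only [planeElt, mul_add, add_mul, mul_smul_comm, smul_mul_assoc, one_mul, mul_one]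

theorem exists_polar (a b : ℝ) : ∃ ρ a' b' : ℝ, 0 ≤ ρ ∧ a' ^ 2 + b' ^ 2 = 1 ∧
    planeElt J a b = ρ • planeElt J a' b' := by
  by_cases h0 : a ^ 2 + b ^ 2 = 0
  · have ha : a = 0 := by nlinarith [sq_nonneg a, sq_nonneg b]
    have hb : b = 0 := by nlinarith [sq_nonneg a, sq_nonneg b]
    exact ⟨0, 1, 0, le_rfl, by norm_num, by simp [planeElt, ha, hb]⟩
  · have hpos : 0 < a ^ 2 + b ^ 2 := lt_of_le_of_ne (by positivity) (Ne.symm h0)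
    have hs := Real.sqrt_pos.2 hpos
    have hsq := Real.sq_sqrt hpos.le
    refine ⟨√(a ^ 2 + b ^ 2), a / √(a ^ 2 + b ^ 2), b / √(a ^ 2 + b ^ 2), hs.le, ?_, ?_⟩
    · rw [div_pow, div_pow, hsq, ← add_div, div_self h0]
    · rw [planeElt, planeElt, smul_add, smul_smul, smul_smul, mul_div_cancel₀ _ hs.ne',
        mul_div_cancel₀ _ hs.ne']

theorem map_add_symmetry (hτ : IsOrthAdditive τ) (a b : ℝ) {c d : ℝ} (hcd : c ^ 2 + d ^ 2 = 1)
    (σ : ℝ) : τ (planeElt J a b + σ • (planeElt J c d * S)) =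
      τ (planeElt J a b) + σ • τ (planeElt J c d * S) := by
  obtain ⟨ρ, a', b', -, h1, h2⟩ := h.exists_polar a b
  rw [h2, hτ.map_add_symmetry (by rw [h.star_mul_planeElt, h1, one_smul])
    (by rw [h.planeElt_mul_star, h1, one_smul]) (h.symmetry_star c d) (h.symmetry_mul_self hcd)
    (h.symmetry_mul_star _ _ _ _), hτ.map_smul]

theorem norm_add_symmetry [Nontrivial R] (a b : ℝ) {c d : ℝ} (hcd : c ^ 2 + d ^ 2 = 1) {σ : ℝ}
    (hσ : 0 ≤ σ) : ‖planeElt J a b + σ • (planeElt J c d * S)‖ = ‖planeElt J a b‖ + σ := by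
  obtain ⟨ρ, a', b', hρ, h1, h2⟩ := h.exists_polar a b
  have hU : star (planeElt J a' b') * planeElt J a' b' = 1 := by
    rw [h.star_mul_planeElt, h1, one_smul]
  have hU' : planeElt J a' b' * star (planeElt J a' b') = 1 := by
    rw [h.planeElt_mul_star, h1, one_smul]
  rw [h2, _root_.norm_add_symmetry hU hU' (h.symmetry_star c d) (h.symmetry_mul_self hcd)
    (h.symmetry_mul_star _ _ _ _) (h.right_mul_symmetry c d) (h.right_mul_planeElt _ _)
    h.right_mul_self hρ hσ, norm_smul, Real.norm_of_nonneg hρ,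
    CStarRing.norm_of_mem_unitary ⟨hU, hU'⟩, mul_one]

/-- In rank two, the plane spanned by `1` and `J` consists of the contractions at maximal distance
from the four symmetries `±S` and `±JS`. -/
theorem exists_eq_planeElt (hR : HasPeirceGeometry R) (hP : HasProjections R) {p : R}
    (hp : IsMinimalProjection p) (hq : IsMinimalProjection (1 - p)) (hp0 : p ≠ 0)
    (hp1 : 1 - p ≠ 0) (hS : S = (2 : ℝ) • p - 1) {z : R} (hz : ‖z‖ ≤ 1)
    (hzD : ∀ c d : ℝ, c ^ 2 + d ^ 2 = 1 → ‖z + planeElt J c d * S‖ = 2) :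
    ∃ α β : ℝ, z = planeElt J α β := by
  have hsa : ∀ c d : ℝ, c ^ 2 + d ^ 2 = 1 →
      star z * (planeElt J c d * S) = (planeElt J c d * S) * z := by
    intro c d hcd
    refine hP.isSelfAdjoint_mul hR hp hq hp0 hp1 hz (h.symmetry_star c d) (h.symmetry_mul_self hcd)
      (hzD c d hcd) ?_
    have := hzD (-c) (-d) (by rw [neg_sq, neg_sq, hcd])
    rw [← this]
    congr 1
    simp only [planeElt, add_mul, smul_mul_assoc]
    module
  have h1 : star z * S = S * z := by simpa [planeElt] using hsa 1 0 (by norm_num)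
  have h2 : star z * (J * S) = J * S * z := by simpa [planeElt] using hsa 0 1 (by norm_num)
  have hSp : S * p = p := by rw [hS, sub_mul, smul_mul_assoc, hp.1.mul_self, one_mul]; module
  have hpS : p * S = p := by rw [hS, mul_sub, mul_smul_comm, hp.1.mul_self, mul_one]; module
  have hzs : star z = S * z * S := by
    rw [← h1, mul_assoc, h.left_mul_self, mul_one]
  have hSJS : S * J * S = -J := by rw [h.left_mul_right, neg_mul, mul_assoc, h.left_mul_self, mul_one]
  have hcomm : z * J = J * z := by
    have h3 : S * (star z * (J * S)) = S * (J * S * z) := by rw [h2]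
    have h4 : S * (star z * (J * S)) = -(z * J) := by
      calc S * (star z * (J * S)) = (S * S) * z * (S * J * S) := by rw [hzs]; noncomm_ring
        _ = _ := by rw [h.left_mul_self, hSJS, one_mul, mul_neg]
    have h5 : S * (J * S * z) = -(J * z) := by
      calc S * (J * S * z) = S * J * S * z := by noncomm_ring
        _ = _ := by rw [hSJS, neg_mul]
    rw [h4, h5] at h3
    exact neg_injective h3
  obtain ⟨α, hα⟩ := hP.exists_smul_of_minimal hp (b := p * z * p)
    (by
      rw [IsSelfAdjoint, star_mul, star_mul, hp.1.star_eq, hzs]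
      calc p * (S * z * S * p) = (p * S) * z * (S * p) := by noncomm_ring
        _ = _ := by rw [hSp, hpS])
    (by rw [mul_assoc, ← mul_assoc, hp.1.mul_self]) (by rw [mul_assoc, hp.1.mul_self])
  obtain ⟨β, hβ⟩ := hP.exists_smul_of_minimal hp (b := p * (J * z) * p)
    (by
      rw [IsSelfAdjoint, star_mul, star_mul, star_mul, hp.1.star_eq, hzs, h.star_right]
      calc p * (S * z * S * -J * p) = (p * S) * z * -(S * J) * p := by noncomm_ring
        _ = p * z * J * (S * p) := by rw [h.left_mul_right, neg_neg, hpS]; noncomm_ring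
        _ = p * (z * J) * p := by rw [hSp]; noncomm_ring
        _ = _ := by rw [hcomm])
    (by rw [mul_assoc, ← mul_assoc, hp.1.mul_self]) (by rw [mul_assoc, hp.1.mul_self])
  have hJpJ : J * p * J = p - 1 := by
    have : p = (1 / 2 : ℝ) • (1 + S) := by rw [hS]; module
    rw [this]
    have h3 : J * S * J = S := by
      rw [mul_assoc, h.left_mul_right, mul_neg, ← mul_assoc, h.right_mul_self]; simp
    simp only [mul_smul_comm, smul_mul_assoc, mul_add, add_mul, mul_one, h3, h.right_mul_self]
    module
  have hzp : z * p = planeElt J α (-β) * p := by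
    calc z * p = p * z * p - (p - 1) * z * p := by noncomm_ring
      _ = α • p - J * (p * (J * z) * p) := by rw [hα, ← hJpJ]; noncomm_ring
      _ = _ := by
        rw [hβ, planeElt]
        simp only [add_mul, smul_mul_assoc, mul_smul_comm, one_mul]
        module
  refine ⟨α, -β, ?_⟩
  calc z = z * p - z * (p - 1) := by noncomm_ring
    _ = z * p - (z * J) * p * J := by rw [← hJpJ]; noncomm_ring
    _ = z * p - J * (z * p) * J := by rw [hcomm]; noncomm_ring
    _ = planeElt J α (-β) * p - (J * planeElt J α (-β)) * p * J := by rw [hzp]; noncomm_ring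
    _ = planeElt J α (-β) * p - planeElt J α (-β) * (J * p * J) := by
      rw [h.right_mul_planeElt]; noncomm_ring
    _ = _ := by rw [hJpJ]; noncomm_ring

theorem map_add_planeElt [Nontrivial R] (hR : HasPeirceGeometry R) (hP : HasProjections R) {p : R}
    (hp : IsMinimalProjection p) (hq : IsMinimalProjection (1 - p)) (hp0 : p ≠ 0)
    (hp1 : 1 - p ≠ 0) (hS : S = (2 : ℝ) • p - 1) (hτ : IsOrthAdditive τ) {a b a' b' : ℝ}
    (hab : a ^ 2 + b ^ 2 = a' ^ 2 + b' ^ 2) :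
    τ (planeElt J (a + a') (b + b')) = τ (planeElt J a b) + τ (planeElt J a' b') := by
  have hadd : ∀ a b a' b' : ℝ, planeElt J (a + a') (b + b') = planeElt J a b + planeElt J a' b' := by
    intros; simp only [planeElt]; module
  have hneg : ∀ a b : ℝ, planeElt J (-a) (-b) = -planeElt J a b := by
    intros; simp only [planeElt]; module
  have hnorm : ‖planeElt J a b‖ = ‖planeElt J a' b'‖ :=
    (pow_left_inj₀ (norm_nonneg _) (norm_nonneg _) two_ne_zero).1
      (by rw [h.norm_planeElt, h.norm_planeElt, hab])
  set x := planeElt J a b with hx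
  set x' := planeElt J a' b' with hx'
  set s := planeElt J (a + a') (b + b') with hs
  have hsx : s = x + x' := hadd _ _ _ _
  rcases eq_or_ne s 0 with hs0 | hs0
  · have hx0 : x' = -x := eq_neg_of_add_eq_zero_right (by rw [← hsx, hs0])
    rw [hs0, hτ.map_zero, hx0, hτ.map_neg, add_neg_cancel]
  set ρ := ‖s‖ with hρ
  have hρ0 : 0 < ρ := norm_pos_iff.2 hs0
  obtain ⟨z, hz⟩ := hτ.surj (ρ⁻¹ • (τ x + τ x'))
  have hy : ‖τ x + τ x'‖ = ρ := by rw [hτ.norm_add _ _ hnorm, ← hsx]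
  have hz1 : ‖z‖ = 1 := by
    rw [← hτ.norm_map, hz, norm_smul, hy, norm_inv, Real.norm_of_nonneg hρ0.le,
      inv_mul_cancel₀ hρ0.ne']
  obtain ⟨α, β, hzp⟩ := h.exists_eq_planeElt hR hP hp hq hp0 hp1 hS hz1.le (by
    intro c d hcd
    set D := planeElt J c d * S with hD
    have hDn : ‖D‖ = 1 := by
      have := h.norm_add_symmetry 0 0 hcd zero_le_one
      rwa [show planeElt J 0 0 = 0 by simp [planeElt], zero_add, norm_zero, zero_add,
        one_smul] at this
    rw [← hτ.norm_add z D (by rw [hz1, hDn]), hz]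
    have e1 : ρ⁻¹ • (τ x + τ x') + τ D =
        ρ⁻¹ • (τ (x + (ρ / 2) • D) + τ (x' + (ρ / 2) • D)) := by
      rw [h.map_add_symmetry hτ _ _ hcd, h.map_add_symmetry hτ _ _ hcd]
      have : τ D = ρ⁻¹ • ((ρ / 2) • τ D + (ρ / 2) • τ D) := by
        rw [← add_smul, add_halves, smul_smul, inv_mul_cancel₀ hρ0.ne', one_smul]
      nth_rewrite 1 [this]
      module
    rw [e1, norm_smul, hτ.norm_add _ _ (by
      rw [h.norm_add_symmetry _ _ hcd (by positivity), h.norm_add_symmetry _ _ hcd (by positivity),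
        hnorm]), show x + (ρ / 2) • D + (x' + (ρ / 2) • D) = s + ρ • D by rw [hsx]; module,
      h.norm_add_symmetry _ _ hcd hρ0.le, norm_inv, Real.norm_of_nonneg hρ0.le, ← hρ]
    field_simp
    norm_num)
  set ζ := planeElt J (ρ * α) (ρ * β) with hζ
  have hζz : ζ = ρ • z := by rw [hzp, hζ, planeElt, planeElt, smul_add, smul_smul, smul_smul]
  have hτζ : τ ζ = τ x + τ x' := by
    rw [hζz, hτ.map_smul, hz, smul_smul, mul_inv_cancel₀ hρ0.ne', one_smul]
  have hζn : ‖ζ‖ = ‖s‖ := by rw [hζz, norm_smul, hz1, mul_one, norm_norm]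
  have dist : ∀ u v m n : ℝ, τ ζ - τ (planeElt J u v) = τ (planeElt J m n) →
      ‖planeElt J (ρ * α - u) (ρ * β - v)‖ = ‖planeElt J m n‖ := by
    intro u v m n huv
    have h10 : (1 : ℝ) ^ 2 + 0 ^ 2 = 1 := by norm_num
    set D := planeElt J 1 0 * S with hD
    set w := planeElt J (-u) (-v) with hw
    have hw' : τ w = -τ (planeElt J u v) := by rw [hw, hneg, hτ.map_neg]
    have e1 : τ (ζ + ‖w‖ • D) + τ (w + ‖ζ‖ • D) = τ (planeElt J m n + (‖ζ‖ + ‖w‖) • D) := by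
      rw [h.map_add_symmetry hτ _ _ h10, h.map_add_symmetry hτ _ _ h10,
        h.map_add_symmetry hτ _ _ h10, ← huv, hw']
      module
    have e2 := hτ.norm_add (ζ + ‖w‖ • D) (w + ‖ζ‖ • D) (by
      rw [h.norm_add_symmetry _ _ h10 (norm_nonneg _), h.norm_add_symmetry _ _ h10 (norm_nonneg _),
        add_comm])
    have e3 : ζ + ‖w‖ • D + (w + ‖ζ‖ • D) =
        planeElt J (ρ * α - u) (ρ * β - v) + (‖ζ‖ + ‖w‖) • D := by
      rw [sub_eq_add_neg, sub_eq_add_neg, hadd]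
      module
    rw [e1, hτ.norm_map, e3, h.norm_add_symmetry _ _ h10 (by positivity),
      h.norm_add_symmetry _ _ h10 (by positivity)] at e2
    linarith
  have d1 := dist a b a' b' (by rw [hτζ]; abel)
  have d2 := dist a' b' a b (by rw [hτζ]; abel)
  have k1 := congrArg (· ^ 2) d1
  have k2 := congrArg (· ^ 2) d2
  have k3 := congrArg (· ^ 2) hζn
  simp only [hζ, hs, h.norm_planeElt] at k1 k2 k3
  have k4 : (ρ * α - (a + a')) ^ 2 + (ρ * β - (b + b')) ^ 2 = 0 := by
    linear_combination k1 + k2 - k3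
  have k5 : ρ * α = a + a' := by nlinarith [sq_nonneg (ρ * α - (a + a')), sq_nonneg (ρ * β - (b + b'))]
  have k6 : ρ * β = b + b' := by nlinarith [sq_nonneg (ρ * α - (a + a')), sq_nonneg (ρ * β - (b + b'))]
  rw [hs, ← k5, ← k6]
  exact hτζ

theorem map_planeElt [Nontrivial R] (hR : HasPeirceGeometry R) (hP : HasProjections R) {p : R}
    (hp : IsMinimalProjection p) (hq : IsMinimalProjection (1 - p)) (hp0 : p ≠ 0)
    (hp1 : 1 - p ≠ 0) (hS : S = (2 : ℝ) • p - 1) (hτ : IsOrthAdditive τ) (c d : ℝ) :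
    τ (planeElt J c d) = c • τ 1 + d • τ J := by
  have h1 := h.map_add_planeElt hR hP hp hq hp0 hp1 hS hτ (a := c) (b := d) (a' := c) (b' := -d)
    (by ring)
  have h2 := h.map_add_planeElt hR hP hp hq hp0 hp1 hS hτ (a := c) (b := d) (a' := -c) (b' := d)
    (by ring)
  have h3 : planeElt J (c + c) (d + -d) = (2 * c) • (1 : R) := by simp only [planeElt]; module
  have h4 : planeElt J (c + -c) (d + d) = (2 * d) • J := by simp only [planeElt]; module
  have h5 : planeElt J (-c) d = -planeElt J c (-d) := by simp only [planeElt]; module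
  rw [h3, hτ.map_smul] at h1
  rw [h4, hτ.map_smul, h5, hτ.map_neg] at h2
  have h6 : (2 : ℝ) • τ (planeElt J c d) = (2 : ℝ) • (c • τ 1 + d • τ J) := by
    calc (2 : ℝ) • τ (planeElt J c d) = (τ (planeElt J c d) + τ (planeElt J c (-d))) +
          (τ (planeElt J c d) + -τ (planeElt J c (-d))) := by rw [two_smul]; abel
      _ = _ := by rw [← h1, ← h2]; module
  exact smul_right_injective _ (two_ne_zero' ℝ) h6

end IsRotationPair

/-- In rank two, `τ` is linear on the span of a minimal projection `p` and of a partial isometry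
from `p` to its complement. -/
theorem IsOrthAdditive.map_smul_add_smul (hR : HasPeirceGeometry R) (hP : HasProjections R)
    (hτ : IsOrthAdditive τ) {p E : R} (hp : IsMinimalProjection p)
    (hq : IsMinimalProjection (1 - p)) (hp0 : p ≠ 0) (hp1 : 1 - p ≠ 0) (hE : star E * E = p)
    (hE' : E * star E = 1 - p) {c d : ℝ} (hcd : c ^ 2 + d ^ 2 = 1) :
    τ (c • p + d • E) = c • τ p + d • τ E := by
  have : Nontrivial R := ⟨p, 0, hp0⟩
  have hpp := hp.1.mul_self
  have hEP : PIso E := .of_isStarProjection (by rw [hE, hpp])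
  have m1 : E * p = E := by rw [← hE, hEP.mul_star_mul]
  have m2 : p * E = 0 := by
    have : (1 - p) * E = E := by rw [← hE', hEP]
    rw [sub_mul, one_mul, sub_eq_self] at this
    exact this
  have m3 : p * star E = star E := by simpa [hp.1.star_eq] using congrArg star m1
  have m4 : star E * p = 0 := by simpa [hp.1.star_eq] using congrArg star m2
  have m5 : E * E = 0 := by
    calc E * E = E * p * E := by rw [m1]
      _ = 0 := by rw [mul_assoc, m2, mul_zero]
  have m6 : star E * star E = 0 := by simpa using congrArg star m5
  set S := (2 : ℝ) • p - 1 with hS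
  set J := E - star E with hJ
  have hSJ : IsRotationPair S J := by
    refine ⟨?_, ?_, ?_, ?_, ?_⟩
    · rw [hS, star_sub, star_smul, star_trivial, star_one, hp.1.star_eq]
    · rw [hS]
      simp only [sub_mul, mul_sub, smul_mul_assoc, mul_smul_comm, one_mul, mul_one, hpp]
      module
    · rw [hJ, star_sub, star_star]; abel
    · rw [hJ]
      simp only [sub_mul, mul_sub, m5, m6, hE, hE']
      abel
    · rw [hS, hJ]
      simp only [sub_mul, mul_sub, smul_mul_assoc, mul_smul_comm, one_mul, mul_one, m1, m2, m3, m4]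
      module
  have hJp : J * p = E := by rw [hJ, sub_mul, m1, m4, sub_zero]
  have hpS : p = (1 / 2 : ℝ) • (1 + S) := by rw [hS]; module
  have hES : E = (1 / 2 : ℝ) • (J + J * S) := by
    rw [hS, mul_sub, mul_smul_comm, hJp, mul_one]; module
  have l1 := hSJ.map_planeElt hR hP hp hq hp0 hp1 hS hτ
  have l2 := hSJ.map_planeElt hR hP hp hq hp0 hp1 hS (hτ.comp_mul_right (w := S)
    (by rw [hSJ.star_left, hSJ.left_mul_self]) (by rw [hSJ.star_left, hSJ.left_mul_self]))
  have half : ∀ c d : ℝ, c ^ 2 + d ^ 2 = 1 → τ (c • p + d • E) =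
      (1 / 2 : ℝ) • ((c • τ 1 + d • τ J) + (c • τ S + d • τ (J * S))) := by
    intro c d hcd
    have e1 : c • p + d • E = (1 / 2 : ℝ) • (planeElt J c d + (1 : ℝ) • (planeElt J c d * S)) := by
      nth_rewrite 1 [hpS, hES]
      simp only [planeElt, add_mul, smul_mul_assoc, one_mul]
      module
    have e2 := l2 c d
    simp only [one_mul] at e2
    rw [e1, hτ.map_smul, hSJ.map_add_symmetry hτ _ _ hcd, l1, e2, one_smul]
  have f1 := half 1 0 (by norm_num)
  have f2 := half 0 1 (by norm_num)
  simp only [one_smul, zero_smul, add_zero, zero_add] at f1 f2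
  rw [half c d hcd, f1, f2]
  module

end Plane

/-! ### Additivity -/

section Additivity

variable {R : Type*} [NormedRing R] [NormedAlgebra ℝ R] [StarRing R] [CStarRing R] [StarModule ℝ R]
  {Y : Type*} [NormedAddCommGroup Y] [NormedSpace ℝ Y] {τ : R → Y}

theorem IsOrthAdditive.map_add_of_central (hτ : IsOrthAdditive τ) {z : R} (hz : IsStarProjection z)
    (h0 : z ≠ 0) (h1 : z ≠ 1) (hc : ∀ a, z * a = a * z) (x y : R) : τ (x + y) = τ x + τ y := by
  have h1' : 1 - z ≠ 0 := fun h => h1 (sub_eq_zero.1 h).symm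
  have hzz := hz.mul_one_sub_self
  have hzz' := hz.one_sub_mul_self
  have c1 : ∀ a, Orth (1 - z) (z * a) := fun a => by
    constructor
    · rw [hz.one_sub.star_eq, ← mul_assoc, hzz', zero_mul]
    · rw [hc a, star_mul, hz.star_eq, ← mul_assoc, hzz', zero_mul]
  have c2 : ∀ a, Orth z ((1 - z) * a) := fun a => by
    constructor
    · rw [hz.star_eq, ← mul_assoc, hzz, zero_mul]
    · rw [show (1 - z) * a = a * (1 - z) by rw [sub_mul, mul_sub, hc]; simp, star_mul,
        hz.one_sub.star_eq, ← mul_assoc, hzz, zero_mul]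
  have split : ∀ a, τ a = τ (z * a) + τ ((1 - z) * a) := fun a => by
    rw [← hτ.map_add_of_orth, ← add_mul, add_sub_cancel, one_mul]
    refine (c2 a).under ⟨fun y hy => by rw [← mul_assoc, hy, zero_mul], fun y hy => ?_⟩
    rw [hc, mul_assoc, hy, mul_zero]
  rw [split x, split y, split (x + y), mul_add, mul_add,
    hτ.map_add_of_common_orth _ _ _ h1' (c1 x) (c1 y),
    hτ.map_add_of_common_orth _ _ _ h0 (c2 x) (c2 y)]
  abel

theorem IsOrthAdditive.map_add_of_trivial (hP : HasProjections R) (hτ : IsOrthAdditive τ)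
    (htriv : ∀ p : R, IsStarProjection p → p = 0 ∨ p = 1) (x y : R) : τ (x + y) = τ x + τ y := by
  have key : ∀ x : R, star x * x = ‖x‖ ^ 2 • (1 : R) := by
    intro x
    rcases eq_or_ne x 0 with rfl | hx
    · simp
    have : Nontrivial R := ⟨x, 0, hx⟩
    rcases hP.eq_smul_or (star x * x) 1 (.star_mul_self x) (.one _) (one_mul _) (mul_one _) with
      ⟨c, hc⟩ | ⟨g, hg, -, -, h0, h1, -⟩
    · have hc0 := hP.nonneg x 1 c (.one _) one_ne_zero hc
      have := CStarRing.norm_star_mul_self (x := x)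
      rw [hc, norm_smul, CStarRing.norm_one, mul_one, Real.norm_of_nonneg hc0] at this
      rw [hc, this, sq]
    · rcases htriv g hg with h | h
      · exact absurd h h0
      · exact absurd h h1
  refine map_add_of_unit_parallelogram ?_ hτ.surj hτ.map_smul hτ.norm_map
    (fun x y hx hy => hτ.norm_sub x y (hx.trans hy.symm)) x y
  intro u v hu hv
  have : Nontrivial R := ⟨u, 0, norm_ne_zero_iff.1 (by rw [hu]; exact one_ne_zero)⟩
  have h1 : (‖u + v‖ ^ 2 + ‖u - v‖ ^ 2) • (1 : R) = (4 : ℝ) • (1 : R) := by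
    rw [add_smul, ← key, ← key]
    calc star (u + v) * (u + v) + star (u - v) * (u - v) =
        (2 : ℝ) • (star u * u) + (2 : ℝ) • (star v * v) := by
          simp only [star_add, star_sub, add_mul, mul_add, sub_mul, mul_sub]
          module
      _ = _ := by rw [key u, key v, hu, hv]; module
  exact smul_left_injective ℝ one_ne_zero h1

/-- Column additivity when a projection below the initial projection splits everything. -/
theorem IsOrthAdditive.map_column_of_commute (hτ : IsOrthAdditive τ) {p v g : R}
    (hp : IsStarProjection p) (hg : IsStarProjection g) (hgr : star v * v * g = g)
    (hg0 : g ≠ 0) (hg1 : g ≠ star v * v) (hv : PIso v)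
    (hgh : g * (star v * p * v) = star v * p * v * g) :
    τ v = τ (p * v) + τ ((1 - p) * v) := by
  set r := star v * v with hr
  have hrp : IsStarProjection r := hv.isStarProjection
  have hvr : v * r = v := hv.mul_star_mul
  have hrg : g * r = g := by simpa [hrp.star_eq, hg.star_eq] using congrArg star hgr
  set g' := r - g with hg'
  have hg'p : IsStarProjection g' := hg.sub_of_mul_eq_left hrp hrg
  have hgg' : g * g' = 0 := by rw [hg', mul_sub, hrg, hg.mul_self, sub_self]
  have hg'g : g' * g = 0 := by rw [hg', sub_mul, hgr, hg.mul_self, sub_self]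
  have hrg' : r * g' = g' := by rw [hg', mul_sub, hrp.mul_self, hgr]
  have hg'0 : g' ≠ 0 := fun h => hg1 (sub_eq_zero.1 h).symm
  have hvg : v * g + v * g' = v := by rw [← mul_add, hg', add_sub_cancel, hvr]
  have hgh' : g * (star v * (1 - p) * v) = star v * (1 - p) * v * g := by
    have : star v * (1 - p) * v = r - star v * p * v := by rw [hr]; noncomm_ring
    rw [this, mul_sub, sub_mul, hgh, hrg, hgr]
  have hpq : p * (1 - p) = 0 := hp.mul_one_sub_self
  have o1 : Orth (v * g) (v * g') := by
    constructor
    · calc star (v * g) * (v * g') = g * (star v * v * g') := by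
            rw [star_mul, hg.star_eq]; noncomm_ring
        _ = 0 := by rw [← hr, hrg', hgg']
    · calc v * g * star (v * g') = v * (g * g') * star v := by
            rw [star_mul, hg'p.star_eq]; noncomm_ring
        _ = 0 := by rw [hgg']; simp
  have o2 : ∀ s : R, IsStarProjection s → g * (star v * s * v) = star v * s * v * g →
      Orth (s * v * g) (s * v * g') := by
    intro s hs hgs
    constructor
    · calc star (s * v * g) * (s * v * g') = g * (star v * (s * s) * v) * g' := by
            rw [star_mul, star_mul, hg.star_eq, hs.star_eq]; noncomm_ring
        _ = star v * s * v * (g * g') := by rw [hs.mul_self, hgs]; noncomm_ring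
        _ = 0 := by rw [hgg', mul_zero]
    · calc s * v * g * star (s * v * g') = s * v * (g * g') * star (s * v) := by
            rw [star_mul, hg'p.star_eq]; noncomm_ring
        _ = 0 := by rw [hgg']; simp
  have o3 : ∀ s k l : R, IsStarProjection s → IsStarProjection k → IsStarProjection l →
      k * l = 0 → Orth (s * v * k) ((1 - s) * v * l) := by
    intro s k l hs hk hl hkl
    constructor
    · calc star (s * v * k) * ((1 - s) * v * l) = k * star v * (s * (1 - s)) * v * l := by
            rw [star_mul, star_mul, hk.star_eq, hs.star_eq]; noncomm_ring
        _ = 0 := by rw [hs.mul_one_sub_self]; simp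
    · calc s * v * k * star ((1 - s) * v * l) = s * v * (k * l) * star ((1 - s) * v) := by
            rw [star_mul _ l, hl.star_eq]; noncomm_ring
        _ = 0 := by rw [hkl]; simp
  have hqq : 1 - (1 - p) = p := by abel
  have part : ∀ k l : R, IsStarProjection k → IsStarProjection l → l ≠ 0 → r * l = l → k * l = 0 →
      l * k = 0 → Orth (p * v * l) (p * v * k) → Orth ((1 - p) * v * l) ((1 - p) * v * k) →
      τ (v * k) = τ (p * v * k) + τ ((1 - p) * v * k) := by
    intro k l hk hl hl0 hrl hkl hlk h1 h2
    have hvk : v * k = p * v * k + (1 - p) * v * k := by noncomm_ring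
    rw [hvk]
    by_cases hz : p * v * l = 0
    · refine hτ.map_add_of_common_orth ((1 - p) * v * l) _ _ ?_ ?_ h2
      · intro hz'
        apply hl0
        calc l = r * l := hrl.symm
          _ = star v * (p * v * l + (1 - p) * v * l) := by rw [hr]; noncomm_ring
          _ = 0 := by rw [hz, hz']; simp
      · have := o3 (1 - p) l k hp.one_sub hl hk hlk
        rwa [hqq] at this
    · exact hτ.map_add_of_common_orth (p * v * l) _ _ hz h1 (o3 p l k hp hl hk hlk)
  have q1 := part g g' hg hg'p hg'0 hrg' hgg' hg'g (o2 p hp hgh).symm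
    (o2 _ hp.one_sub hgh').symm
  have q2 := part g' g hg'p hg hg0 hgr hg'g hgg' (o2 p hp hgh) (o2 _ hp.one_sub hgh')
  have q3 : ∀ s : R, s * v = s * v * g + s * v * g' := fun s => by
    rw [mul_assoc, mul_assoc, ← mul_add, hvg]
  have r1 : τ (p * v) = τ (p * v * g) + τ (p * v * g') := by
    rw [← hτ.map_add_of_orth _ _ (o2 p hp hgh), ← q3 p]
  have r2 : τ ((1 - p) * v) = τ ((1 - p) * v * g) + τ ((1 - p) * v * g') := by
    rw [← hτ.map_add_of_orth _ _ (o2 _ hp.one_sub hgh'), ← q3 (1 - p)]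
  have r0 : τ v = τ (v * g) + τ (v * g') := by rw [← hτ.map_add_of_orth _ _ o1, hvg]
  rw [r0, r1, r2, q1, q2]
  abel

/-- Column additivity when the two halves of the column are multiples of partial isometries with
complementary minimal ranges. -/
theorem IsOrthAdditive.map_column_of_minimal (hR : HasPeirceGeometry R) (hP : HasProjections R)
    (hτ : IsOrthAdditive τ) {p e f a : R} (hp : IsMinimalProjection p)
    (hq : IsMinimalProjection (1 - p)) (hp0 : p ≠ 0) (hp1 : 1 - p ≠ 0)
    (hee : e * star e = p) (hff : f * star f = 1 - p) (hef : star e * e = star f * f)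
    (ha : p * a * (1 - star e * e) ≠ 0) {c d : ℝ} (hcd : c ^ 2 + d ^ 2 = 1) :
    τ (c • e + d • f) = c • τ e + d • τ f := by
  set r := star e * e with hr
  have heP : PIso e := by
    have : PIso (star e) := .of_isStarProjection (by rw [star_star, hee, hp.1.mul_self])
    simpa using this.star_pIso
  have hfP : PIso f := by
    have : PIso (star f) := .of_isStarProjection (by rw [star_star, hff, hq.1.mul_self])
    simpa using this.star_pIso
  have hrp : IsStarProjection r := heP.isStarProjection
  have her : e * r = e := heP.mul_star_mul
  have hfr : f * r = f := by rw [hef]; exact hfP.mul_star_mul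
  have hpe : p * e = e := by rw [← hee, heP]
  have hqf : (1 - p) * f = f := by rw [← hff, hfP]
  have hpq := hp.1.mul_one_sub_self
  have hqp := hp.1.one_sub_mul_self
  have hpf : p * f = 0 := by rw [← hqf, ← mul_assoc, hpq, zero_mul]
  have hqe : (1 - p) * e = 0 := by rw [← hpe, ← mul_assoc, hqp, zero_mul]
  have hef0 : star e * f = 0 := by
    rw [← hpe, star_mul, hp.1.star_eq, mul_assoc, hpf, mul_zero]
  have he0 : e ≠ 0 := fun h => hp0 (by rw [← hee, h]; simp)
  obtain ⟨e', he'0, he', hu⟩ := hR.exists_pIso_under ha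
  have hpe' : p * e' = e' := by
    have := hu.1 (1 - p) (by rw [← mul_assoc, ← mul_assoc, hqp]; simp)
    rw [sub_mul, one_mul, sub_eq_zero] at this
    exact this.symm
  have he'r : e' * r = 0 := hu.2 r (by rw [mul_assoc, hrp.one_sub_mul_self, mul_zero])
  have he'p : e' * star e' = p := by
    have h1 : IsStarProjection (e' * star e') := by simpa using he'.star_pIso.isStarProjection
    have h2 : p * (e' * star e') = e' * star e' := by rw [← mul_assoc, hpe']
    rcases hp.2 _ h1 (by simpa [hp.1.star_eq] using congrArg star h2) h2 with h | h
    · exact absurd ((CStarRing.mul_star_self_eq_zero_iff _).1 h) he'0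
    · exact h
  set f' := f * star e * e' with hf'
  have hre' : r * star e' = 0 := by simpa [hrp.star_eq] using congrArg star he'r
  have hee' : e * star e' = 0 := by rw [← her, mul_assoc, hre', mul_zero]
  have k1 : f' * star f' = 1 - p := by
    calc f' * star f' = f * star e * (e' * star e') * e * star f := by
          rw [hf', star_mul, star_mul, star_star]; noncomm_ring
      _ = f * star e * (p * e) * star f := by rw [he'p]; noncomm_ring
      _ = f * r * star f := by rw [hpe, hr]; noncomm_ring
      _ = _ := by rw [hfr, hff]
  have k2 : e * star f' = 0 := by
    rw [hf', star_mul, ← mul_assoc, hee', zero_mul]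
  have k3 : f' * star e = 0 := by simpa using congrArg star k2
  have k4 : star f' * f' = star e' * e' := by
    calc star f' * f' = star e' * e * (star f * f) * star e * e' := by
          rw [hf', star_mul, star_mul, star_star]; noncomm_ring
      _ = star e' * (e * r) * star e * e' := by rw [← hef]; noncomm_ring
      _ = star e' * (e * star e * e') := by rw [her]; noncomm_ring
      _ = _ := by rw [hee, hpe']
  have k5 : p * f' = 0 := by rw [hf', ← mul_assoc, ← mul_assoc, hpf]; simp
  have k6 : star e * f' = 0 := by
    rw [← hpe, star_mul, hp.1.star_eq, mul_assoc, k5, mul_zero]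
  have k7 : star f' * e = 0 := by simpa using congrArg star k6
  set w := e + f' with hw
  have w1 : w * star w = 1 := by
    rw [hw, star_add, add_mul, mul_add, mul_add, hee, k1, k2, k3]; abel
  have w2' : star w * w = r + star e' * e' := by
    rw [hw, star_add, add_mul, mul_add, mul_add, k4, k6, k7, hr]; abel
  have hr' : IsStarProjection (star e' * e') := he'.isStarProjection
  have hrr' : r * (star e' * e') = 0 := by rw [← mul_assoc, hre', zero_mul]
  have hr'r : star e' * e' * r = 0 := by rw [mul_assoc, he'r, mul_zero]
  have hthree : IsStarProjection (1 - r - star e' * e') :=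
    hr'.sub_of_mul_eq_left hrp.one_sub (by rw [mul_sub, hr'r, mul_one, sub_zero])
  have h3 := hP.eq_zero_of_three hp hq hp0 hp1 hrp hr' hthree (by abel) (star_mul_self_ne_zero' he0)
    (star_mul_self_ne_zero' he'0)
  have w2 : star w * w = 1 := by
    rw [w2']
    rw [sub_sub, sub_eq_zero] at h3
    exact h3.symm
  have hE1 : star (f * star e) * (f * star e) = p := by
    calc star (f * star e) * (f * star e) = e * (star f * f) * star e := by
          rw [star_mul, star_star]; noncomm_ring
      _ = p := by rw [← hef, her, hee]
  have hE2 : (f * star e) * star (f * star e) = 1 - p := by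
    calc (f * star e) * star (f * star e) = f * r * star f := by
          rw [star_mul, star_star, hr]; noncomm_ring
      _ = _ := by rw [hfr, hff]
  have hpw : p * w = e := by rw [hw, mul_add, hpe, k5, add_zero]
  have hEw : f * star e * w = f := by
    rw [hw, mul_add]
    calc f * star e * e + f * star e * f' = f * r + f * (star e * f') := by rw [hr]; noncomm_ring
      _ = f := by rw [hfr, k6]; simp
  have := (hτ.comp_mul_right w2 w1).map_smul_add_smul hR hP hp hq hp0 hp1 hE1 hE2 hcd
  simpa only [add_mul, smul_mul_assoc, hpw, hEw] using this

end Additivity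

/-! ### Additivity of columns and of the whole map -/

section Gluing

variable {R : Type*} [NormedRing R] [NormedAlgebra ℝ R] [StarRing R] [CStarRing R] [StarModule ℝ R]
  {Y : Type*} [NormedAddCommGroup Y] [NormedSpace ℝ Y] {τ : R → Y}

theorem IsOrthAdditive.map_column (hR : HasPeirceGeometry R) (hP : HasProjections R)
    (hprime : ∀ x y : R, x ≠ 0 → y ≠ 0 → ∃ a, x * a * y ≠ 0) (hτ : IsOrthAdditive τ) {p v : R}
    (hp : IsStarProjection p) (hp0 : p ≠ 0) (hp1 : 1 - p ≠ 0) (hv : PIso v) :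
    τ v = τ (p * v) + τ ((1 - p) * v) := by
  have hsplit : v = p * v + (1 - p) * v := by noncomm_ring
  have hτ0 : τ 0 = 0 := hτ.toIsHomogeneousIsometry.map_zero
  by_cases hA : ∃ g : R, IsStarProjection g ∧ star v * v * g = g ∧ g ≠ 0 ∧ g ≠ star v * v ∧
      g * (star v * p * v) = star v * p * v * g
  · obtain ⟨g, hg, h1, h2, h3, h4⟩ := hA
    exact hτ.map_column_of_commute hp hg h1 h2 h3 hv h4
  have hqs := hp.one_sub
  have hpq := hp.mul_one_sub_self
  have hqp := hp.one_sub_mul_self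
  set r := star v * v with hr
  have hrp : IsStarProjection r := hv.isStarProjection
  have hvr : v * r = v := hv.mul_star_mul
  have hrv : r * star v = star v := by simpa [hrp.star_eq] using congrArg star hvr
  have hhs : IsSelfAdjoint (star v * p * v) := by
    rw [IsSelfAdjoint, star_mul, star_mul, star_star, hp.star_eq, mul_assoc]
  obtain ⟨l, hl⟩ : ∃ l : ℝ, star v * p * v = l • r := by
    rcases hP.eq_smul_or (star v * p * v) r hhs hrp (by rw [← mul_assoc, ← mul_assoc, hrv])
      (by rw [mul_assoc, hvr]) with h | ⟨g, hg, -, h2, h3, h4, h5⟩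
    · exact h
    · exact absurd ⟨g, hg, h2, h3, h4, h5⟩ hA
  have hmin : IsMinimalProjection r := by
    refine ⟨hrp, fun g hg h1 h2 => ?_⟩
    by_contra hcon
    push Not at hcon
    exact hA ⟨g, hg, h2, hcon.1, hcon.2, by rw [hl, mul_smul_comm, smul_mul_assoc, h1, h2]⟩
  by_cases hv0 : v = 0
  · simp [hv0, hτ0]
  have hr0 : r ≠ 0 := star_mul_self_ne_zero' hv0
  have hpv : star (p * v) * (p * v) = l • r := by
    calc star (p * v) * (p * v) = star v * (p * p) * v := by
          rw [star_mul, hp.star_eq]; noncomm_ring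
      _ = _ := by rw [hp.mul_self, hl]
  have hqv : star ((1 - p) * v) * ((1 - p) * v) = (1 - l) • r := by
    calc star ((1 - p) * v) * ((1 - p) * v) = star v * ((1 - p) * (1 - p)) * v := by
          rw [star_mul, hqs.star_eq]; noncomm_ring
      _ = r - star v * p * v := by rw [hqs.mul_self, hr]; noncomm_ring
      _ = _ := by rw [hl, sub_smul, one_smul]
  have hl0 := hP.nonneg _ _ _ hrp hr0 hpv
  have hl1 := hP.nonneg _ _ _ hrp hr0 hqv
  rcases hl0.eq_or_lt with h | hl0
  · rw [← h, zero_smul] at hpv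
    have : p * v = 0 := (CStarRing.star_mul_self_eq_zero_iff _).1 hpv
    rw [sub_mul, one_mul, this, hτ0, zero_add, sub_zero]
  rcases hl1.eq_or_lt with h | hl1
  · rw [← h, zero_smul] at hqv
    have h1 : (1 - p) * v = 0 := (CStarRing.star_mul_self_eq_zero_iff _).1 hqv
    have : p * v = v := by rw [sub_mul, one_mul, sub_eq_zero] at h1; exact h1.symm
    rw [h1, this, hτ0, add_zero]
  set c := √l with hc
  set d := √(1 - l) with hd
  have hc0 : c ≠ 0 := (Real.sqrt_pos.2 hl0).ne'
  have hd0 : d ≠ 0 := (Real.sqrt_pos.2 hl1).ne'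
  have hcc : c * c = l := Real.mul_self_sqrt hl0.le
  have hdd : d * d = 1 - l := Real.mul_self_sqrt hl1.le
  set e := c⁻¹ • (p * v) with he
  set f := d⁻¹ • ((1 - p) * v) with hf
  have hce : c • e = p * v := smul_inv_smul₀ hc0 _
  have hdf : d • f = (1 - p) * v := smul_inv_smul₀ hd0 _
  have hee : star e * e = r := by
    rw [he, star_smul, smul_mul_smul_comm, hpv, smul_smul, ← hcc, star_trivial]
    field_simp
    simp
  have hff : star f * f = r := by
    rw [hf, star_smul, smul_mul_smul_comm, hqv, smul_smul, ← hdd, star_trivial]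
    field_simp
    simp
  have heP : PIso e := .of_isStarProjection (by rw [hee, hrp.mul_self])
  have hfP : PIso f := .of_isStarProjection (by rw [hff, hrp.mul_self])
  have hpe : p * e = e := by rw [he, mul_smul_comm, ← mul_assoc, hp.mul_self]
  have hqf : (1 - p) * f = f := by rw [hf, mul_smul_comm, ← mul_assoc, hqs.mul_self]
  have hpf : p * f = 0 := by rw [← hqf, ← mul_assoc, hpq, zero_mul]
  have hqe : (1 - p) * e = 0 := by rw [← hpe, ← mul_assoc, hqp, zero_mul]
  have hsep : star e * p = star e := by simpa [hp.star_eq] using congrArg star hpe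
  have hsfp : star f * p = 0 := by simpa [hp.star_eq] using congrArg star hpf
  have hef0 : star e * f = 0 := by rw [← hsep, mul_assoc, hpf, mul_zero]
  have hfe0 : star f * e = 0 := by rw [← hpe, ← mul_assoc, hsfp, zero_mul]
  have her : e * r = e := by rw [← hee]; exact heP.mul_star_mul
  have hfr : f * r = f := by rw [← hff]; exact hfP.mul_star_mul
  have hre : r * star e = star e := by simpa [hrp.star_eq] using congrArg star her
  have hrf : r * star f = star f := by simpa [hrp.star_eq] using congrArg star hfr
  set k := 1 - e * star e - f * star f with hk
  have hks : star k = k := by simp [hk]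
  have hke : k * e = 0 := by
    rw [hk, sub_mul, sub_mul, heP, mul_assoc f, hfe0]; simp
  have hkf : k * f = 0 := by
    rw [hk, sub_mul, sub_mul, hfP, mul_assoc e, hef0]; simp
  have goal_of : τ (c • e + d • f) = c • τ e + d • τ f →
      τ v = τ (p * v) + τ ((1 - p) * v) := fun h => by
    rw [← hce, ← hdf, hτ.map_smul c e, hτ.map_smul d f, ← h, hce, hdf, ← hsplit]
  by_cases hw : ∃ a, k * a * (1 - r) ≠ 0
  · obtain ⟨a, ha⟩ := hw
    have orth : ∀ x : R, k * x = 0 → r * star x = star x → Orth (k * a * (1 - r)) x := by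
      intro x h1 h2
      constructor
      · rw [star_mul, star_mul, hks, mul_assoc, mul_assoc, h1]; simp
      · rw [mul_assoc, sub_mul 1 r, one_mul, h2, sub_self, mul_zero]
    apply goal_of
    rw [hτ.map_add_of_common_orth _ _ _ ha ((orth e hke hre).smul_right c)
      ((orth f hkf hrf).smul_right d), hτ.map_smul c e, hτ.map_smul d f]
  push Not at hw
  have hr1 : 1 - r ≠ 0 := by
    intro h
    have h : r = 1 := (sub_eq_zero.1 h).symm
    refine hA ⟨p, hp, by rw [h, one_mul], hp0, fun hpr => hp1 ?_, ?_⟩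
    · rw [hpr, h, sub_self]
    · rw [hl, h, mul_smul_comm, smul_mul_assoc, mul_one, one_mul]
  have hk0 : k = 0 := by
    by_contra hne
    obtain ⟨a, ha⟩ := hprime k (1 - r) hne hr1
    exact ha (hw a)
  have hees : e * star e = p := by
    have : p * k = p - e * star e := by
      rw [hk, mul_sub, mul_sub, mul_one, ← mul_assoc, ← mul_assoc, hpe, hpf]; simp
    rw [hk0, mul_zero] at this
    exact (sub_eq_zero.1 this.symm).symm
  have hffs : f * star f = 1 - p := by
    rw [hk, hees] at hk0
    exact (sub_eq_zero.1 hk0).symm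
  have hmp : IsMinimalProjection p := by
    rw [← hees]; exact IsMinimalProjection.mul_star heP (by rwa [hee])
  have hmq : IsMinimalProjection (1 - p) := by
    rw [← hffs]; exact IsMinimalProjection.mul_star hfP (by rwa [hff])
  obtain ⟨a, ha⟩ := hprime p (1 - r) hp0 hr1
  apply goal_of
  refine hτ.map_column_of_minimal hR hP hmp hmq hp0 hp1 hees hffs (hee.trans hff.symm)
    (a := a) (by rwa [hee]) ?_
  rw [sq, sq, hcc, hdd]; ring

theorem IsOrthAdditive.map_row (hR : HasPeirceGeometry R) (hP : HasProjections R)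
    (hprime : ∀ x y : R, x ≠ 0 → y ≠ 0 → ∃ a, x * a * y ≠ 0) (hτ : IsOrthAdditive τ) {p v : R}
    (hp : IsStarProjection p) (hp0 : p ≠ 0) (hp1 : 1 - p ≠ 0) (hv : PIso v) :
    τ v = τ (v * p) + τ (v * (1 - p)) := by
  have := hτ.comp_star.map_column hR hP hprime hp hp0 hp1 hv.star_pIso
  simpa [hp.star_eq] using this

theorem IsOrthAdditive.map_add_of_prime (hR : HasPeirceGeometry R) (hP : HasProjections R)
    (hprime : ∀ x y : R, x ≠ 0 → y ≠ 0 → ∃ a, x * a * y ≠ 0) (hτ : IsOrthAdditive τ) {p : R}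
    (hp : IsStarProjection p) (hp0 : p ≠ 0) (hp1 : 1 - p ≠ 0) (x y : R) :
    τ (x + y) = τ x + τ y := by
  have hq := hp.one_sub
  have hpq := hp.mul_one_sub_self
  have hqp := hp.one_sub_mul_self
  have hτ0 : τ 0 = 0 := hτ.toIsHomogeneousIsometry.map_zero
  have hcont : Continuous τ := hτ.toIsHomogeneousIsometry.continuous
  have orth : ∀ s s' t t' a x : R, IsStarProjection s → IsStarProjection s' → IsStarProjection t →
      IsStarProjection t' → s * s' = 0 → t * t' = 0 → Orth (s * a * t) (s' * x * t') := by
    intro s s' t t' a x hs hs' ht ht' h1 h2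
    constructor
    · calc star (s * a * t) * (s' * x * t') = star (a * t) * (s * s') * (x * t') := by
            rw [mul_assoc s, star_mul s, hs.star_eq]; noncomm_ring
        _ = 0 := by rw [h1]; simp
    · calc s * a * t * star (s' * x * t') = s * a * (t * t') * star (s' * x) := by
            rw [star_mul _ t', ht'.star_eq]; noncomm_ring
        _ = 0 := by rw [h2]; simp
  have corner : ∀ s s' t t' : R, IsStarProjection s → IsStarProjection s' → IsStarProjection t →
      IsStarProjection t' → s * s' = 0 → t * t' = 0 → s ≠ 0 → t ≠ 0 → ∀ x y : R,
      τ (s' * (x + y) * t') = τ (s' * x * t') + τ (s' * y * t') := by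
    intro s s' t t' hs hs' ht ht' h1 h2 h3 h4 x y
    obtain ⟨a, ha⟩ := hprime s t h3 h4
    rw [mul_add, add_mul, hτ.map_add_of_common_orth _ _ _ ha (orth s s' t t' a x hs hs' ht ht' h1 h2)
      (orth s s' t t' a y hs hs' ht ht' h1 h2)]
  set Φ : R → Y := fun x => τ (p * x * p) + τ (p * x * (1 - p)) + τ ((1 - p) * x * p) +
    τ ((1 - p) * x * (1 - p)) with hΦ
  have hΦadd : ∀ x y, Φ (x + y) = Φ x + Φ y := by
    intro x y
    simp only [hΦ]
    rw [corner _ p _ p hq hp hq hp hqp hqp hp1 hp1, corner _ p p (1 - p) hq hp hp hq hqp hpq hp1 hp0,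
      corner p (1 - p) _ p hp hq hq hp hpq hqp hp0 hp1,
      corner p (1 - p) p (1 - p) hp hq hp hq hpq hpq hp0 hp0]
    abel
  have hΦsmul : ∀ (c : ℝ) x, Φ (c • x) = c • Φ x := by
    intro c x
    simp only [hΦ, mul_smul_comm, smul_mul_assoc, hτ.map_smul, smul_add]
  have hclosed : IsClosed {x | τ x = Φ x} :=
    isClosed_eq hcont (by simp only [hΦ]; fun_prop)
  have gen : ∀ x, (∀ e, PIso e → Under e x → τ e = Φ e) → τ x = Φ x := by
    intro x hx
    refine hR.mem_of_isClosed x {x | τ x = Φ x} hclosed (fun e he hu c => ?_) ?_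
    · show τ (c • e) = Φ (c • e)
      rw [hτ.map_smul, hΦsmul, hx e he hu]
    · intro y hy z hz h
      show τ (y + z) = Φ (y + z)
      rw [hΦadd, hτ.map_add_of_orth _ _ h, show τ y = Φ y from hy, show τ z = Φ z from hz]
  have under_mul : ∀ s e x : R, s * x = x → Under e x → s * e = e := by
    intro s e x h hu
    have := hu.1 (1 - s) (by rw [sub_mul, h, one_mul, sub_self])
    rw [sub_mul, one_mul, sub_eq_zero] at this
    exact this.symm
  have row : ∀ x, p * x = x → τ x = Φ x := by
    intro x hx
    refine gen x fun e he hu => ?_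
    have hpe := under_mul p e x hx hu
    have hqe : (1 - p) * e = 0 := by rw [← hpe, ← mul_assoc, hqp, zero_mul]
    simp only [hΦ, hpe, hqe, zero_mul, hτ0, add_zero]
    exact hτ.map_row hR hP hprime hp hp0 hp1 he
  have row' : ∀ x, (1 - p) * x = x → τ x = Φ x := by
    intro x hx
    refine gen x fun e he hu => ?_
    have hqe := under_mul (1 - p) e x hx hu
    have hpe : p * e = 0 := by rw [← hqe, ← mul_assoc, hpq, zero_mul]
    simp only [hΦ, hpe, hqe, zero_mul, hτ0, zero_add]
    exact hτ.map_row hR hP hprime hp hp0 hp1 he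
  have all : ∀ x, τ x = Φ x := by
    intro x
    refine gen x fun e he _ => ?_
    rw [hτ.map_column hR hP hprime hp hp0 hp1 he, row (p * e) (by rw [← mul_assoc, hp.mul_self]),
      row' ((1 - p) * e) (by rw [← mul_assoc, hq.mul_self]), ← hΦadd, ← add_mul, add_sub_cancel,
      one_mul]
  rw [all, all x, all y, hΦadd]

theorem IsOrthAdditive.map_add (hR : HasPeirceGeometry R) (hP : HasProjections R)
    (hτ : IsOrthAdditive τ) (x y : R) : τ (x + y) = τ x + τ y := by
  by_cases hprime : ∀ x y : R, x ≠ 0 → y ≠ 0 → ∃ a, x * a * y ≠ 0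
  · by_cases htriv : ∀ p : R, IsStarProjection p → p = 0 ∨ p = 1
    · exact hτ.map_add_of_trivial hP htriv x y
    · push Not at htriv
      obtain ⟨p, hp, h0, h1⟩ := htriv
      exact hτ.map_add_of_prime hR hP hprime hp h0 (fun h => h1 (sub_eq_zero.1 h).symm) x y
  · push Not at hprime
    obtain ⟨u, v, hu, hv, h⟩ := hprime
    obtain ⟨z, hz, h0, h1, hc⟩ := hP.exists_central u v hu hv h
    exact hτ.map_add_of_central hz h0 h1 hc x y

theorem HasPeirceGeometry.exists_linearIsometry_of_sphere (hR : HasPeirceGeometry R)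
    (hP : HasProjections R) {T : R → Y} (hT : IsSphereIsometry T) :
    ∃ g : R →ₗᵢ[ℝ] Y, Function.Surjective g ∧ ∀ x, ‖x‖ = 1 → g x = T x := by
  have hτ := hR.isOrthAdditive_sphereExtension hT
  obtain ⟨g, hg, h⟩ := hτ.toIsHomogeneousIsometry.exists_linearIsometry (hτ.map_add hR hP)
  exact ⟨g, hg, fun x hx => by rw [h, sphereExtension_eq hx]⟩

end Gluing

/-! ### Supports, polar decompositions and spectral cuts -/

section Operators

open ContinuousLinearMap
open scoped ComplexInnerProductSpace

variable {H : Type*} [NormedAddCommGroup H] [InnerProductSpace ℂ H] [CompleteSpace H]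

/-- The two closure properties by which a real von Neumann algebra enters. -/
structure IsRealVN (𝒜 : StarSubalgebra ℝ (H →L[ℂ] H)) : Prop where
  glue : ∀ (U : H →L[ℂ] H) (S : Set (H →L[ℂ] H)), S ⊆ 𝒜 → (∀ s ∈ S, U * s ∈ 𝒜) →
    (∀ ξ, (∀ s ∈ S, star s ξ = 0) → U ξ = 0) → U ∈ 𝒜
  abs_mem : ∀ x ∈ 𝒜, CFC.abs x ∈ 𝒜

theorem inner_star_left (x : H →L[ℂ] H) (ξ η : H) : ⟪star x ξ, η⟫ = ⟪ξ, x η⟫ := by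
  rw [star_eq_adjoint, adjoint_inner_left]

theorem inner_star_right (x : H →L[ℂ] H) (ξ η : H) : ⟪ξ, star x η⟫ = ⟪x ξ, η⟫ := by
  rw [star_eq_adjoint, adjoint_inner_right]

theorem inner_star_mul_self (x : H →L[ℂ] H) (ξ : H) : ⟪(star x * x) ξ, ξ⟫.re = ‖x ξ‖ ^ 2 := by
  have : (star x * x) ξ = star x (x ξ) := rfl
  rw [this, inner_star_left]
  exact inner_self_eq_norm_sq (𝕜 := ℂ) _

theorem IsStarProjection.inner_self {p : H →L[ℂ] H} (hp : IsStarProjection p) (ξ : H) :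
    ⟪p ξ, ξ⟫.re = ‖p ξ‖ ^ 2 := by
  rw [← inner_star_mul_self, hp.star_eq, hp.mul_self]

theorem re_inner_mono {a b : H →L[ℂ] H} (h : a ≤ b) (ξ : H) : ⟪a ξ, ξ⟫.re ≤ ⟪b ξ, ξ⟫.re := by
  have := ((le_def a b).1 h).re_inner_nonneg_left ξ
  rw [sub_apply, inner_sub_left] at this
  simpa using this

theorem le_of_re_inner {a b : H →L[ℂ] H} (ha : IsSelfAdjoint a) (hb : IsSelfAdjoint b)
    (h : ∀ ξ, ⟪a ξ, ξ⟫.re ≤ ⟪b ξ, ξ⟫.re) : a ≤ b := by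
  rw [le_def, isPositive_def]
  refine ⟨(hb.sub ha).isSymmetric, fun ξ => ?_⟩
  rw [reApplyInnerSelf, sub_apply, inner_sub_left]
  simpa using h ξ

namespace IsRealVN

variable {𝒜 : StarSubalgebra ℝ (H →L[ℂ] H)} (hA : IsRealVN 𝒜)
include hA

theorem exists_support {S : Set (H →L[ℂ] H)} (hS : S ⊆ 𝒜) :
    ∃ p ∈ 𝒜, IsStarProjection p ∧ (∀ s ∈ S, p * s = s) ∧
      ∀ y : H →L[ℂ] H, (∀ s ∈ S, y * s = 0) → y * p = 0 := by
  let K : Submodule ℂ H := (⨆ s ∈ S, LinearMap.range (s : H →ₗ[ℂ] H)).topologicalClosure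
  have hK : ∀ s ∈ S, ∀ ξ, s ξ ∈ K := fun s hs ξ =>
    Submodule.le_topologicalClosure _
      ((le_iSup₂ (f := fun s (_ : s ∈ S) => LinearMap.range (s : H →ₗ[ℂ] H)) s hs) ⟨ξ, rfl⟩)
  have hKc : IsClosed (K : Set H) := Submodule.isClosed_topologicalClosure _
  have : CompleteSpace K := hKc.completeSpace_coe
  have hps : ∀ s ∈ S, K.starProjection * s = s := fun s hs => by
    ext ξ
    exact Submodule.starProjection_eq_self_iff.2 (hK s hs ξ)
  have hleast : ∀ L : Submodule ℂ H, IsClosed (L : Set H) → (∀ s ∈ S, ∀ ξ, s ξ ∈ L) → K ≤ L := by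
    intro L hL h
    refine Submodule.topologicalClosure_minimal _ (iSup₂_le fun s hs => ?_) hL
    rintro _ ⟨ξ, rfl⟩
    exact h s hs ξ
  refine ⟨K.starProjection, hA.glue _ S hS (fun s hs => by rw [hps s hs]; exact hS hs) ?_,
    isStarProjection_starProjection, hps, ?_⟩
  · intro ξ hξ
    refine (Submodule.starProjection_apply_eq_zero_iff _).2 ?_
    rw [Submodule.mem_orthogonal]
    intro η hη
    have hle := hleast (LinearMap.ker (innerSL ℂ ξ : H →ₗ[ℂ] ℂ)) (innerSL ℂ ξ).isClosed_ker (by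
      intro s hs ζ
      show ⟪ξ, s ζ⟫ = 0
      rw [← inner_star_left, hξ s hs, inner_zero_left])
    have h0 : ⟪ξ, η⟫ = 0 := hle hη
    rw [← inner_conj_symm, h0, map_zero]
  · intro y hy
    have hle := hleast (LinearMap.ker (y : H →ₗ[ℂ] H)) y.isClosed_ker fun s hs ξ => by
      show (y * s) ξ = 0
      rw [hy s hs]; rfl
    ext ξ
    exact hle (Submodule.starProjection_apply_mem K ξ)

theorem exists_support_of_mem {x : H →L[ℂ] H} (hx : x ∈ 𝒜) :
    ∃ p ∈ 𝒜, IsStarProjection p ∧ p * x = x ∧ ∀ y : H →L[ℂ] H, y * x = 0 → y * p = 0 := by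
  obtain ⟨p, h1, h2, h3, h4⟩ := hA.exists_support (Set.singleton_subset_iff.2 hx)
  exact ⟨p, h1, h2, h3 x rfl, fun y hy => h4 y (by simpa using hy)⟩

/-- Polar decomposition; `p` is the support of the absolute value. -/
theorem exists_polar {x : H →L[ℂ] H} (hx : x ∈ 𝒜) :
    ∃ v ∈ 𝒜, ∃ p ∈ 𝒜, IsStarProjection p ∧ star v * v = p ∧ v * p = v ∧ p * CFC.abs x = CFC.abs x ∧
      (∀ y : H →L[ℂ] H, y * CFC.abs x = 0 → y * p = 0) ∧ v * CFC.abs x = x ∧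
      star v * x = CFC.abs x := by
  have hcm := hA.abs_mem x hx
  have hcc := CFC.abs_mul_abs x
  have hcs : star (CFC.abs x) = CFC.abs x := (CFC.abs_nonneg x).isSelfAdjoint.star_eq
  set c := CFC.abs x with hc
  have hnorm : ∀ ξ, ‖x ξ‖ = ‖c ξ‖ := fun ξ => by
    rw [← sq_eq_sq₀ (norm_nonneg _) (norm_nonneg _), ← inner_star_mul_self, ← inner_star_mul_self,
      ← hcc, hcs]
  let K : Submodule ℂ H := (LinearMap.range (c : H →ₗ[ℂ] H)).topologicalClosure
  have hK : ∀ ξ, c ξ ∈ K := fun ξ => Submodule.le_topologicalClosure _ ⟨ξ, rfl⟩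
  have hKc : IsClosed (K : Set H) := Submodule.isClosed_topologicalClosure _
  have : CompleteSpace K := hKc.completeSpace_coe
  let e : H →ₗ[ℂ] K := (c : H →ₗ[ℂ] H).codRestrict K hK
  have he : DenseRange e := by
    intro ⟨η, hη⟩
    rw [Metric.mem_closure_range_iff]
    intro ε hε
    have : η ∈ closure (Set.range c) := by
      have h2 : η ∈ closure ((LinearMap.range (c : H →ₗ[ℂ] H) : Submodule ℂ H) : Set H) := hη
      rwa [LinearMap.coe_range] at h2
    obtain ⟨ξ, hξ⟩ := Metric.mem_closure_range_iff.1 this ε hε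
    exact ⟨ξ, hξ⟩
  let w : K →L[ℂ] H := (x : H →ₗ[ℂ] H).extendOfNorm e
  have hw : ∀ ξ, w (e ξ) = x ξ := LinearMap.extendOfNorm_eq he ⟨1, fun ξ => by
    rw [one_mul]; exact (hnorm ξ).le⟩
  let v : H →L[ℂ] H := w ∘L K.orthogonalProjectionOnto
  have hvc : v * c = x := by
    ext ξ
    show w (K.orthogonalProjectionOnto (c ξ)) = x ξ
    rw [← hw ξ]
    congr 1
    exact Submodule.orthogonalProjectionOnto_mem_subspace_eq_self (⟨c ξ, hK ξ⟩ : K)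
  obtain ⟨p, hpA, hp, hpc, hpmin⟩ := hA.exists_support_of_mem hcm
  have hv0 : ∀ ξ, c ξ = 0 → v ξ = 0 := by
    intro ξ hξ
    show w (K.orthogonalProjectionOnto ξ) = 0
    have : K.orthogonalProjectionOnto ξ = 0 := by
      rw [Submodule.orthogonalProjectionOnto_eq_zero_iff]
      rw [Submodule.mem_orthogonal]
      intro η hη
      have hle : K ≤ LinearMap.ker (innerSL ℂ ξ : H →ₗ[ℂ] ℂ) := by
        refine Submodule.topologicalClosure_minimal _ ?_ (innerSL ℂ ξ).isClosed_ker
        rintro _ ⟨ζ, rfl⟩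
        show ⟪ξ, c ζ⟫ = 0
        rw [← inner_star_left, hcs, hξ, inner_zero_left]
      have h0 : ⟪ξ, η⟫ = 0 := hle hη
      rw [← inner_conj_symm, h0, map_zero]
    rw [this, map_zero]
  have hvA : v ∈ 𝒜 := by
    refine hA.glue v {c} (Set.singleton_subset_iff.2 hcm) ?_ ?_
    · rintro s rfl
      rw [hvc]; exact hx
    · intro ξ hξ
      exact hv0 ξ (by rw [← hcs]; exact hξ c rfl)
  have hcp : c * p = c := by
    have := congrArg star hpc
    rwa [star_mul, hcs, hp.star_eq] at this
  have hvp : v * p = v := by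
    have : v * (1 - p) = 0 := by
      ext ξ
      refine hv0 _ ?_
      show (c * (1 - p)) ξ = 0
      rw [mul_sub, hcp, mul_one, sub_self]; rfl
    rw [mul_sub, mul_one, sub_eq_zero] at this
    exact this.symm
  have hpv : p * star v = star v := by
    have := congrArg star hvp
    rwa [star_mul, hp.star_eq] at this
  have hvv : star v * v = p := by
    have h1 : (star (star v * v - p) * c) = 0 := by
      have h2 : (c * (star v * v - p)) * c = 0 := by
        calc c * (star v * v - p) * c = star (v * c) * (v * c) - c * (p * c) := by
              rw [star_mul, hcs]; noncomm_ring
          _ = 0 := by rw [hvc, hpc, hcc, sub_self]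
      have h3 := hpmin _ h2
      have h4 : (star v * v - p) * p = star v * v - p := by
        rw [sub_mul, mul_assoc, hvp, hp.mul_self]
      rw [mul_assoc, h4] at h3
      have := congrArg star h3
      rwa [star_mul, hcs, star_zero] at this
    have h2 := hpmin _ h1
    have h3 := congrArg star h2
    rw [star_mul, star_star, hp.star_eq, star_zero, mul_sub, ← mul_assoc, hpv, hp.mul_self,
      sub_eq_zero] at h3
    exact h3
  refine ⟨v, hvA, p, hpA, hp, hvv, hvp, hpc, hpmin, hvc, ?_⟩
  calc star v * x = star v * v * c := by rw [mul_assoc, hvc]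
    _ = c := by rw [hvv, hpc]

/-- The support of the positive part. -/
theorem exists_support_posPart {b : H →L[ℂ] H} (hbA : b ∈ 𝒜) (hbs : IsSelfAdjoint b) :
    ∃ g ∈ 𝒜, IsStarProjection g ∧ b * g = g * b ∧ 0 ≤ b * g ∧ b * (1 - g) ≤ 0 ∧
      ∀ y : H →L[ℂ] H, y * b = 0 → y * g = 0 := by
  have hposA : b⁺ ∈ 𝒜 := by
    have h1 := CFC.abs_add_self b hbs
    have h2 : b⁺ = (1 / 2 : ℝ) • (CFC.abs b + b) := by
      rw [h1, ← Nat.cast_smul_eq_nsmul ℝ, smul_smul]; norm_num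
    rw [h2]
    exact 𝒜.smul_mem (add_mem (hA.abs_mem b hbA) hbA) _
  have hsub := CFC.posPart_sub_negPart b hbs
  have hnp := CFC.negPart_mul_posPart b
  have hP0 := CFC.posPart_nonneg b
  have hN0 := CFC.negPart_nonneg b
  generalize b⁺ = P at *
  generalize b⁻ = N at *
  obtain ⟨g, hgA', hgp, hgP, hgmin⟩ := hA.exists_support_of_mem hposA
  have hPs : star P = P := hP0.isSelfAdjoint.star_eq
  have hNs : star N = N := hN0.isSelfAdjoint.star_eq
  have hPg : P * g = P := by
    have := congrArg star hgP
    rwa [star_mul, hPs, hgp.star_eq] at this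
  have hNg : N * g = 0 := hgmin _ hnp
  have hgN : g * N = 0 := by
    have := congrArg star hNg
    rwa [star_mul, hNs, hgp.star_eq, star_zero] at this
  have hbgP : b * g = P := by rw [← hsub, sub_mul, hPg, hNg, sub_zero]
  have hgbP : g * b = P := by rw [← hsub, mul_sub, hgP, hgN, sub_zero]
  refine ⟨g, hgA', hgp, by rw [hbgP, hgbP], by rwa [hbgP], ?_, fun y hy => hgmin y ?_⟩
  · rw [mul_sub, mul_one, hbgP, ← hsub, sub_sub_cancel_left]
    exact neg_nonpos.2 hN0
  · rw [← hbgP, ← mul_assoc, hy, zero_mul]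

/-- Cutting a self-adjoint element at a real number, below a commuting projection. -/
theorem exists_cut {a g₀ : H →L[ℂ] H} (haA : a ∈ 𝒜) (ha : IsSelfAdjoint a) (hgA : g₀ ∈ 𝒜)
    (hg : IsStarProjection g₀) (hcomm : g₀ * a = a * g₀) (l : ℝ) :
    ∃ g ∈ 𝒜, IsStarProjection g ∧ g₀ * g = g ∧ g * g₀ = g ∧ g * a = a * g ∧ l • g ≤ a * g ∧
      a * (g₀ - g) ≤ l • (g₀ - g) := by
  set b := (a - l • 1) * g₀ with hb
  have hcomm' : g₀ * (a - l • 1) = b := by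
    rw [hb, mul_sub, sub_mul, hcomm, mul_smul_comm, smul_mul_assoc, mul_one, one_mul]
  have hbA : b ∈ 𝒜 := mul_mem (sub_mem haA (𝒜.smul_mem (one_mem _) l)) hgA
  have hbs : IsSelfAdjoint b := by
    rw [IsSelfAdjoint, hb, star_mul, hg.star_eq, star_sub, ha.star_eq, star_smul, star_one,
      star_trivial, hcomm']
  obtain ⟨g, hgA', hgp, hbg, hpos, hneg, hgmin⟩ := hA.exists_support_posPart hbA hbs
  have hg₀g : g₀ * g = g := by
    have h1 : (1 - g₀) * b = 0 := by
      rw [← hcomm', ← mul_assoc, sub_mul, one_mul, hg.mul_self, sub_self, zero_mul]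
    have := hgmin _ h1
    rw [sub_mul, one_mul, sub_eq_zero] at this
    exact this.symm
  have hgg₀ : g * g₀ = g := by
    have := congrArg star hg₀g
    rwa [star_mul, hg.star_eq, hgp.star_eq] at this
  have hag : b * g = a * g - l • g := by
    rw [hb, mul_assoc, hg₀g, sub_mul, smul_mul_assoc, one_mul]
  have hga : g * b = g * a - l • g := by
    rw [← hcomm', ← mul_assoc, hgg₀, mul_sub, mul_smul_comm, mul_one]
  refine ⟨g, hgA', hgp, hg₀g, hgg₀, ?_, ?_, ?_⟩
  · have := hbg
    rw [hag, hga] at this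
    exact (sub_left_injective this).symm
  · rw [hag] at hpos
    exact sub_nonneg.1 hpos
  · have : b * (1 - g) = a * (g₀ - g) - l • (g₀ - g) := by
      rw [mul_sub, mul_one, hag, hb, sub_mul, smul_mul_assoc, one_mul, mul_sub, smul_sub]
      abel
    rw [this] at hneg
    exact sub_nonpos.1 hneg

end IsRealVN

end Operators

/-! ### Orthogonal sums and approximation by partial isometries -/

section Operators

open ContinuousLinearMap
open scoped ComplexInnerProductSpace

variable {H : Type*} [NormedAddCommGroup H] [InnerProductSpace ℂ H] [CompleteSpace H]

theorem op_mul_apply (x y : H →L[ℂ] H) (ξ : H) : (x * y) ξ = x (y ξ) := rfl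

theorem norm_add_sq_of_inner_eq_zero {ξ η : H} (h : ⟪ξ, η⟫ = 0) :
    ‖ξ + η‖ ^ 2 = ‖ξ‖ ^ 2 + ‖η‖ ^ 2 := by
  rw [sq, sq, sq]; exact norm_add_sq_eq_norm_sq_add_norm_sq_of_inner_eq_zero ξ η h

theorem IsStarProjection.norm_sq_add {p : H →L[ℂ] H} (hp : IsStarProjection p) (ξ : H) :
    ‖p ξ‖ ^ 2 + ‖(1 - p) ξ‖ ^ 2 = ‖ξ‖ ^ 2 := by
  rw [← norm_add_sq_of_inner_eq_zero, ← add_apply, add_sub_cancel]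
  · rfl
  · rw [← inner_star_right, hp.star_eq, ← op_mul_apply p (1 - p), hp.mul_one_sub_self, zero_apply,
      inner_zero_right]

theorem Orth.norm_add_sq {x y : H →L[ℂ] H} (h : Orth x y) (ξ : H) :
    ‖(x + y) ξ‖ ^ 2 = ‖x ξ‖ ^ 2 + ‖y ξ‖ ^ 2 := by
  rw [add_apply, norm_add_sq_of_inner_eq_zero]
  rw [← inner_star_right, ← op_mul_apply (star x) y, h.1, zero_apply, inner_zero_right]

theorem norm_le_of_nonneg_of_le_smul {a p : H →L[ℂ] H} {c : ℝ} (hc : 0 ≤ c)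
    (hp : IsStarProjection p) (h0 : 0 ≤ a) (h : a ≤ c • p) : ‖a‖ ≤ c := by
  refine (CStarAlgebra.norm_le_norm_of_nonneg_of_le h0 h).trans ?_
  rw [norm_smul, Real.norm_of_nonneg hc]
  exact mul_le_of_le_one_right hc hp.pIso.norm_le_one

theorem le_norm_smul_one {a : H →L[ℂ] H} (ha : IsSelfAdjoint a) : a ≤ ‖a‖ • (1 : H →L[ℂ] H) := by
  have := IsSelfAdjoint.le_algebraMap_norm_self (a := a) ha
  rwa [Algebra.algebraMap_eq_smul_one] at this

/-- If `c g` is bounded below on `g`, then `g` is dominated by the support of `c`. -/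
theorem mul_eq_zero_of_le {c g y : H →L[ℂ] H} {l : ℝ} (hl : 0 < l) (hg : IsStarProjection g)
    (hcomm : g * c = c * g) (h : l • g ≤ c * g) (hy : c * y = 0) : g * y = 0 := by
  ext ξ
  have h1 := re_inner_mono h (y ξ)
  rw [← hcomm, op_mul_apply g c, ← op_mul_apply c y, hy, zero_apply, map_zero, inner_zero_left,
    smul_apply, ← Complex.coe_smul, inner_smul_left, Complex.conj_ofReal, Complex.re_ofReal_mul,
    hg.inner_self, Complex.zero_re] at h1
  have h2 : ‖g (y ξ)‖ ^ 2 ≤ 0 := by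
    by_contra hcon
    push Not at hcon
    nlinarith
  have h3 : ‖g (y ξ)‖ = 0 := by nlinarith [norm_nonneg (g (y ξ))]
  exact norm_eq_zero.1 h3

namespace IsRealVN

variable {𝒜 : StarSubalgebra ℝ (H →L[ℂ] H)} (hA : IsRealVN 𝒜)
include hA

theorem norm_add_le {x y : H →L[ℂ] H} (hx : x ∈ 𝒜) (h : Orth x y) : ‖x + y‖ ≤ max ‖x‖ ‖y‖ := by
  obtain ⟨p, -, hp, hpx, hpmin⟩ := hA.exists_support_of_mem (star_mem hx)
  have hxp : x * p = x := by
    have := congrArg star hpx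
    rwa [star_mul, star_star, hp.star_eq] at this
  have hyp : y * p = 0 := hpmin _ h.symm.2
  set m := max ‖x‖ ‖y‖ with hm
  have hm0 : 0 ≤ m := (norm_nonneg x).trans (le_max_left _ _)
  refine opNorm_le_bound _ hm0 fun ξ => ?_
  rw [← sq_le_sq₀ (norm_nonneg _) (by positivity), h.norm_add_sq, mul_pow, ← hp.norm_sq_add ξ, mul_add]
  have e1 : x ξ = x (p ξ) := by rw [← op_mul_apply x p, hxp]
  have e2 : y ξ = y ((1 - p) ξ) := by rw [← op_mul_apply y (1 - p), mul_sub, hyp, mul_one, sub_zero]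
  rw [e1, e2, ← mul_pow, ← mul_pow]
  gcongr
  · exact (le_opNorm _ _).trans (by gcongr; exact le_max_left _ _)
  · exact (le_opNorm _ _).trans (by gcongr; exact le_max_right _ _)

theorem exists_peel {x : H →L[ℂ] H} (hx : x ∈ 𝒜) (hx1 : ‖x‖ = 1) {ε : ℝ} (hε : 0 < ε) :
    ∃ e ∈ 𝒜, ∃ b ∈ 𝒜, e ≠ 0 ∧ PIso e ∧ Orth e b ∧ ‖b‖ ≤ 1 ∧ ‖x - (e + b)‖ ≤ ε ∧
      Under e x ∧ Under b x := by
  wlog hε1 : ε < 1 generalizing ε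
  · obtain ⟨e, he, b, hb, h1, h2, h3, h4, h5, h6⟩ := this (ε := 1 / 2) (by norm_num) (by norm_num)
    exact ⟨e, he, b, hb, h1, h2, h3, h4, h5.trans (by linarith [not_lt.1 hε1]), h6⟩
  obtain ⟨v, hvA, p, hpA, hp, hvv, hvp, hpc, hpmin, hvc, hvx⟩ := hA.exists_polar hx
  have hcA := hA.abs_mem x hx
  have hc0 := CFC.abs_nonneg x
  have hcn : ‖CFC.abs x‖ = 1 := by rw [CFC.norm_abs, hx1]
  generalize CFC.abs x = c at *
  have hcs := hc0.isSelfAdjoint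
  have hcle : c ≤ 1 := by simpa [hcn] using le_norm_smul_one hcs
  obtain ⟨g, hgA, hg, -, -, hgc, hlow, hhigh⟩ := hA.exists_cut hcA hcs (one_mem 𝒜) (.one _)
    (by rw [one_mul, mul_one]) (1 - ε)
  have hcg : c * g = g * c := hgc.symm
  have hgy : ∀ y : H →L[ℂ] H, c * y = 0 → g * y = 0 := fun y =>
    mul_eq_zero_of_le (sub_pos.2 hε1) hg hgc hlow
  have hcp : c * p = c := by
    have := congrArg star hpc
    rwa [star_mul, hcs.star_eq, hp.star_eq] at this
  have hgp : g * p = g := by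
    have := hgy (1 - p) (by rw [mul_sub, hcp, mul_one, sub_self])
    rw [mul_sub, mul_one, sub_eq_zero] at this
    exact this.symm
  have hpg : p * g = g := hg.mul_eq_comm hp hgp
  have hxc : ∀ y : H →L[ℂ] H, x * y = 0 → c * y = 0 := fun y hy => by
    rw [← hvx, mul_assoc, hy, mul_zero]
  have hstar : star (v * g) * (v * g) = g := by
    calc star (v * g) * (v * g) = g * (star v * v) * g := by
          rw [star_mul, hg.star_eq]; noncomm_ring
      _ = g := by rw [hvv, hgp, hg.mul_self]
  have hvnorm : ‖v‖ ≤ 1 := PIso.norm_le_one (.of_isStarProjection (by rw [hvv, hp.mul_self]))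
  have hg0 : g ≠ 0 := by
    rintro rfl
    rw [sub_zero, mul_one] at hhigh
    have := norm_le_of_nonneg_of_le_smul (by linarith) (.one _) hc0 hhigh
    linarith
  refine ⟨v * g, mul_mem hvA hgA, x * (1 - g), mul_mem hx (sub_mem (one_mem _) hgA), ?_, ?_, ?_, ?_,
    ?_, ?_, ?_⟩
  · intro h
    rw [h] at hstar
    exact hg0 (by rw [← hstar]; simp)
  · exact .of_isStarProjection (by rw [hstar, hg.mul_self])
  · constructor
    · calc star (v * g) * (x * (1 - g)) = g * (star v * x) * (1 - g) := by
            rw [star_mul, hg.star_eq]; noncomm_ring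
        _ = c * (g * (1 - g)) := by rw [hvx, hgc]; noncomm_ring
        _ = 0 := by rw [hg.mul_one_sub_self, mul_zero]
    · calc v * g * star (x * (1 - g)) = v * (g * (1 - g)) * star x := by
            rw [star_mul, hg.one_sub.star_eq]; noncomm_ring
        _ = 0 := by rw [hg.mul_one_sub_self]; simp
  · exact (norm_mul_le _ _).trans (by
      rw [hx1, one_mul]; exact hg.one_sub.pIso.norm_le_one)
  · have e1 : x - (v * g + x * (1 - g)) = -(v * (g - c * g)) := by
      rw [mul_sub, mul_sub, ← mul_assoc v c, hvc]; noncomm_ring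
    have hs : IsSelfAdjoint (c * g) := by
      rw [IsSelfAdjoint, star_mul, hg.star_eq, hcs.star_eq, hgc]
    have hcgle : c * g ≤ g := by
      have := star_left_conjugate_le_conjugate hcle g
      rwa [hg.star_eq, mul_one, hg.mul_self, hgc, mul_assoc, hg.mul_self] at this
    rw [e1, norm_neg]
    refine (norm_mul_le _ _).trans ?_
    refine (mul_le_of_le_one_left (norm_nonneg _) hvnorm).trans ?_
    refine norm_le_of_nonneg_of_le_smul hε.le hg (sub_nonneg.2 hcgle) ?_
    rw [sub_smul, one_smul] at hlow
    rw [sub_le_comm]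
    exact hlow
  · refine ⟨fun y hy => ?_, fun y hy => ?_⟩
    · have : y * v * p = 0 := hpmin _ (by rw [mul_assoc, hvc, hy])
      rw [mul_assoc, hvp] at this
      rw [← mul_assoc, this, zero_mul]
    · rw [mul_assoc, hgy y (hxc y hy), mul_zero]
  · refine ⟨fun y hy => by rw [← mul_assoc, hy, zero_mul], fun y hy => ?_⟩
    rw [mul_assoc, sub_mul, one_mul, hgy y (hxc y hy), sub_zero, hy]

theorem mem_closure_of_pIso {x : H →L[ℂ] H} (hx : x ∈ 𝒜) (G : Set (H →L[ℂ] H))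
    (hG : ∀ e ∈ 𝒜, PIso e → Under e x → ∀ c : ℝ, c • e ∈ G)
    (hadd : ∀ y ∈ 𝒜, ∀ z ∈ 𝒜, y ∈ G → z ∈ G → Orth y z → y + z ∈ G) {ε : ℝ} (hε : 0 < ε) :
    ∃ y ∈ 𝒜, y ∈ G ∧ ‖x - y‖ ≤ ε := by
  obtain ⟨v, hvA, p, hpA, hp, hvv, hvp, hpc, hpmin, hvc, hvx⟩ := hA.exists_polar hx
  have hcA := hA.abs_mem x hx
  have hc0 := CFC.abs_nonneg x
  generalize CFC.abs x = c at *
  have hcs := hc0.isSelfAdjoint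
  have hcp : c * p = c := by
    have := congrArg star hpc
    rwa [star_mul, hcs.star_eq, hp.star_eq] at this
  have hxc : ∀ y : H →L[ℂ] H, x * y = 0 → c * y = 0 := fun y hy => by
    rw [← hvx, mul_assoc, hy, mul_zero]
  have hvnorm : ‖v‖ ≤ 1 := PIso.norm_le_one (.of_isStarProjection (by rw [hvv, hp.mul_self]))
  have hcy : ∀ y : H →L[ℂ] H, c * y = 0 → p * y = 0 := fun y hy => by
    have h1 : star y * c = 0 := by
      have := congrArg star hy
      rwa [star_mul, hcs.star_eq, star_zero] at this
    have := congrArg star (hpmin _ h1)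
    rwa [star_mul, star_star, hp.star_eq, star_zero] at this
  -- a short spectral interval
  have short : ∀ g ∈ 𝒜, IsStarProjection g → p * g = g → g * c = c * g → ∀ l : ℝ,
      l • g ≤ c * g → c * g ≤ (l + ε) • g →
      ∃ s ∈ 𝒜, g * s = s ∧ s * g = s ∧ v * s ∈ G ∧ ‖x * g - v * s‖ ≤ ε := by
    intro g hgA hg hpg hgc l h1 h2
    have hgp : g * p = g := by
      have := congrArg star hpg
      rwa [star_mul, hp.star_eq, hg.star_eq] at this
    have hstar : star (v * g) * (v * g) = g := by
      calc star (v * g) * (v * g) = g * (star v * v) * g := by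
            rw [star_mul, hg.star_eq]; noncomm_ring
        _ = g := by rw [hvv, hgp, hg.mul_self]
    refine ⟨l • g, 𝒜.smul_mem hgA l, by rw [mul_smul_comm, hg.mul_self],
      by rw [smul_mul_assoc, hg.mul_self], ?_, ?_⟩
    · rw [mul_smul_comm]
      refine hG _ (mul_mem hvA hgA) (.of_isStarProjection (by rw [hstar, hg.mul_self])) ⟨?_, ?_⟩ l
      · intro y hy
        have : y * v * p = 0 := hpmin _ (by rw [mul_assoc, hvc, hy])
        rw [mul_assoc, hvp] at this
        rw [← mul_assoc, this, zero_mul]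
      · intro y hy
        rw [mul_assoc, ← hgp, mul_assoc, hcy y (hxc y hy), mul_zero, mul_zero]
    · have e1 : x * g - v * (l • g) = v * (c * g - l • g) := by
        rw [mul_sub, ← mul_assoc, hvc]
      rw [e1]
      refine (norm_mul_le _ _).trans ?_
      refine (mul_le_of_le_one_left (norm_nonneg _) hvnorm).trans ?_
      refine norm_le_of_nonneg_of_le_smul hε.le hg (sub_nonneg.2 h1) ?_
      rw [sub_le_iff_le_add, ← add_smul, add_comm]
      exact h2
  have long : ∀ n : ℕ, ∀ g ∈ 𝒜, IsStarProjection g → p * g = g → g * c = c * g → ∀ l : ℝ,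
      l • g ≤ c * g → c * g ≤ (l + (n + 1) * ε) • g →
      ∃ s ∈ 𝒜, g * s = s ∧ s * g = s ∧ v * s ∈ G ∧ ‖x * g - v * s‖ ≤ ε := by
    intro n
    induction n with
    | zero =>
      intro g hgA hg hpg hgc l h1 h2
      refine short g hgA hg hpg hgc l h1 ?_
      simpa using h2
    | succ n ih =>
      intro g hgA hg hpg hgc l h1 h2
      obtain ⟨k, hkA, hk, hgk, hkg, hkc, hlow, hhigh⟩ :=
        hA.exists_cut hcA hcs hgA hg hgc (l + ε)
      have hgk' : IsStarProjection (g - k) := hk.sub_of_mul_eq_left hg hkg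
      have hgkk : (g - k) * k = 0 := by rw [sub_mul, hgk, hk.mul_self, sub_self]
      have hkgk : k * (g - k) = 0 := by rw [mul_sub, hkg, hk.mul_self, sub_self]
      have hpk : p * k = k := by rw [← hgk, ← mul_assoc, hpg]
      have hmono : ∀ {a b t : H →L[ℂ] H}, a ≤ b → IsStarProjection t → t * a * t ≤ t * b * t := by
        intro a b t hab ht
        have := star_left_conjugate_le_conjugate hab t
        rwa [ht.star_eq] at this
      obtain ⟨s₁, hs₁A, a1, a2, a3, a4⟩ := ih k hkA hk hpk hkc (l + ε) hlow (by
        have := hmono h2 hk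
        have e1 : k * (c * g) * k = c * k := by
          rw [mul_assoc, mul_assoc, hgk, ← mul_assoc, hkc, mul_assoc, hk.mul_self]
        have e2 : k * ((l + ((n + 1 : ℕ) + 1) * ε) • g) * k = (l + ((n + 1 : ℕ) + 1) * ε) • k := by
          rw [mul_smul_comm, smul_mul_assoc, hkg, hk.mul_self]
        rw [e1, e2] at this
        convert this using 2
        push_cast; ring)
      obtain ⟨s₂, hs₂A, b1, b2, b3, b4⟩ := short (g - k) (sub_mem hgA hkA) hgk'
        (by rw [mul_sub, hpg, hpk]) (by rw [sub_mul, mul_sub, hgc, hkc]) l (by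
          have := hmono h1 hgk'
          have e0 : g * (g - k) = g - k := by rw [mul_sub, hg.mul_self, hgk]
          have e0' : (g - k) * g = g - k := by rw [sub_mul, hg.mul_self, hkg]
          have e1 : (g - k) * (c * g) * (g - k) = c * (g - k) := by
            rw [mul_assoc, mul_assoc, e0, ← mul_assoc,
              show (g - k) * c = c * (g - k) by rw [sub_mul, mul_sub, hgc, hkc], mul_assoc,
              hgk'.mul_self]
          have e2 : (g - k) * (l • g) * (g - k) = l • (g - k) := by
            rw [mul_smul_comm, smul_mul_assoc, e0', hgk'.mul_self]
          rwa [e1, e2] at this) hhigh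
      have orth1 : Orth (v * s₁) (v * s₂) := by
        constructor
        · calc star (v * s₁) * (v * s₂) = star s₁ * (star v * v) * s₂ := by
                rw [star_mul]; noncomm_ring
            _ = star (k * s₁) * (p * (g - k)) * s₂ := by rw [hvv, a1, mul_assoc _ (p * _), mul_assoc p, b1, mul_assoc]
            _ = star s₁ * (k * (g - k)) * s₂ := by
                rw [mul_sub, hpg, hpk, star_mul, hk.star_eq]; noncomm_ring
            _ = 0 := by rw [hkgk]; simp
        · calc v * s₁ * star (v * s₂) = v * (s₁ * k) * star (v * (s₂ * (g - k))) := by rw [a2, b2]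
            _ = v * s₁ * (k * (g - k)) * star (v * s₂) := by
                rw [← mul_assoc v s₂, star_mul _ (g - k), hgk'.star_eq]; noncomm_ring
            _ = 0 := by rw [hkgk]; simp
      have orth2 : Orth (x * k - v * s₁) (x * (g - k) - v * s₂) := by
        have f1 : x * k - v * s₁ = v * (k * (c * k - s₁)) := by
          rw [mul_sub k, a1, ← mul_assoc k, hkc, mul_assoc c, hk.mul_self, mul_sub, ← mul_assoc, hvc]
        have f2 : x * (g - k) - v * s₂ = v * ((g - k) * (c * (g - k) - s₂)) := by
          rw [mul_sub (g - k), b1, ← mul_assoc (g - k),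
            show (g - k) * c = c * (g - k) by rw [sub_mul, mul_sub, hgc, hkc], mul_assoc c,
            hgk'.mul_self, mul_sub v, ← mul_assoc v, hvc]
        have f3 : (x * k - v * s₁) * k = x * k - v * s₁ := by
          rw [sub_mul, mul_assoc, mul_assoc, hk.mul_self, a2]
        have f4 : (x * (g - k) - v * s₂) * (g - k) = x * (g - k) - v * s₂ := by
          rw [sub_mul, mul_assoc, mul_assoc, hgk'.mul_self, b2]
        constructor
        · rw [f1, f2]
          calc star (v * (k * (c * k - s₁))) * (v * ((g - k) * (c * (g - k) - s₂))) =
              star (c * k - s₁) * (k * ((star v * v) * (g - k))) * (c * (g - k) - s₂) := by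
                rw [star_mul, star_mul, hk.star_eq]; noncomm_ring
            _ = 0 := by rw [hvv, mul_sub p, hpg, hpk, hkgk]; simp
        · rw [← f3, ← f4, star_mul _ (g - k), hgk'.star_eq, mul_assoc, ← mul_assoc k, hkgk]
          simp
      refine ⟨s₁ + s₂, add_mem hs₁A hs₂A, ?_, ?_, ?_, ?_⟩
      · rw [mul_add, ← a1, ← mul_assoc, hgk, ← b1, ← mul_assoc g, mul_sub, hg.mul_self, hgk]
      · rw [add_mul, ← a2, mul_assoc, hkg, ← b2, mul_assoc s₂, sub_mul, hg.mul_self, hkg]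
      · rw [mul_add]
        exact hadd _ (mul_mem hvA hs₁A) _ (mul_mem hvA hs₂A) a3 b3 orth1
      · have : x * g - v * (s₁ + s₂) = (x * k - v * s₁) + (x * (g - k) - v * s₂) := by
          noncomm_ring
        rw [this]
        exact (hA.norm_add_le (sub_mem (mul_mem hx hkA) (mul_mem hvA hs₁A)) orth2).trans
          (max_le a4 b4)
  obtain ⟨n, hn⟩ := exists_nat_gt (‖c‖ / ε)
  obtain ⟨s, hsA, -, -, h1, h2⟩ := long n p hpA hp hp.mul_self (by rw [hpc, hcp]) 0
    (by rw [zero_smul, hcp]; exact hc0) (by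
      have h := star_left_conjugate_le_conjugate (le_norm_smul_one hcs) p
      rw [hp.star_eq, mul_smul_comm, smul_mul_assoc, mul_one, hp.mul_self, hpc, hcp] at h
      rw [hcp]
      refine h.trans (smul_le_smul_of_nonneg_right ?_ hp.nonneg)
      rw [div_lt_iff₀ hε] at hn
      nlinarith)
  refine ⟨v * s, mul_mem hvA hsA, h1, ?_⟩
  have : x * p = x := by rw [← hvc, mul_assoc, hcp]
  rwa [this] at h2

end IsRealVN

end Operators

/-! ### Norm conditions for partial isometries -/

section Operators

open ContinuousLinearMap
open scoped ComplexInnerProductSpace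

variable {H : Type*} [NormedAddCommGroup H] [InnerProductSpace ℂ H] [CompleteSpace H]

theorem norm_apply_le {x : H →L[ℂ] H} (hx : ‖x‖ ≤ 1) (ξ : H) : ‖x ξ‖ ≤ ‖ξ‖ :=
  (x.le_opNorm ξ).trans (mul_le_of_le_one_left (norm_nonneg _) hx)

theorem parallelogram (ξ η : H) : ‖ξ + η‖ ^ 2 + ‖ξ - η‖ ^ 2 = 2 * (‖ξ‖ ^ 2 + ‖η‖ ^ 2) := by
  have := parallelogram_law_with_norm ℂ ξ η
  nlinarith

theorem norm_sub_sq_re (ξ η : H) : ‖ξ - η‖ ^ 2 = ‖ξ‖ ^ 2 - 2 * ⟪ξ, η⟫.re + ‖η‖ ^ 2 :=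
  norm_sub_sq (𝕜 := ℂ) ξ η

theorem norm_add_sq_re (ξ η : H) : ‖ξ + η‖ ^ 2 = ‖ξ‖ ^ 2 + 2 * ⟪ξ, η⟫.re + ‖η‖ ^ 2 :=
  norm_add_sq (𝕜 := ℂ) ξ η

theorem eq_of_norm_sub_sq_nonpos {ξ η : H} (h : ‖ξ - η‖ ^ 2 ≤ 0) : ξ = η := by
  have : ‖ξ - η‖ = 0 := by nlinarith [norm_nonneg (ξ - η)]
  exact sub_eq_zero.1 (norm_eq_zero.1 this)

theorem PIso.norm_sq_apply {e : H →L[ℂ] H} (he : PIso e) (ξ : H) :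
    ‖e ξ‖ ^ 2 = ‖(star e * e) ξ‖ ^ 2 := by
  rw [← inner_star_mul_self, he.isStarProjection.inner_self]

theorem PIso.norm_apply_initial {e : H →L[ℂ] H} (he : PIso e) (ξ : H) :
    ‖e ξ‖ = ‖(star e * e) ξ‖ := by
  rw [← sq_eq_sq₀ (norm_nonneg _) (norm_nonneg _), he.norm_sq_apply]

theorem mul_star_eq_zero_of_norm_le {u c : H →L[ℂ] H} (hu : PIso u) (h1 : ‖c + u‖ ≤ 1)
    (h2 : ‖c - u‖ ≤ 1) : c * star u = 0 := by
  have key : c * (star u * u) = 0 := by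
    ext ξ
    set η := (star u * u) ξ with hη
    have hu1 : ‖u η‖ = ‖η‖ := by
      rw [hu.norm_apply_initial, hη, ← op_mul_apply (star u * u), hu.isStarProjection.mul_self]
    have e := parallelogram (c η) (u η)
    have a1 := norm_apply_le h1 η
    have a2 := norm_apply_le h2 η
    rw [add_apply] at a1
    rw [sub_apply] at a2
    rw [hu1] at e
    have b1 : ‖c η + u η‖ ^ 2 ≤ ‖η‖ ^ 2 := by gcongr
    have b2 : ‖c η - u η‖ ^ 2 ≤ ‖η‖ ^ 2 := by gcongr
    have : ‖c η‖ = 0 := by nlinarith [norm_nonneg (c η)]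
    exact norm_eq_zero.1 this
  calc c * star u = c * (star u * u) * star u := by
        conv_lhs => rw [← hu.star_pIso]
        rw [star_star]; noncomm_ring
    _ = 0 := by rw [key, zero_mul]

theorem orth_of_norm_le {u c : H →L[ℂ] H} (hu : PIso u) (h1 : ‖c + u‖ ≤ 1) (h2 : ‖c - u‖ ≤ 1) :
    Orth u c := by
  have e1 := mul_star_eq_zero_of_norm_le hu h1 h2
  have e2 := mul_star_eq_zero_of_norm_le hu.star_pIso (c := star c)
    (by rwa [← star_add, norm_star]) (by rwa [← star_sub, norm_star])
  rw [star_star] at e2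
  constructor
  · have := congrArg star e2
    rwa [star_mul, star_star, star_zero] at this
  · have := congrArg star e1
    rwa [star_mul, star_star, star_zero] at this

theorem nonneg_of_star_mul_self_eq {x s : H →L[ℂ] H} {c : ℝ} (hs : IsStarProjection s)
    (hs0 : s ≠ 0) (h : star x * x = c • s) : 0 ≤ c := by
  obtain ⟨ξ, hξ⟩ : ∃ ξ, s ξ ≠ 0 := by
    by_contra hcon
    push Not at hcon
    exact hs0 (by ext ξ; exact hcon ξ)
  have h1 := inner_star_mul_self x ξ
  rw [h, smul_apply, ← Complex.coe_smul, inner_smul_left, Complex.conj_ofReal,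
    Complex.re_ofReal_mul, hs.inner_self] at h1
  have h2 : 0 < ‖s ξ‖ ^ 2 := by have := norm_pos_iff.2 hξ; positivity
  by_contra hcon
  push Not at hcon
  nlinarith [sq_nonneg ‖x ξ‖]

theorem norm_sq_of_star_mul_self_eq {x s : H →L[ℂ] H} {c : ℝ} (hs : IsStarProjection s)
    (h : star x * x = c • s) (ξ : H) : ‖x ξ‖ ^ 2 = c * ‖s ξ‖ ^ 2 := by
  rw [← inner_star_mul_self, h, smul_apply, ← Complex.coe_smul, inner_smul_left,
    Complex.conj_ofReal, Complex.re_ofReal_mul, hs.inner_self]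

theorem mul_eq_of_four {h g : H →L[ℂ] H} (hh : ‖h‖ ≤ 1) (hg : IsStarProjection g)
    (h4 : star ((1 + h) * g) * ((1 + h) * g) = (4 : ℝ) • g) : h * g = g := by
  ext ξ
  have h1 := norm_sq_of_star_mul_self_eq hg h4 ξ
  have e1 : ((1 + h) * g) ξ = g ξ + h (g ξ) := rfl
  rw [e1] at h1
  have e := parallelogram (g ξ) (h (g ξ))
  have h2 : ‖h (g ξ)‖ ^ 2 ≤ ‖g ξ‖ ^ 2 := by gcongr; exact norm_apply_le hh _
  exact (eq_of_norm_sub_sq_nonpos (ξ := g ξ) (η := h (g ξ)) (by nlinarith)).symm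

theorem star_mul_mul_eq {z k : H →L[ℂ] H} (hz : ‖z‖ ≤ 1) (hk : IsStarProjection k)
    (h : star (z * k) * (z * k) = k) : star z * z * k = k := by
  ext ξ
  have h1 := norm_sq_of_star_mul_self_eq hk (c := 1) (by rw [h, one_smul]) ξ
  have h2 : ‖star z (z (k ξ))‖ ^ 2 ≤ ‖z (k ξ)‖ ^ 2 := by
    gcongr; exact norm_apply_le (by rwa [norm_star]) _
  have e : ⟪star z (z (k ξ)), k ξ⟫.re = ‖z (k ξ)‖ ^ 2 := inner_star_mul_self z (k ξ)
  have e1 : (z * k) ξ = z (k ξ) := rfl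
  rw [e1] at h1
  refine eq_of_norm_sub_sq_nonpos (ξ := star z (z (k ξ))) ?_
  rw [norm_sub_sq_re, e]
  nlinarith

end Operators

/-! ### Faces determined by partial isometries -/

section Operators

open ContinuousLinearMap
open scoped ComplexInnerProductSpace

variable {H : Type*} [NormedAddCommGroup H] [InnerProductSpace ℂ H] [CompleteSpace H]

theorem norm_sq_apply_le_of_nonneg {c : H →L[ℂ] H} (hc : 0 ≤ c) (hc1 : ‖c‖ ≤ 1) (ξ : H) :
    ‖c ξ‖ ^ 2 ≤ ⟪c ξ, ξ⟫.re := by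
  have h1 := CFC.sqrt_mul_sqrt_self c hc
  have h2 := (CFC.sqrt_nonneg c).isSelfAdjoint
  generalize CFC.sqrt c = s at *
  have h3 : ‖s‖ ≤ 1 := by
    have : ‖s‖ * ‖s‖ = ‖c‖ := by rw [← CStarRing.norm_star_mul_self, h2.star_eq, h1]
    nlinarith [norm_nonneg s]
  rw [← h1]
  have h4 := inner_star_mul_self s ξ
  rw [h2.star_eq] at h4
  rw [h4, op_mul_apply]
  gcongr
  exact norm_apply_le h3 _

theorem re_inner_le_norm_mul (ξ η : H) : ⟪ξ, η⟫.re ≤ ‖ξ‖ * ‖η‖ :=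
  re_inner_le_norm (𝕜 := ℂ) ξ η

theorem re_inner_swap (ξ η : H) : ⟪ξ, η⟫.re = ⟪η, ξ⟫.re := inner_re_symm (𝕜 := ℂ) ξ η

theorem PIso.re_inner_apply {e : H →L[ℂ] H} (ξ η : H) :
    ⟪e ξ, e η⟫.re = ⟪(star e * e) ξ, η⟫.re := by
  rw [← inner_star_left, op_mul_apply]

/-- The defect of `x` with respect to the partial isometry `e`. -/
noncomputable def faceDefect (e x : H →L[ℂ] H) : H →L[ℂ] H :=
  star e * e - (1 / 2 : ℝ) • (star e * x * (star e * e) + star e * e * (star x * e))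

theorem faceDefect_isSelfAdjoint (e x : H →L[ℂ] H) : IsSelfAdjoint (faceDefect e x) := by
  rw [IsSelfAdjoint, faceDefect]
  simp only [star_sub, star_smul, star_add, star_mul, star_star, star_trivial]
  congr 2
  noncomm_ring

theorem faceDefect_re_inner {e : H →L[ℂ] H} (he : PIso e) (x : H →L[ℂ] H) (ξ : H) :
    ⟪faceDefect e x ξ, ξ⟫.re =
      ‖(star e * e) ξ‖ ^ 2 - ⟪x ((star e * e) ξ), e ξ⟫.re := by
  have hp := he.isStarProjection
  have e1 : ⟪(star e * x * (star e * e)) ξ, ξ⟫.re = ⟪x ((star e * e) ξ), e ξ⟫.re := by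
    rw [← inner_star_left e]; rfl
  have e2 : ⟪(star e * e * (star x * e)) ξ, ξ⟫.re = ⟪x ((star e * e) ξ), e ξ⟫.re := by
    rw [re_inner_swap (x _), ← inner_star_left x, ← inner_star_left (star e * e), hp.star_eq]; rfl
  rw [faceDefect, sub_apply, smul_apply, add_apply, inner_sub_left, ← Complex.coe_smul,
    inner_smul_left, Complex.conj_ofReal, inner_add_left, Complex.sub_re, Complex.re_ofReal_mul,
    Complex.add_re, e1, e2, hp.inner_self]
  ring

theorem faceDefect_mul {e : H →L[ℂ] H} (he : PIso e) (x : H →L[ℂ] H) :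
    star e * e * faceDefect e x = faceDefect e x := by
  have hp := he.isStarProjection.mul_self
  have h2 : star e * e * star e = star e := by rw [mul_assoc]; exact he.star_mul_mul_star
  rw [faceDefect, mul_sub, hp, mul_smul_comm, mul_add, ← mul_assoc (star e * e) (star e * e), hp,
    ← mul_assoc (star e * e) (star e * x), ← mul_assoc (star e * e) (star e), h2]

theorem faceDefect_nonneg {e x : H →L[ℂ] H} (he : PIso e) (hx : ‖x‖ ≤ 1) :
    0 ≤ faceDefect e x := by
  refine le_of_re_inner (.zero _) (faceDefect_isSelfAdjoint e x) fun ξ => ?_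
  rw [zero_apply, inner_zero_left, Complex.zero_re, faceDefect_re_inner he]
  have h1 := re_inner_le_norm_mul (x ((star e * e) ξ)) (e ξ)
  have h2 := norm_apply_le hx ((star e * e) ξ)
  rw [he.norm_apply_initial] at h1
  nlinarith [norm_nonneg ((star e * e) ξ)]

theorem mul_eq_of_faceDefect_eq_zero {e x : H →L[ℂ] H} (he : PIso e) (hx : ‖x‖ ≤ 1)
    (h : faceDefect e x = 0) : x * (star e * e) = e := by
  ext ξ
  have h1 := faceDefect_re_inner he x ξ
  rw [h, zero_apply, inner_zero_left, Complex.zero_re] at h1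
  have h2 := norm_apply_le hx ((star e * e) ξ)
  refine eq_of_norm_sub_sq_nonpos ?_
  rw [norm_sub_sq_re, he.norm_apply_initial, op_mul_apply x]
  nlinarith [norm_nonneg (x ((star e * e) ξ))]

/-- If `x * (star e * e) = e` then `e` and `x - e` are orthogonal. -/
theorem orth_sub_of_mul_eq {e x : H →L[ℂ] H} (he : PIso e) (hx : ‖x‖ ≤ 1)
    (h : x * (star e * e) = e) : Orth e (x - e) := by
  have hp := he.isStarProjection
  have hxe : x * star e = e * star e := by
    calc x * star e = x * (star e * e) * star e := by
          conv_lhs => rw [← he.star_mul_mul_star]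
          noncomm_ring
      _ = e * star e := by rw [h]
  have key : star x * e = star e * e := by
    ext ξ
    have h1 : x ((star e * e) ξ) = e ξ := by rw [← op_mul_apply x, h]
    have h2 : ‖(star x * e) ξ‖ ≤ ‖(star e * e) ξ‖ := by
      rw [← he.norm_apply_initial]
      exact norm_apply_le (x := star x) (by rwa [norm_star]) _
    have h3 : ⟪(star x * e) ξ, (star e * e) ξ⟫.re = ‖(star e * e) ξ‖ ^ 2 := by
      rw [op_mul_apply, inner_star_left, h1, ← he.norm_sq_apply]
      exact inner_self_eq_norm_sq (𝕜 := ℂ) _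
    refine eq_of_norm_sub_sq_nonpos ?_
    rw [norm_sub_sq_re, h3]
    nlinarith [norm_nonneg ((star x * e) ξ)]
  have key' := congrArg star key
  simp only [star_mul, star_star] at key'
  constructor
  · rw [mul_sub, key', sub_self]
  · have := congrArg star hxe
    simp only [star_mul, star_star] at this
    rw [star_sub, mul_sub, this, sub_self]

theorem IsRealVN.orth_of_face {𝒜 : StarSubalgebra ℝ (H →L[ℂ] H)} {e x : H →L[ℂ] H} (heA : e ∈ 𝒜)
    (hxA : x ∈ 𝒜) (he : PIso e) (hx : ‖x‖ ≤ 1)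
    (hface : ∀ y ∈ 𝒜, ‖y‖ = 1 → ‖e + y‖ = 2 → ‖x + y‖ = 2) : Orth e (x - e) := by
  refine orth_sub_of_mul_eq he hx (mul_eq_of_faceDefect_eq_zero he hx ?_)
  by_contra hne
  have hp := he.isStarProjection
  have hcA : faceDefect e x ∈ 𝒜 := by
    refine sub_mem (mul_mem (star_mem heA) heA) (𝒜.smul_mem (add_mem ?_ ?_) _)
    · exact mul_mem (mul_mem (star_mem heA) hxA) (mul_mem (star_mem heA) heA)
    · exact mul_mem (mul_mem (star_mem heA) heA) (mul_mem (star_mem hxA) heA)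
  have hc0 := faceDefect_nonneg he hx
  have hpc := faceDefect_mul he x
  have hin := faceDefect_re_inner he x
  generalize faceDefect e x = c at *
  set N := ‖c‖ with hN
  have hN0 : 0 < N := norm_pos_iff.2 hne
  obtain ⟨d, hd⟩ : ∃ d, d = N⁻¹ • c := ⟨_, rfl⟩
  have hcd : c = N • d := by rw [hd, smul_smul, mul_inv_cancel₀ hN0.ne', one_smul]
  have hdA : d ∈ 𝒜 := by rw [hd]; exact 𝒜.smul_mem hcA _
  have hd0 : 0 ≤ d := by rw [hd]; exact smul_nonneg (by positivity) hc0
  have hd1 : ‖d‖ = 1 := by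
    rw [hd, norm_smul, Real.norm_of_nonneg (by positivity), ← hN, inv_mul_cancel₀ hN0.ne']
  have hds := hd0.isSelfAdjoint.star_eq
  have hpd : star e * e * d = d := by rw [hd, mul_smul_comm, hpc]
  have hdp : d * (star e * e) = d := by
    have := congrArg star hpd
    rwa [star_mul, hp.star_eq, hds] at this
  have hpd' : ∀ ξ, (star e * e) (d ξ) = d ξ := fun ξ => by rw [← op_mul_apply (star e * e), hpd]
  have hdsq := fun ξ => norm_sq_apply_le_of_nonneg hd0 hd1.le ξ
  have hed : ∀ ξ, ‖e (d ξ)‖ = ‖d ξ‖ := fun ξ => by rw [he.norm_apply_initial, hpd']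
  have hdle : ∀ ξ, ‖d ξ‖ ≤ ‖ξ‖ := norm_apply_le hd1.le
  have hdpξ : ∀ ξ, ‖d ξ‖ ≤ ‖(star e * e) ξ‖ := fun ξ => by
    have := norm_apply_le hd1.le ((star e * e) ξ)
    rwa [← op_mul_apply d, hdp] at this
  have hy1 : ‖e * d‖ = 1 := by
    refine le_antisymm ?_ ?_
    · refine opNorm_le_bound _ zero_le_one fun ξ => ?_
      rw [op_mul_apply, hed, one_mul]
      exact hdle ξ
    · rw [← hd1]
      refine opNorm_le_bound _ (norm_nonneg _) fun ξ => ?_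
      rw [← hed, ← op_mul_apply]
      exact le_opNorm _ _
  have hey : ‖e + e * d‖ = 2 := by
    refine le_antisymm ((_root_.norm_add_le _ _).trans (by linarith [he.norm_le_one])) ?_
    have : ‖d‖ ≤ ‖e + e * d‖ / 2 := by
      refine opNorm_le_bound _ (by positivity) fun ξ => ?_
      have h1 : ‖(e + e * d) ξ‖ ^ 2 = ‖(star e * e) ξ‖ ^ 2 + 2 * ⟪d ξ, ξ⟫.re + ‖d ξ‖ ^ 2 := by
        rw [add_apply, norm_add_sq_re, op_mul_apply, hed, he.norm_sq_apply, re_inner_swap,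
          PIso.re_inner_apply, hpd']
      have h2 : (2 * ‖d ξ‖) ^ 2 ≤ ‖(e + e * d) ξ‖ ^ 2 := by
        rw [h1]
        nlinarith [hdsq ξ, hdpξ ξ, norm_nonneg (d ξ)]
      have h3 := (sq_le_sq₀ (by positivity) (by positivity)).1 h2
      have h4 := le_opNorm (e + e * d) ξ
      linarith
    linarith
  have hxy := hface _ (mul_mem heA hdA) hy1 hey
  obtain ⟨t, ht0, ht1, ht2⟩ : ∃ t : ℝ, 0 < t ∧ t ≤ 1 / 10 ∧ t ≤ N / 32 :=
    ⟨min (1 / 10) (N / 32), by positivity, min_le_left _ _, min_le_right _ _⟩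
  obtain ⟨ξ, hξ1, hξ2⟩ := exists_lt_apply_of_lt_opNorm (x + e * d) (r := 2 - t ^ 2)
    (by rw [hxy]; nlinarith)
  rw [add_apply, op_mul_apply] at hξ2
  have a1 : ‖x ξ‖ ≤ 1 := (norm_apply_le hx ξ).trans hξ1.le
  have a2 : ‖d ξ‖ ≤ 1 := (hdle ξ).trans hξ1.le
  have a3 : 1 - t ^ 2 ≤ ‖d ξ‖ := by
    have := _root_.norm_add_le (x ξ) (e (d ξ))
    rw [hed] at this
    linarith
  have a4 : ‖x ξ - e (d ξ)‖ ≤ 2 * t := by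
    have h := parallelogram (x ξ) (e (d ξ))
    rw [hed] at h
    rw [← sq_le_sq₀ (norm_nonneg _) (by positivity)]
    have h2 : (2 - t ^ 2) ^ 2 ≤ ‖x ξ + e (d ξ)‖ ^ 2 := by
      gcongr
      nlinarith
    nlinarith [norm_nonneg (x ξ), norm_nonneg (d ξ)]
  have a5 : ‖ξ - d ξ‖ ≤ 3 / 2 * t := by
    rw [← sq_le_sq₀ (norm_nonneg _) (by positivity), norm_sub_sq_re, re_inner_swap]
    nlinarith [hdsq ξ, norm_nonneg ξ, norm_nonneg (d ξ)]
  have a6 : ‖e (d ξ) - x (d ξ)‖ ≤ 4 * t := by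
    have h1 : e (d ξ) - x (d ξ) = -(x ξ - e (d ξ)) + x (ξ - d ξ) := by rw [map_sub]; abel
    have h2 := norm_apply_le hx (ξ - d ξ)
    rw [h1]
    refine (_root_.norm_add_le _ _).trans ?_
    rw [norm_neg]
    linarith
  have a7 : ⟪c (d ξ), d ξ⟫.re ≤ 4 * t := by
    have h1 : ⟪c (d ξ), d ξ⟫.re = ⟪e (d ξ) - x (d ξ), e (d ξ)⟫.re := by
      rw [hin, hpd', inner_sub_left, Complex.sub_re, ← hed]
      congr 1
      exact (inner_self_eq_norm_sq (𝕜 := ℂ) _).symm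
    rw [h1]
    refine (re_inner_le_norm_mul _ _).trans ?_
    rw [hed]
    nlinarith [norm_nonneg (d ξ), norm_nonneg (e (d ξ) - x (d ξ))]
  have a8 : 1 / 2 ≤ ‖d (d ξ)‖ := by
    have h1 := norm_sub_norm_le (d ξ) (d (d ξ))
    rw [← map_sub] at h1
    have h2 := hdle (ξ - d ξ)
    nlinarith
  have a9 : N * (1 / 4) ≤ ⟪c (d ξ), d ξ⟫.re := by
    rw [hcd, smul_apply, ← Complex.coe_smul, inner_smul_left, Complex.conj_ofReal,
      Complex.re_ofReal_mul]
    have := hdsq (d ξ)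
    gcongr
    nlinarith
  linarith

end Operators

/-! ### Sums of orthogonal families of partial isometries -/

section Operators

open ContinuousLinearMap
open scoped ComplexInnerProductSpace

variable {H : Type*} [NormedAddCommGroup H] [InnerProductSpace ℂ H] [CompleteSpace H]

/-- Bessel's inequality for a finite orthogonal family of partial isometries. -/
theorem PIso.finset_sum {ι : Type*} [DecidableEq ι] (s : ι → H →L[ℂ] H) (hs : ∀ i, PIso (s i))
    (ho : Pairwise fun i j => Orth (s i) (s j)) (F : Finset ι) :
    PIso (∑ i ∈ F, s i) ∧ (∀ j ∉ F, Orth (∑ i ∈ F, s i) (s j)) ∧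
      ∀ ξ, ‖(∑ i ∈ F, s i) ξ‖ ^ 2 = ∑ i ∈ F, ‖s i ξ‖ ^ 2 := by
  induction F using Finset.induction_on with
  | empty => exact ⟨by simp [PIso], fun j _ => by simp [Orth], fun ξ => by simp⟩
  | insert a F ha ih =>
    obtain ⟨h1, h2, h3⟩ := ih
    simp only [Finset.sum_insert ha]
    refine ⟨(hs a).add h1 (h2 a ha).symm, fun j hj => ?_, fun ξ => ?_⟩
    · rw [Finset.mem_insert, not_or] at hj
      exact (ho (Ne.symm hj.1)).add_left (h2 j hj.2)
    · rw [(h2 a ha).symm.norm_add_sq, h3]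

theorem PIso.orthogonalFamily {ι : Type*} (s : ι → H →L[ℂ] H)
    (ho : Pairwise fun i j => Orth (s i) (s j)) :
    OrthogonalFamily ℂ (fun i => LinearMap.range (s i : H →ₗ[ℂ] H))
      fun i => (LinearMap.range (s i : H →ₗ[ℂ] H)).subtypeₗᵢ := by
  rintro i j hij ⟨_, ξ, rfl⟩ ⟨_, η, rfl⟩
  show ⟪s i ξ, s j η⟫ = 0
  rw [← inner_star_right, ← op_mul_apply, (ho hij).1, zero_apply, inner_zero_right]

theorem PIso.exists_tsum {ι : Type*} (s : ι → H →L[ℂ] H) (hs : ∀ i, PIso (s i))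
    (ho : Pairwise fun i j => Orth (s i) (s j)) :
    ∃ w : H →L[ℂ] H, ∀ ξ, HasSum (fun i => s i ξ) (w ξ) := by
  classical
  have hle : ∀ (F : Finset ι) (ξ : H), ‖∑ i ∈ F, s i ξ‖ ≤ ‖ξ‖ := fun F ξ => by
    rw [← sum_apply]
    exact norm_apply_le (PIso.finset_sum s hs ho F).1.norm_le_one ξ
  have hsum : ∀ ξ, Summable fun i => s i ξ := fun ξ => by
    refine ((PIso.orthogonalFamily s ho).summable_iff_norm_sq_summable
      (fun i => ⟨s i ξ, ξ, rfl⟩)).2 ?_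
    refine summable_of_sum_le (c := ‖ξ‖ ^ 2) (fun i => by positivity) fun F => ?_
    show ∑ i ∈ F, ‖s i ξ‖ ^ 2 ≤ _
    rw [← (PIso.finset_sum s hs ho F).2.2]
    gcongr
    exact norm_apply_le (PIso.finset_sum s hs ho F).1.norm_le_one ξ
  let w₀ : H →ₗ[ℂ] H :=
    { toFun := fun ξ => ∑' i, s i ξ
      map_add' := fun ξ η => by
        simp only [map_add]
        exact (hsum ξ).tsum_add (hsum η)
      map_smul' := fun c ξ => by
        simp only [map_smul]
        exact (hsum ξ).tsum_const_smul c }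
  refine ⟨w₀.mkContinuous 1 fun ξ => ?_, fun ξ => (hsum ξ).hasSum⟩
  rw [one_mul]
  exact le_of_tendsto (hsum ξ).hasSum.norm (Filter.Eventually.of_forall fun F => hle F ξ)

namespace IsRealVN

variable {𝒜 : StarSubalgebra ℝ (H →L[ℂ] H)} (hA : IsRealVN 𝒜)
include hA

theorem exists_sum {S : Set (H →L[ℂ] H)} (hS : S ⊆ 𝒜) (hs : ∀ s ∈ S, PIso s)
    (ho : S.Pairwise Orth) :
    ∃ w ∈ 𝒜, PIso w ∧ (∀ t ∈ S, t * star w = t * star t ∧ star t * w = star t * t) ∧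
      (∀ y : H →L[ℂ] H, (∀ s ∈ S, y * s = 0) → y * w = 0) ∧
      ∀ y : H →L[ℂ] H, (∀ s ∈ S, s * y = 0) → w * y = 0 := by
  have ho' : Pairwise fun i j : S => Orth (i : H →L[ℂ] H) j := fun i j hij =>
    ho i.2 j.2 fun h => hij (Subtype.ext h)
  obtain ⟨w, hw⟩ := PIso.exists_tsum (fun i : S => (i : H →L[ℂ] H)) (fun i => hs i i.2) ho'
  have h1 : ∀ t ∈ S, w * star t = t * star t := by
    intro t ht
    ext ξ
    refine (hw (star t ξ)).unique (hasSum_single (⟨t, ht⟩ : S) fun s hst => ?_)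
    show ((s : H →L[ℂ] H) * star t) ξ = 0
    rw [(ho' hst).2, zero_apply]
  have h2 : ∀ t ∈ S, star t * w = star t * t := by
    intro t ht
    ext ξ
    refine ((hw ξ).mapL (star t)).unique (hasSum_single (⟨t, ht⟩ : S) fun s hst => ?_)
    show (star t * (s : H →L[ℂ] H)) ξ = 0
    rw [(ho' hst).symm.1, zero_apply]
  have h3 : ∀ y : H →L[ℂ] H, (∀ s ∈ S, y * s = 0) → y * w = 0 := by
    intro y hy
    ext ξ
    refine ((hw ξ).mapL y).unique ?_
    convert hasSum_zero using 2 with s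
    · show (y * (s : H →L[ℂ] H)) ξ = 0
      rw [hy s s.2, zero_apply]
    · rfl
  have h4 : ∀ ξ, (∀ s ∈ S, s ξ = 0) → w ξ = 0 := by
    intro ξ hξ
    refine (hw ξ).unique ?_
    convert hasSum_zero using 2 with s
    exact hξ s s.2
  have h5 : ∀ t ∈ S, star w * t = star t * t := fun t ht => by
    have := congrArg star (h2 t ht)
    simpa only [star_mul, star_star] using this
  refine ⟨w, ?_, ?_, fun t ht => ⟨?_, h2 t ht⟩, h3, fun y hy => ?_⟩
  · refine hA.glue w (star '' S) ?_ ?_ ?_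
    · rintro _ ⟨s, hs, rfl⟩
      exact star_mem (hS hs)
    · rintro _ ⟨s, hs, rfl⟩
      rw [h1 s hs]
      exact mul_mem (hS hs) (star_mem (hS hs))
    · intro ξ hξ
      refine h4 ξ fun s hs => ?_
      simpa only [star_star] using hξ (star s) ⟨s, hs, rfl⟩
  · have := h3 (w * star w - 1) fun s hs' => by
      rw [sub_mul, mul_assoc, h5 s hs', ← mul_assoc, h1 s hs', hs s hs', one_mul, sub_self]
    rwa [sub_mul, one_mul, sub_eq_zero] at this
  · have := congrArg star (h1 t ht)
    simpa only [star_mul, star_star] using this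
  · ext ξ
    exact h4 (y ξ) fun s hs => by rw [← op_mul_apply s, hy s hs, zero_apply]

theorem exists_pIso_under {b : H →L[ℂ] H} (hb : b ∈ 𝒜) (hb0 : b ≠ 0) :
    ∃ v ∈ 𝒜, PIso v ∧ v ≠ 0 ∧ Under v b := by
  obtain ⟨v, hvA, p, hpA, hp, hvv, hvp, hpc, hpmin, hvc, hvx⟩ := hA.exists_polar hb
  have hcs := (CFC.abs_nonneg b).isSelfAdjoint
  generalize CFC.abs b = c at *
  refine ⟨v, hvA, .of_isStarProjection (by rw [hvv, hp.mul_self]), ?_, fun y hy => ?_,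
    fun y hy => ?_⟩
  · rintro rfl
    exact hb0 (by rw [← hvc, zero_mul])
  · have : y * v * p = 0 := hpmin _ (by rw [mul_assoc, hvc, hy])
    rwa [mul_assoc, hvp] at this
  · have hcy : c * y = 0 := by rw [← hvx, mul_assoc, hy, mul_zero]
    have h1 : star y * c = 0 := by
      have := congrArg star hcy
      rwa [star_mul, hcs.star_eq, star_zero] at this
    have := congrArg star (hpmin _ h1)
    rw [star_mul, star_star, hp.star_eq, star_zero] at this
    rw [← hvp, mul_assoc, this, mul_zero]

theorem exists_maximal {e : H →L[ℂ] H} (he : PIso e) :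
    ∃ w ∈ 𝒜, Orth e w ∧ PIso (e + w) ∧ ∀ b ∈ 𝒜, Orth (e + w) b → b = 0 := by
  obtain ⟨S, hS⟩ := zorn_subset {S : Set (H →L[ℂ] H) | (S ⊆ 𝒜 ∧
      ∀ s ∈ S, PIso s ∧ s ≠ 0 ∧ Orth e s) ∧ S.Pairwise Orth} (by
    intro C hC hchain
    refine ⟨⋃₀ C, ⟨⟨Set.sUnion_subset fun s hs => (hC hs).1.1, ?_⟩,
      hchain.pairwise_sUnion.2 fun s hs => (hC hs).2⟩, fun s hs => Set.subset_sUnion_of_mem hs⟩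
    rintro s ⟨t, ht, hst⟩
    exact (hC ht).1.2 s hst)
  obtain ⟨⟨⟨hSA, hSp⟩, hSo⟩, hmax⟩ := hS
  obtain ⟨w, hwA, hw, h1, h2, h3⟩ := hA.exists_sum hSA (fun s hs => (hSp s hs).1) hSo
  have hew : Orth e w := by
    refine ⟨h2 _ fun s hs => (hSp s hs).2.2.1, ?_⟩
    have := h3 (star e) fun s hs => (hSp s hs).2.2.symm.2
    have := congrArg star this
    simpa only [star_mul, star_star, star_zero] using this
  refine ⟨w, hwA, hew, he.add hw hew, fun b hbA hb => ?_⟩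
  by_contra hb0
  have heb : Orth e b := he.orth_of_orth_add hew hb
  have hwb : Orth w b := hw.orth_of_orth_add hew.symm (by rwa [add_comm])
  have hsb : ∀ s ∈ S, Orth s b := fun s hs => by
    have hsp := (hSp s hs).1
    constructor
    · rw [← hsp.star_mul_mul_star, ← (h1 s hs).1, mul_assoc, mul_assoc, hwb.1, mul_zero, mul_zero]
    · rw [← hsp.mul_star_mul, ← (h1 s hs).2, mul_assoc, mul_assoc, hwb.2, mul_zero, mul_zero]
  obtain ⟨v, hvA, hv, hv0, hvb⟩ := hA.exists_pIso_under hbA hb0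
  have hsv : ∀ s ∈ S, Orth s v := fun s hs => (hsb s hs).under_right hvb
  have hvS : v ∈ S := by
    refine hmax ⟨⟨?_, ?_⟩, ?_⟩ (Set.subset_insert v S) (Set.mem_insert v S)
    · exact Set.insert_subset hvA hSA
    · rintro s (rfl | hs)
      · exact ⟨hv, hv0, heb.under_right hvb⟩
      · exact hSp s hs
    · refine hSo.insert fun s hs _ => ⟨(hsv s hs).symm, hsv s hs⟩
  have hvv := (hsv v hvS).1
  exact hv0 (by rw [← hv.mul_star_mul, hvv, mul_zero])

end IsRealVN

end Operators

/-! ### Central projections and spectral dichotomy -/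

section Operators

open ContinuousLinearMap
open scoped ComplexInnerProductSpace

variable {H : Type*} [NormedAddCommGroup H] [InnerProductSpace ℂ H] [CompleteSpace H]

theorem smul_le_iff_re_inner {b p : H →L[ℂ] H} (hb : IsSelfAdjoint b) (hp : IsStarProjection p)
    (l : ℝ) : l • p ≤ b ↔ ∀ ξ, l * ‖p ξ‖ ^ 2 ≤ ⟪b ξ, ξ⟫.re := by
  have key : ∀ ξ, ⟪(l • p) ξ, ξ⟫.re = l * ‖p ξ‖ ^ 2 := fun ξ => by
    rw [smul_apply, ← Complex.coe_smul, inner_smul_left, Complex.conj_ofReal,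
      Complex.re_ofReal_mul, hp.inner_self]
  refine ⟨fun h ξ => by rw [← key]; exact re_inner_mono h ξ, fun h => ?_⟩
  refine le_of_re_inner ?_ hb fun ξ => by rw [key]; exact h ξ
  rw [IsSelfAdjoint, star_smul, hp.star_eq, star_trivial]

theorem le_smul_iff_re_inner {b p : H →L[ℂ] H} (hb : IsSelfAdjoint b) (hp : IsStarProjection p)
    (l : ℝ) : b ≤ l • p ↔ ∀ ξ, ⟪b ξ, ξ⟫.re ≤ l * ‖p ξ‖ ^ 2 := by
  have := smul_le_iff_re_inner hb.neg hp (-l)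
  rw [neg_smul, neg_le_neg_iff] at this
  rw [this]
  simp

theorem exists_eq_smul_of_forall {b p : H →L[ℂ] H} (hb : IsSelfAdjoint b) (hp : IsStarProjection p)
    (hpb : p * b = b) (hbp : b * p = b) (h : ∀ l : ℝ, l • p ≤ b ∨ b ≤ l • p) :
    ∃ c : ℝ, b = c • p := by
  by_cases hp0 : p = 0
  · exact ⟨0, by rw [← hpb, hp0, zero_mul, smul_zero]⟩
  obtain ⟨ξ, hξ⟩ : ∃ ξ, p ξ ≠ 0 := by
    by_contra hcon
    push Not at hcon
    exact hp0 (by ext ξ; exact hcon ξ)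
  have hξ0 : 0 < ‖p ξ‖ ^ 2 := by have := norm_pos_iff.2 hξ; positivity
  have hbound : |⟪b ξ, ξ⟫.re| ≤ ‖b‖ * ‖p ξ‖ ^ 2 := by
    have e : ⟪b ξ, ξ⟫ = ⟪b (p ξ), p ξ⟫ := by
      rw [← inner_star_left p, hp.star_eq, ← op_mul_apply b, hbp, ← op_mul_apply p, hpb]
    rw [e]
    refine (Complex.abs_re_le_norm _).trans ((norm_inner_le_norm _ _).trans ?_)
    rw [sq, ← mul_assoc]
    gcongr
    exact b.le_opNorm _
  rw [abs_le] at hbound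
  set L : Set ℝ := {l | l • p ≤ b} with hL
  have hLb : BddAbove L := ⟨‖b‖, fun l hl => by
    have := (smul_le_iff_re_inner hb hp l).1 hl ξ
    by_contra hcon
    push Not at hcon
    nlinarith [hbound.2]⟩
  have hLn : L.Nonempty := by
    refine ⟨-‖b‖ - 1, (h _).resolve_right fun hcon => ?_⟩
    have := (le_smul_iff_re_inner hb hp _).1 hcon ξ
    nlinarith [hbound.1]
  refine ⟨sSup L, le_antisymm ?_ ?_⟩
  · refine (le_smul_iff_re_inner hb hp _).2 fun η => ?_
    refine le_of_forall_pos_le_add fun ε hε => ?_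
    set δ := ε / (‖p η‖ ^ 2 + 1) with hδ
    have hδ0 : 0 < δ := by positivity
    have hδε : δ * ‖p η‖ ^ 2 ≤ ε := by
      rw [hδ, div_mul_eq_mul_div, div_le_iff₀ (by positivity)]
      nlinarith
    have h1 : b ≤ (sSup L + δ) • p := (h _).resolve_left fun hcon => by
      have := le_csSup hLb hcon
      linarith
    have := (le_smul_iff_re_inner hb hp _).1 h1 η
    linarith
  · refine (smul_le_iff_re_inner hb hp _).2 fun η => ?_
    refine le_of_forall_pos_le_add fun ε hε => ?_
    set δ := ε / (‖p η‖ ^ 2 + 1) with hδ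
    have hδ0 : 0 < δ := by positivity
    have hδε : δ * ‖p η‖ ^ 2 ≤ ε := by
      rw [hδ, div_mul_eq_mul_div, div_le_iff₀ (by positivity)]
      nlinarith
    obtain ⟨l, hl, hlt⟩ := exists_lt_of_lt_csSup hLn (show sSup L - δ < sSup L by linarith)
    have h1 := (smul_le_iff_re_inner hb hp _).1 hl η
    nlinarith [sq_nonneg ‖p η‖]

namespace IsRealVN

variable {𝒜 : StarSubalgebra ℝ (H →L[ℂ] H)} (hA : IsRealVN 𝒜)
include hA

theorem eq_smul_or {b p : H →L[ℂ] H} (hbA : b ∈ 𝒜) (hpA : p ∈ 𝒜) (hb : IsSelfAdjoint b)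
    (hp : IsStarProjection p) (hpb : p * b = b) (hbp : b * p = b) :
    (∃ c : ℝ, b = c • p) ∨ ∃ g ∈ 𝒜, IsStarProjection g ∧ g * p = g ∧ p * g = g ∧ g ≠ 0 ∧ g ≠ p ∧
      g * b = b * g := by
  by_cases h : ∃ g ∈ 𝒜, IsStarProjection g ∧ g * p = g ∧ p * g = g ∧ g ≠ 0 ∧ g ≠ p ∧
      g * b = b * g
  · exact .inr h
  refine .inl (exists_eq_smul_of_forall hb hp hpb hbp fun l => ?_)
  obtain ⟨g, hgA, hg, hpg, hgp, hgb, h1, h2⟩ := hA.exists_cut hbA hb hpA hp (by rw [hpb, hbp]) l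
  by_cases hg0 : g = 0
  · right
    rwa [hg0, sub_zero, hbp] at h2
  by_cases hgp' : g = p
  · left
    rwa [hgp', hbp] at h1
  · exact (h ⟨g, hgA, hg, hgp, hpg, hg0, hgp', hgb⟩).elim

theorem exists_central {x y : H →L[ℂ] H} (hyA : y ∈ 𝒜) (hx : x ≠ 0) (hy : y ≠ 0)
    (h : ∀ a ∈ 𝒜, x * a * y = 0) :
    ∃ z ∈ 𝒜, IsStarProjection z ∧ z ≠ 0 ∧ z ≠ 1 ∧ ∀ a ∈ 𝒜, z * a = a * z := by
  obtain ⟨z, hzA, hz, hzS, hzmin⟩ := hA.exists_support (S := {s | ∃ a ∈ 𝒜, s = a * y}) (by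
    rintro _ ⟨a, ha, rfl⟩
    exact mul_mem ha hyA)
  have hxz : x * z = 0 := hzmin x (by
    rintro _ ⟨a, ha, rfl⟩
    rw [← mul_assoc, h a ha])
  have hzy : z * y = y := hzS y ⟨1, one_mem _, (one_mul y).symm⟩
  have key : ∀ a ∈ 𝒜, a * z = z * a * z := fun a ha => by
    have := hzmin ((1 - z) * a) (by
      rintro _ ⟨a', ha', rfl⟩
      rw [sub_mul, one_mul, sub_mul, mul_assoc z, hzS _ ⟨a * a', mul_mem ha ha', (mul_assoc _ _ _).symm⟩,
        sub_self])
    rwa [sub_mul, one_mul, sub_mul, sub_eq_zero] at this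
  refine ⟨z, hzA, hz, ?_, ?_, fun a ha => ?_⟩
  · rintro rfl
    exact hy (by rw [← hzy, zero_mul])
  · rintro rfl
    exact hx (by rw [← hxz, mul_one])
  · have := congrArg star (key (star a) (star_mem ha))
    simp only [star_mul, star_star, hz.star_eq] at this
    rw [this, ← mul_assoc, ← key a ha]

end IsRealVN

/-! ### The Peirce geometry of a real von Neumann algebra -/

theorem Orth.coe_iff {𝒜 : StarSubalgebra ℝ (H →L[ℂ] H)} {x y : 𝒜} :
    Orth (x : H →L[ℂ] H) y ↔ Orth x y := by
  simp only [Orth, Subtype.ext_iff]; rfl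

theorem PIso.coe_iff {𝒜 : StarSubalgebra ℝ (H →L[ℂ] H)} {e : 𝒜} :
    PIso (e : H →L[ℂ] H) ↔ PIso e := by
  simp only [PIso, Subtype.ext_iff]; rfl

theorem IsStarProjection.coe_iff {𝒜 : StarSubalgebra ℝ (H →L[ℂ] H)} {e : 𝒜} :
    IsStarProjection (e : H →L[ℂ] H) ↔ IsStarProjection e := by
  refine ⟨fun h => .of_mul_eq ?_ ?_, fun h => .of_mul_eq ?_ ?_⟩
  · exact Subtype.ext h.mul_self
  · exact Subtype.ext h.star_eq
  · exact congrArg Subtype.val h.mul_self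
  · exact congrArg Subtype.val h.star_eq

theorem Under.of_coe {𝒜 : StarSubalgebra ℝ (H →L[ℂ] H)} {e x : 𝒜}
    (h : Under (e : H →L[ℂ] H) x) : Under e x :=
  ⟨fun y hy => Subtype.ext (h.1 y (congrArg Subtype.val hy)),
    fun y hy => Subtype.ext (h.2 y (congrArg Subtype.val hy))⟩

end Operators

section Operators

open ContinuousLinearMap
open scoped ComplexInnerProductSpace

variable {H : Type*} [NormedAddCommGroup H] [InnerProductSpace ℂ H] [CompleteSpace H]

theorem IsRealVN.hasProjections {𝒜 : StarSubalgebra ℝ (H →L[ℂ] H)} (hA : IsRealVN 𝒜) :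
    HasProjections 𝒜 where
  exists_central x y hx hy h := by
    obtain ⟨z, hzA, h1, h2, h3, h4⟩ := hA.exists_central y.2 (x := x)
      (fun h0 => hx (Subtype.ext h0)) (fun h0 => hy (Subtype.ext h0))
      fun a ha => congrArg Subtype.val (h ⟨a, ha⟩)
    exact ⟨⟨z, hzA⟩, IsStarProjection.coe_iff.1 h1, fun h0 => h2 (congrArg Subtype.val h0),
      fun h0 => h3 (congrArg Subtype.val h0), fun a => Subtype.ext (h4 a a.2)⟩
  eq_smul_or b p hb hp hpb hbp := by
    rcases hA.eq_smul_or b.2 p.2 (congrArg Subtype.val hb.star_eq) (IsStarProjection.coe_iff.2 hp)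
      (congrArg Subtype.val hpb) (congrArg Subtype.val hbp) with ⟨c, hc⟩ |
      ⟨g, hgA, h1, h2, h3, h4, h5, h6⟩
    · exact .inl ⟨c, Subtype.ext hc⟩
    · exact .inr ⟨⟨g, hgA⟩, IsStarProjection.coe_iff.1 h1, Subtype.ext h2, Subtype.ext h3,
        fun h0 => h4 (congrArg Subtype.val h0), fun h0 => h5 (congrArg Subtype.val h0),
        Subtype.ext h6⟩
  nonneg x s c hs hs0 h := by
    have h' : star (x : H →L[ℂ] H) * x = c • (s : H →L[ℂ] H) := by
      simpa using congrArg 𝒜.subtype h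
    exact nonneg_of_star_mul_self_eq (IsStarProjection.coe_iff.2 hs)
      (fun h0 => hs0 (Subtype.ext h0)) h'
  mul_eq_of_four h g hh hg h4 := by
    have h' : star ((1 + (h : H →L[ℂ] H)) * g) * ((1 + (h : H →L[ℂ] H)) * g) =
        (4 : ℝ) • (g : H →L[ℂ] H) := by
      simpa using congrArg 𝒜.subtype h4
    have := mul_eq_of_four hh (IsStarProjection.coe_iff.2 hg) h'
    exact Subtype.ext this
  star_mul_mul_eq z k hz hk h := by
    have h' : star ((z : H →L[ℂ] H) * k) * ((z : H →L[ℂ] H) * k) = (k : H →L[ℂ] H) := by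
      simpa using congrArg 𝒜.subtype h
    have := star_mul_mul_eq hz (IsStarProjection.coe_iff.2 hk) h'
    exact Subtype.ext this

theorem IsRealVN.hasPeirceGeometry {𝒜 : StarSubalgebra ℝ (H →L[ℂ] H)} (hA : IsRealVN 𝒜) :
    HasPeirceGeometry 𝒜 where
  norm_add_le x y h := hA.norm_add_le x.2 (Orth.coe_iff.2 h)
  peel x hx ε hε := by
    obtain ⟨e, he, b, hb, h1, h2, h3, h4, h5, h6, h7⟩ := hA.exists_peel x.2 hx hε
    exact ⟨⟨e, he⟩, ⟨b, hb⟩, fun h0 => h1 (congrArg Subtype.val h0), PIso.coe_iff.1 h2,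
      Orth.coe_iff.1 h3, h4, h5, Under.of_coe h6, Under.of_coe h7⟩
  mem_of_isClosed x G hG h1 h2 := by
    rw [← hG.closure_eq, Metric.mem_closure_iff]
    intro ε hε
    obtain ⟨y, hyA, hy, hxy⟩ := hA.mem_closure_of_pIso x.2 (Subtype.val '' G)
      (fun e he hep heu c => by
        have hep' : PIso (⟨e, he⟩ : 𝒜) := PIso.coe_iff.1 hep
        have heu' : Under (⟨e, he⟩ : 𝒜) x := Under.of_coe heu
        exact ⟨c • (⟨e, he⟩ : 𝒜), h1 _ hep' heu' c, 𝒜.toSubalgebra.coe_smul c ⟨e, he⟩⟩)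
      (by
        rintro _ - _ - ⟨y, hy, rfl⟩ ⟨z, hz, rfl⟩ hyz
        exact ⟨y + z, h2 y hy z hz (Orth.coe_iff.1 hyz), rfl⟩) (half_pos hε)
    obtain ⟨y, hy, rfl⟩ := hy
    refine ⟨y, hy, ?_⟩
    rw [dist_eq_norm]
    exact lt_of_le_of_lt hxy (half_lt_self hε)
  orth_of_face e x he _ hx h := by
    have := IsRealVN.orth_of_face e.2 x.2 (PIso.coe_iff.2 he) hx fun y hyA hy1 hy2 => by
      have := h ⟨y, hyA⟩ hy1 hy2
      exact this
    have e1 : (x : H →L[ℂ] H) - e = ((x - e : 𝒜) : H →L[ℂ] H) := rfl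
    rw [e1] at this
    exact Orth.coe_iff.1 this
  exists_maximal e he := by
    obtain ⟨w, hwA, h1, h2, h3⟩ := hA.exists_maximal (PIso.coe_iff.2 he)
    lift w to 𝒜 using hwA
    rw [← 𝒜.coe_add e w] at h2 h3
    rw [PIso.coe_iff] at h2
    refine ⟨w, Orth.coe_iff.1 h1, h2, fun b hb => Subtype.ext (h3 b b.2 ?_)⟩
    rwa [Orth.coe_iff]
  orth_of_norm_le u c hu h1 h2 := by
    have h1' : ‖(c : H →L[ℂ] H) + u‖ ≤ 1 := h1
    have h2' : ‖(c : H →L[ℂ] H) - u‖ ≤ 1 := h2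
    have := _root_.orth_of_norm_le (PIso.coe_iff.2 hu) h1' h2'
    exact Orth.coe_iff.1 this

end Operators

section Operators

open ContinuousLinearMap
open scoped ComplexInnerProductSpace

variable {H : Type*} [NormedAddCommGroup H] [InnerProductSpace ℂ H] [CompleteSpace H]

theorem isRealVN_top : IsRealVN (⊤ : StarSubalgebra ℝ (H →L[ℂ] H)) where
  glue _ _ _ _ _ := trivial
  abs_mem _ _ := trivial

/-- The projection onto the closed span of the ranges of a family of operators. -/
theorem exists_range_projection (S : Set (H →L[ℂ] H)) :
    ∃ p : H →L[ℂ] H, IsStarProjection p ∧ (∀ s ∈ S, p * s = s) ∧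
      (∀ y : H →L[ℂ] H, (∀ s ∈ S, y * s = 0) → y * p = 0) ∧
      (∀ η, (∀ s ∈ S, star s η = 0) → p η = 0) ∧
      ∀ U : H →L[ℂ] H, (∀ ξ, (∀ s ∈ S, star s ξ = 0) → U ξ = 0) → U * p = U := by
  obtain ⟨p, -, hp, hps, hmin⟩ := isRealVN_top.exists_support (H := H) (S := S) fun _ _ => trivial
  refine ⟨p, hp, hps, hmin, fun η hη => ?_, fun U hU => ?_⟩
  · have h1 : ((innerSL ℂ η).smulRight η) * p = 0 := hmin _ fun s hs => by
      ext ξ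
      show ⟪η, s ξ⟫ • η = 0
      rw [← inner_star_left, hη s hs, inner_zero_left, zero_smul]
    have h2 : ⟪η, p η⟫ • η = 0 := congrArg (fun y : H →L[ℂ] H => y η) h1
    rcases smul_eq_zero.1 h2 with h3 | h3
    · have h4 := hp.inner_self η
      rw [← inner_conj_symm, h3] at h4
      simpa using h4.symm
    · rw [h3, map_zero]
  · have h : U * (1 - p) = 0 := by
      ext ξ
      refine hU _ fun s hs => ?_
      show (star s * (1 - p)) ξ = 0
      have := congrArg star (hps s hs)
      rw [star_mul, hp.star_eq] at this
      rw [mul_sub, mul_one, this, sub_self]; rfl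
    rw [mul_sub, mul_one, sub_eq_zero] at h
    exact h.symm

namespace VonNeumannAlgebra

theorem mem_of_commute {M : VonNeumannAlgebra H} {x : H →L[ℂ] H}
    (h : ∀ y ∈ M.commutant, Commute x y) : x ∈ M := by
  rw [← M.commutant_commutant, mem_commutant_iff]
  exact fun y hy => (h y hy).eq.symm

theorem commute_of_mem {M : VonNeumannAlgebra H} {x y : H →L[ℂ] H} (hx : x ∈ M)
    (hy : y ∈ M.commutant) : Commute x y :=
  mem_commutant_iff.1 hy x hx

theorem mem_of_mul_mem {M : VonNeumannAlgebra H} {U : H →L[ℂ] H} {S : Set (H →L[ℂ] H)}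
    (hS : ∀ s ∈ S, s ∈ M) (hU : ∀ s ∈ S, U * s ∈ M)
    (h0 : ∀ ξ, (∀ s ∈ S, star s ξ = 0) → U ξ = 0) : U ∈ M := by
  refine mem_of_commute fun y hy => ?_
  obtain ⟨p, hp, hps, hmin, -, hker⟩ := exists_range_projection S
  have h1 : (U * y - y * U) * p = 0 := hmin _ fun s hs => by
    rw [sub_mul, mul_assoc, ← (commute_of_mem (hS s hs) hy).eq, ← mul_assoc,
      (commute_of_mem (hU s hs) hy).eq, mul_assoc, sub_self]
  have h2 : (U * y - y * U) * p = U * y - y * U := hker _ fun ξ hξ => by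
    have h3 : U (y ξ) = 0 := h0 _ fun s hs => by
      rw [← op_mul_apply, (commute_of_mem (star_mem (hS s hs)) hy).eq, op_mul_apply, hξ s hs,
        map_zero]
    rw [sub_apply, op_mul_apply, op_mul_apply, h3, h0 ξ hξ, map_zero, sub_self]
  exact sub_eq_zero.1 (h2.symm.trans h1)

theorem cfcAbs_mem {M : VonNeumannAlgebra H} {x : H →L[ℂ] H} (hx : x ∈ M) : CFC.abs x ∈ M :=
  mem_of_commute fun _ hy =>
    Commute.cfcAbs_left (commute_of_mem hx hy) (commute_of_mem hx (star_mem hy))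

theorem sqrt_mem {M : VonNeumannAlgebra H} {x : H →L[ℂ] H} (hx : x ∈ M) : CFC.sqrt x ∈ M :=
  mem_of_commute fun _ hy => by
    rw [CFC.sqrt_eq_cfc]
    exact (commute_of_mem hx hy).cfc_nnreal _

end VonNeumannAlgebra

open VonNeumannAlgebra in
/-- The fixed points of a conjugate-linear involution of a von Neumann algebra. -/
theorem exists_isRealVN (M : VonNeumannAlgebra H) (J : (H →L[ℂ] H) → (H →L[ℂ] H))
    (hJmem : ∀ x ∈ M, J x ∈ M)
    (hJmul : ∀ x ∈ M, ∀ y ∈ M, J (x * y) = J x * J y)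
    (hJstar : ∀ x ∈ M, J (star x) = star (J x))
    (hJsq : ∀ x ∈ M, J (J x) = x)
    (A : Submodule ℝ (H →L[ℂ] H))
    (hA : ∀ x, x ∈ A ↔ x ∈ M ∧ J x = x) :
    ∃ 𝒜 : StarSubalgebra ℝ (H →L[ℂ] H), IsRealVN 𝒜 ∧ ∀ x, x ∈ 𝒜 ↔ x ∈ A := by
  have hM1 : (1 : H →L[ℂ] H) ∈ M := one_mem M
  have h1 : J 1 = 1 := by
    have h := hJmul 1 hM1 (J 1) (hJmem 1 hM1)
    rw [one_mul, hJsq 1 hM1, mul_one] at h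
    exact h.symm
  let 𝒜 : StarSubalgebra ℝ (H →L[ℂ] H) :=
    { carrier := A
      mul_mem' := fun {x y} hx hy => by
        obtain ⟨hx, hx'⟩ := (hA x).1 hx
        obtain ⟨hy, hy'⟩ := (hA y).1 hy
        exact (hA _).2 ⟨mul_mem hx hy, by rw [hJmul x hx y hy, hx', hy']⟩
      add_mem' := fun hx hy => A.add_mem hx hy
      algebraMap_mem' := fun r => by
        rw [Algebra.algebraMap_eq_smul_one]
        exact A.smul_mem r ((hA 1).2 ⟨hM1, h1⟩)
      star_mem' := fun {x} hx => by
        obtain ⟨hx, hx'⟩ := (hA x).1 hx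
        exact (hA _).2 ⟨star_mem hx, by rw [hJstar x hx, hx']⟩ }
  have hmem : ∀ x, x ∈ 𝒜 ↔ x ∈ A := fun x => Iff.rfl
  refine ⟨𝒜, ⟨fun U S hS hUS h0 => ?_, fun x hx => ?_⟩, hmem⟩
  · have hSM : ∀ s ∈ S, s ∈ M := fun s hs => ((hA s).1 (hS hs)).1
    have hSJ : ∀ s ∈ S, J s = s := fun s hs => ((hA s).1 (hS hs)).2
    have hU : U ∈ M := mem_of_mul_mem hSM (fun s hs => ((hA _).1 (hUS s hs)).1) h0
    obtain ⟨p, hp, hps, hmin, hp0, hker⟩ := exists_range_projection S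
    have hpM : p ∈ M := mem_of_mul_mem hSM (fun s hs => by rw [hps s hs]; exact hSM s hs) hp0
    have hqs : ∀ s ∈ S, J p * s = s := fun s hs => by
      have := hJmul p hpM s (hSM s hs)
      rwa [hps s hs, hSJ s hs, eq_comm] at this
    have hqp : J p * p = p := by
      have h : (J p - 1) * p = 0 := hmin _ fun s hs => by
        rw [sub_mul, hqs s hs, one_mul, sub_self]
      rwa [sub_mul, one_mul, sub_eq_zero] at h
    have hpq : p * J p = J p := by
      have := congrArg J hqp
      rwa [hJmul _ (hJmem p hpM) p hpM, hJsq p hpM] at this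
    have hJp : J p = p := by
      have h := congrArg star hpq
      rw [star_mul, ← hJstar p hpM, hp.star_eq, hqp] at h
      exact h.symm
    have hUp : U * p = U := hker U h0
    have hJU : J U * p = J U := by
      have := hJmul U hU p hpM
      rw [hUp, hJp] at this
      exact this.symm
    have h : (J U - U) * p = 0 := hmin _ fun s hs => by
      have := hJmul U hU s (hSM s hs)
      rw [((hA _).1 (hUS s hs)).2, hSJ s hs] at this
      rw [sub_mul, ← this, sub_self]
    rw [sub_mul, hJU, hUp, sub_eq_zero] at h
    exact (hA U).2 ⟨hU, h⟩
  · obtain ⟨hx, hx'⟩ := (hA x).1 hx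
    have haM := cfcAbs_mem hx
    have ha0 : 0 ≤ CFC.abs x := CFC.abs_nonneg x
    have hsM := sqrt_mem haM
    have hs0 : star (CFC.sqrt (CFC.abs x)) = CFC.sqrt (CFC.abs x) :=
      (CFC.sqrt_nonneg _).isSelfAdjoint.star_eq
    have hJa : 0 ≤ J (CFC.abs x) := by
      have h := hJmul _ hsM _ hsM
      rw [CFC.sqrt_mul_sqrt_self _ ha0] at h
      rw [h]
      nth_rw 1 [← hs0]
      rw [hJstar _ hsM]
      exact star_mul_self_nonneg _
    have hJJ : J (CFC.abs x) * J (CFC.abs x) = star x * x := by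
      rw [← hJmul _ haM _ haM, CFC.abs_mul_abs, hJmul _ (star_mem hx) _ hx, hJstar x hx, hx']
    refine (hA _).2 ⟨haM, ?_⟩
    rw [← CFC.sqrt_unique hJJ hJa, CFC.sqrt_unique (CFC.abs_mul_abs x) ha0]

end Operators

/-- Sphere isometries of a normed space isometric to such a ring extend linearly. -/
theorem HasPeirceGeometry.exists_linearIsometry_of_image {R : Type*} [NormedRing R]
    [NormedAlgebra ℝ R] [StarRing R] [CStarRing R] [StarModule ℝ R] (hR : HasPeirceGeometry R)
    (hP : HasProjections R) {X Y : Type*} [NormedAddCommGroup X] [NormedSpace ℝ X]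
    [NormedAddCommGroup Y] [NormedSpace ℝ Y] (e : X ≃ₗᵢ[ℝ] R) (T : X → Y)
    (hT : ∀ x ∈ Metric.sphere (0 : X) 1, ∀ y ∈ Metric.sphere (0 : X) 1,
      dist (T x) (T y) = dist x y)
    (himg : T '' Metric.sphere (0 : X) 1 = Metric.sphere (0 : Y) 1) :
    ∃ g : X →ₗᵢ[ℝ] Y, Function.Surjective g ∧ ∀ x ∈ Metric.sphere (0 : X) 1, g x = T x := by
  simp only [mem_sphere_zero_iff_norm] at hT ⊢
  have hT' : IsSphereIsometry (T ∘ e.symm) :=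
    { norm_sub := fun x y hx hy => by
        have h := hT (e.symm x) (by simpa using hx) (e.symm y) (by simpa using hy)
        rw [e.symm.dist_map] at h
        simpa [dist_eq_norm] using h
      norm_map := fun x hx => by
        have h : T (e.symm x) ∈ Metric.sphere (0 : Y) 1 :=
          himg ▸ Set.mem_image_of_mem T (by simpa using hx)
        simpa using h
      surj := fun y hy => by
        have h : y ∈ T '' Metric.sphere (0 : X) 1 := himg ▸ by simpa using hy
        obtain ⟨x, hx, rfl⟩ := h
        exact ⟨e x, by simpa using hx, by simp⟩ }
  obtain ⟨g, hg, h⟩ := hR.exists_linearIsometry_of_sphere hP hT'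
  exact ⟨g.comp e.toLinearIsometry, hg.comp e.surjective, fun x hx => by
    simpa using h (e x) (by simpa using hx)⟩

/-- Every real von Neumann algebra, i.e. the fixed-point set `A = {x ∈ M : J x = x}` of a
conjugate-linear *-automorphism `J` with `J² = id` on a von Neumann algebra `M` acting on a
complex Hilbert space `H`, regarded as a real Banach space, has the Mazur–Ulam property. -/
theorem realVonNeumannAlgebra_hasMazurUlamProperty
    (H : Type*) [NormedAddCommGroup H] [InnerProductSpace ℂ H] [CompleteSpace H]
    (M : VonNeumannAlgebra H) (J : (H →L[ℂ] H) → (H →L[ℂ] H))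
    (hJmem : ∀ x ∈ M, J x ∈ M)
    (hJadd : ∀ x ∈ M, ∀ y ∈ M, J (x + y) = J x + J y)
    (hJsmul : ∀ (c : ℂ), ∀ x ∈ M, J (c • x) = (starRingEnd ℂ c) • J x)
    (hJmul : ∀ x ∈ M, ∀ y ∈ M, J (x * y) = J x * J y)
    (hJstar : ∀ x ∈ M, J (star x) = star (J x))
    (hJsq : ∀ x ∈ M, J (J x) = x)
    (A : Submodule ℝ (H →L[ℂ] H))
    (hA : ∀ x, x ∈ A ↔ x ∈ M ∧ J x = x) :
    HasMazurUlamProperty A := by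
  obtain ⟨𝒜, h𝒜, hmem⟩ := exists_isRealVN M J hJmem hJmul hJstar hJsq A hA
  let e : A ≃ₗᵢ[ℝ] 𝒜 :=
    { toFun := fun x => ⟨x, (hmem x).2 x.2⟩
      invFun := fun x => ⟨x, (hmem x).1 x.2⟩
      map_add' := fun _ _ => rfl
      map_smul' := fun _ _ => rfl
      left_inv := fun _ => rfl
      right_inv := fun _ => rfl
      norm_map' := fun _ => rfl }
  intro Y _ _ T hT himg
  exact h𝒜.hasPeirceGeometry.exists_linearIsometry_of_image h𝒜.hasProjections e T hT himg
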